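/- Let ε₀ > 0 and let g be a holomorphic function on the open ball B(0, ε₀) ⊆ ℂⁿ with g(0) = 0 and g not identically zero. Set S = { x ∈ B(0, ε₀) : g(x) = 0 }. Let (ε_d)_{d ≥ 1} be any sequence of real numbers with 0 < ε_d ≤ ε₀, and define U_d = { x ∈ ℂⁿ : ‖x‖ < ε_d and dist(x, S) > ‖x‖^d } and U = ⋃_{d ≥ 1} U_d. Then every bounded holomorphic function f on U (i.e. f holomorphic on the open set U with ‖f(x)‖ ≤ C for some constant C and all x ∈ U) has a holomorphic extension in a neighborhood of 0: there exist δ > 0 and a holomorphic function F on B(0, δ) such that F(x) = f(x) for all x ∈ U ∩ B(0, δ). -/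

import Mathlib

open Set Filter Topology Metric

/-- Second order Taylor estimate for a bounded holomorphic map. -/
theorem norm_sub_sub_fderiv_le {E F : Type*} [NormedAddCommGroup E] [NormedSpace ℂ E]
    [NormedAddCommGroup F] [NormedSpace ℂ F] {f : E → F} {c z : E} {R B : ℝ}
    (hd : DifferentiableOn ℂ f (ball c R)) (hB : ∀ x ∈ ball c R, ‖f x‖ ≤ B)
    (hz : z ∈ ball c R) :
    ‖f z - f c - fderiv ℂ f c (z - c)‖ ≤ 4 * B * (‖z - c‖ / R) ^ 2 := by
  have hR : 0 < R := nonempty_ball.1 ⟨z, hz⟩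
  have hc : c ∈ ball c R := mem_ball_self hR
  have hmaps : MapsTo f (ball c R) (closedBall (f c) (2 * B)) := fun x hx => by
    rw [mem_closedBall, dist_eq_norm]
    linarith [norm_sub_le (f x) (f c), hB x hx, hB c hc]
  have hL : ‖fderiv ℂ f c‖ ≤ 2 * B / R := Complex.norm_fderiv_le_div_of_mapsTo_ball hd hmaps hR
  set L := fderiv ℂ f c
  have hfc : HasFDerivAt f L c := (hd.differentiableAt (isOpen_ball.mem_nhds hc)).hasFDerivAt
  have key := Complex.dist_le_mul_div_pow_of_mapsTo_ball_of_isLittleO (n := 1)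
    (f := fun x => f x - L (x - c)) (c := c) (z := z) (R₁ := R) (R₂ := 4 * B) ?_ ?_ ?_ hz
  · simpa [dist_eq_norm, sub_sub, add_comm] using key
  · exact hd.sub (by fun_prop)
  · intro x hx
    have h1 : ‖L (x - c)‖ ≤ 2 * B := by
      have hB0 : 0 ≤ 2 * B / R := (norm_nonneg _).trans hL
      calc ‖L (x - c)‖ ≤ ‖L‖ * ‖x - c‖ := L.le_opNorm _
        _ ≤ 2 * B / R * R := by
            gcongr
            exact (mem_ball_iff_norm.1 hx).le
        _ = 2 * B := by field_simp
    have h2 := hmaps hx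
    rw [mem_closedBall, dist_eq_norm] at h2 ⊢
    simp only [sub_self, map_zero, sub_zero]
    calc ‖f x - L (x - c) - f c‖ = ‖(f x - f c) - L (x - c)‖ := by congr 1; abel
      _ ≤ _ := norm_sub_le _ _
      _ ≤ 4 * B := by linarith
  · have := hfc.isLittleO
    refine (this.congr_left fun x => ?_).trans_isBigO ?_
    · simp only [sub_self, map_zero, sub_zero]; abel
    · simpa using Asymptotics.isBigO_refl _ _

open Classical in
/-- The map sending a parameter `z` to the function `H z ·` on a compact space, with the junk value
`0` where that function is not continuous. -/
noncomputable def curryOn {E K F : Type*} [TopologicalSpace K] [TopologicalSpace F] [Zero F]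
    (H : E → K → F) (z : E) : C(K, F) :=
  if h : Continuous (H z) then ⟨H z, h⟩ else 0

theorem curryOn_apply {E K F : Type*} [TopologicalSpace K] [TopologicalSpace F] [Zero F]
    {H : E → K → F} {z : E} (h : Continuous (H z)) (k : K) : curryOn H z k = H z k := by
  simp [curryOn, h]

theorem differentiableOn_curryOn {E K F : Type*} [NormedAddCommGroup E] [NormedSpace ℂ E]
    [FiniteDimensional ℂ E] [TopologicalSpace K] [CompactSpace K]
    [NormedAddCommGroup F] [NormedSpace ℂ F] {H : E → K → F} {V : Set E} (hV : IsOpen V)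
    (hc : ContinuousOn (Function.uncurry H) (V ×ˢ univ))
    (hd : ∀ k, DifferentiableOn ℂ (fun z => H z k) V) :
    DifferentiableOn ℂ (curryOn H) V := by
  intro c hcV
  have : ProperSpace E := FiniteDimensional.proper ℂ E
  obtain ⟨R, hR, hRV⟩ := nhds_basis_closedBall.mem_iff.1 (hV.mem_nhds hcV)
  have hcont : ∀ z ∈ V, Continuous (H z) := fun z hz =>
    hc.comp_continuous (by fun_prop : Continuous fun k : K => (z, k)) fun k => ⟨hz, trivial⟩
  obtain ⟨B, hB⟩ := ((isCompact_closedBall c R).prod isCompact_univ).exists_bound_of_continuousOn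
    (hc.mono (prod_mono hRV Subset.rfl))
  have hB' : ∀ k, ∀ z ∈ ball c R, ‖H z k‖ ≤ B := fun k z hz =>
    hB (z, k) ⟨ball_subset_closedBall hz, trivial⟩
  have hd' : ∀ k, DifferentiableOn ℂ (fun z => H z k) (ball c R) := fun k =>
    (hd k).mono (ball_subset_closedBall.trans hRV)
  have hest : ∀ k, ∀ z ∈ ball c R,
      ‖H z k - H c k - fderiv ℂ (fun z => H z k) c (z - c)‖ ≤ 4 * B * (‖z - c‖ / R) ^ 2 :=
    fun k z hz => norm_sub_sub_fderiv_le (hd' k) (hB' k) hz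
  have hDn : ∀ k, ‖fderiv ℂ (fun z => H z k) c‖ ≤ 2 * |B| / R := fun k => by
    refine Complex.norm_fderiv_le_div_of_mapsTo_ball (hd' k) (fun x hx => ?_) hR
    rw [mem_closedBall, dist_eq_norm]
    linarith [norm_sub_le (H x k) (H c k), hB' k x hx, hB' k c (mem_ball_self hR), le_abs_self B]
  have hDc : ∀ v, Continuous fun k => fderiv ℂ (fun z => H z k) c v := by
    intro v
    have hev : ∀ᶠ s : ℂ in 𝓝[≠] 0, c + s • v ∈ ball c R := by
      have : Tendsto (fun s : ℂ => c + s • v) (𝓝[≠] 0) (𝓝 c) := by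
        have : Continuous fun s : ℂ => c + s • v := by fun_prop
        simpa using (this.tendsto 0).mono_left nhdsWithin_le_nhds
      exact this.eventually (ball_mem_nhds _ hR)
    refine TendstoUniformly.continuous (F := fun (s : ℂ) (k : K) => s⁻¹ • (H (c + s • v) k - H c k))
      (p := 𝓝[≠] 0) ?_ (Eventually.frequently ?_)
    · rw [Metric.tendstoUniformly_iff]
      intro ε hε
      have hlim : Tendsto (fun s : ℂ => 4 * |B| * (‖v‖ / R) ^ 2 * ‖s‖) (𝓝[≠] 0) (𝓝 0) := by
        have : Continuous fun s : ℂ => 4 * |B| * (‖v‖ / R) ^ 2 * ‖s‖ := by fun_prop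
        simpa using (this.tendsto 0).mono_left nhdsWithin_le_nhds
      filter_upwards [hev, self_mem_nhdsWithin, hlim.eventually (gt_mem_nhds hε)] with s hs hs0 hsε k
      have hs0' : s ≠ 0 := hs0
      have h := hest k _ hs
      rw [dist_comm, dist_eq_norm]
      have e : s⁻¹ • (H (c + s • v) k - H c k) - fderiv ℂ (fun z => H z k) c v
          = s⁻¹ • (H (c + s • v) k - H c k - fderiv ℂ (fun z => H z k) c (c + s • v - c)) := by
        simp only [add_sub_cancel_left, map_smul, smul_sub _ _ (s • _), smul_smul,
          inv_mul_cancel₀ hs0', one_smul]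
      rw [e, norm_smul, norm_inv]
      refine lt_of_le_of_lt ?_ hsε
      rw [inv_mul_le_iff₀ (by simpa using hs0')]
      refine h.trans ?_
      simp only [add_sub_cancel_left, norm_smul]
      have : 4 * B * (‖s‖ * ‖v‖ / R) ^ 2 ≤ 4 * |B| * (‖s‖ * ‖v‖ / R) ^ 2 := by
        gcongr; exact le_abs_self B
      refine this.trans (le_of_eq (by ring))
    · filter_upwards [hev] with s hs
      exact ((hcont _ (hRV (ball_subset_closedBall hs))).sub (hcont c hcV)).const_smul _
  let D₀ : E →ₗ[ℂ] C(K, F) :=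
    { toFun := fun v => ⟨_, hDc v⟩
      map_add' := fun v w => by ext k; simp
      map_smul' := fun a v => by ext k; simp }
  let D : E →L[ℂ] C(K, F) := D₀.mkContinuous (2 * |B| / R) fun v => by
    rw [ContinuousMap.norm_le _ (by positivity)]
    exact fun k => (ContinuousLinearMap.le_opNorm _ _).trans (by gcongr; exact hDn k)
  refine (HasFDerivAt.differentiableAt (f' := D) ?_).differentiableWithinAt
  rw [hasFDerivAt_iff_isLittleO]
  have hO : (fun z => curryOn H z - curryOn H c - D (z - c)) =O[𝓝 c] fun z => ‖z - c‖ ^ 2 := by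
    refine Asymptotics.IsBigO.of_bound (4 * |B| / R ^ 2) ?_
    filter_upwards [ball_mem_nhds c hR] with z hz
    rw [ContinuousMap.norm_le _ (by positivity)]
    intro k
    have h := hest k z hz
    have e : (curryOn H z - curryOn H c - D (z - c)) k
        = H z k - H c k - fderiv ℂ (fun z => H z k) c (z - c) := by
      simp only [ContinuousMap.sub_apply, curryOn_apply (hcont c hcV),
        curryOn_apply (hcont z (hRV (ball_subset_closedBall hz)))]
      rfl
    rw [e]
    refine h.trans ?_
    have : 4 * B * (‖z - c‖ / R) ^ 2 ≤ 4 * |B| * (‖z - c‖ / R) ^ 2 := by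
      gcongr; exact le_abs_self B
    refine this.trans (le_of_eq ?_)
    simp; ring
  refine hO.trans_isLittleO ?_
  have := (Asymptotics.isLittleO_pow_pow (𝕜 := ℝ) (m := 1) (n := 2) (by norm_num))
  have h2 : Tendsto (fun z => ‖z - c‖) (𝓝 c) (𝓝 0) := by
    have : Continuous fun z : E => ‖z - c‖ := by fun_prop
    simpa using this.tendsto c
  have h3 := this.comp_tendsto h2
  simpa [Function.comp_def] using h3

/-- Integration over a circle, as a bounded linear functional on continuous functions there. -/
noncomputable def circleIntegralCLM (F : Type*) [NormedAddCommGroup F] [NormedSpace ℂ F]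
    (c : ℂ) {r : ℝ} (hr : 0 ≤ r) : C(sphere c r, F) →L[ℂ] F :=
  LinearMap.mkContinuous
    { toFun := fun u => ∫ θ in (0 : ℝ)..2 * Real.pi,
        deriv (circleMap c r) θ • u ⟨circleMap c r θ, circleMap_mem_sphere c hr θ⟩
      map_add' := fun u v => by
        simp only [ContinuousMap.add_apply, smul_add]
        refine intervalIntegral.integral_add ?_ ?_ <;>
        · apply Continuous.intervalIntegrable
          simp only [deriv_circleMap]
          fun_prop
      map_smul' := fun a u => by
        simp only [ContinuousMap.smul_apply, RingHom.id_apply]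
        rw [← intervalIntegral.integral_smul]
        congr 1; ext θ; rw [smul_comm] }
    (2 * Real.pi * r) fun u => by
      have := intervalIntegral.norm_integral_le_of_norm_le_const (a := 0) (b := 2 * Real.pi)
        (C := r * ‖u‖)
        (f := fun θ => deriv (circleMap c r) θ • u ⟨circleMap c r θ, circleMap_mem_sphere c hr θ⟩)
        fun θ _ => by
          rw [norm_smul]
          simp only [deriv_circleMap, norm_mul, norm_circleMap_zero, Complex.norm_I, mul_one,
            abs_of_nonneg hr]
          gcongr
          exact u.norm_coe_le_norm _
      refine this.trans (le_of_eq ?_)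
      rw [sub_zero, abs_of_pos Real.two_pi_pos]; ring

theorem circleIntegralCLM_apply {F : Type*} [NormedAddCommGroup F] [NormedSpace ℂ F]
    {c : ℂ} {r : ℝ} (hr : 0 ≤ r) {u : C(sphere c r, F)} {f : ℂ → F}
    (hf : ∀ ξ : sphere c r, u ξ = f ξ) :
    circleIntegralCLM F c hr u = ∮ ξ in C(c, r), f ξ := by
  simp only [circleIntegralCLM, circleIntegral]
  change (∫ θ in (0 : ℝ)..2 * Real.pi, _) = _
  congr 1; ext θ; rw [hf]

/-- Pointwise multiplication of vector valued continuous functions by scalar ones, as a bounded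
bilinear map. -/
noncomputable def smulContinuousMapCLM (K F : Type*) [TopologicalSpace K] [CompactSpace K]
    [NormedAddCommGroup F] [NormedSpace ℂ F] : C(K, ℂ) →L[ℂ] C(K, F) →L[ℂ] C(K, F) :=
  LinearMap.mkContinuous₂
    (LinearMap.mk₂ ℂ (fun (k : C(K, ℂ)) (u : C(K, F)) => (⟨fun x => k x • u x, by fun_prop⟩ : C(K, F)))
      (fun k l u => by ext x; simp [add_smul]) (fun a k u => by ext x; simp [mul_smul])
      (fun k u v => by ext x; simp) (fun a k u => by ext x; simp [smul_comm a]))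
    1 fun k u => by
      rw [ContinuousMap.norm_le _ (by positivity)]
      intro x
      simp only [LinearMap.mk₂_apply, ContinuousMap.coe_mk, norm_smul, one_mul]
      gcongr
      · exact k.norm_coe_le_norm x
      · exact u.norm_coe_le_norm x

theorem smulContinuousMapCLM_apply {K F : Type*} [TopologicalSpace K] [CompactSpace K]
    [NormedAddCommGroup F] [NormedSpace ℂ F] (k : C(K, ℂ)) (u : C(K, F)) (x : K) :
    smulContinuousMapCLM K F k u x = k x • u x := rfl

/-- Holomorphic Banach valued maps on open subsets of `E` are analytic. -/
def OsgoodProperty.{u, v} (E : Type u) [NormedAddCommGroup E] [NormedSpace ℂ E] : Prop :=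
  ∀ (F : Type v) [NormedAddCommGroup F] [NormedSpace ℂ F] [CompleteSpace F] (f : E → F) (V : Set E),
    IsOpen V → DifferentiableOn ℂ f V → AnalyticOnNhd ℂ f V

theorem analyticAt_inv_sub_curryOn {c : ℂ} {r : ℝ} {ξ₀ : ℂ} (hξ₀ : ξ₀ ∉ sphere c r) :
    AnalyticAt ℂ (curryOn fun (ξ : ℂ) (η : sphere c r) => ((η : ℂ) - ξ)⁻¹) ξ₀ := by
  have hV : IsOpen (sphere c r)ᶜ := isClosed_sphere.isOpen_compl
  refine DifferentiableOn.analyticAt (s := (sphere c r)ᶜ) ?_ (hV.mem_nhds hξ₀)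
  have hne : ∀ ξ ∈ (sphere c r)ᶜ, ∀ η : sphere c r, (η : ℂ) - ξ ≠ 0 := fun ξ hξ η h =>
    hξ (by rw [← sub_eq_zero.1 h]; exact η.2)
  refine differentiableOn_curryOn hV ?_ fun η => ?_
  · refine ContinuousOn.inv₀ (by fun_prop) fun p hp => hne _ hp.1 _
  · exact DifferentiableOn.inv (by fun_prop) fun ξ hξ => hne ξ hξ η

theorem OsgoodProperty.prod.{u, v} {E : Type u} [NormedAddCommGroup E] [NormedSpace ℂ E]
    [FiniteDimensional ℂ E] (hE : OsgoodProperty.{u, v} E) : OsgoodProperty.{u, v} (ℂ × E) := by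
  intro F _ _ _ f V hV hf p hp
  obtain ⟨ξ₀, z₀⟩ := p
  obtain ⟨r, hr, hrV⟩ := nhds_basis_closedBall.mem_iff.1 (hV.mem_nhds hp)
  rw [← closedBall_prod_same] at hrV
  set H : E → sphere ξ₀ r → F := fun z η => f (η, z)
  have hmem : ∀ z ∈ ball z₀ r, ∀ η ∈ closedBall ξ₀ r, (η, z) ∈ V := fun z hz η hη =>
    hrV ⟨hη, ball_subset_closedBall hz⟩
  have hHc : ContinuousOn (Function.uncurry H) (ball z₀ r ×ˢ univ) := by
    refine hf.continuousOn.comp (f := fun q : E × sphere ξ₀ r => ((q.2 : ℂ), q.1)) (by fun_prop) ?_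
    exact fun q hq => hmem _ hq.1 _ (sphere_subset_closedBall q.2.2)
  have hΦ : AnalyticOnNhd ℂ (curryOn H) (ball z₀ r) := by
    refine hE _ _ _ isOpen_ball (differentiableOn_curryOn isOpen_ball hHc fun η => ?_)
    refine hf.comp (f := fun z => ((η : ℂ), z)) (by fun_prop) ?_
    exact fun z hz => hmem _ hz _ (sphere_subset_closedBall η.2)
  have hk := analyticAt_inv_sub_curryOn (c := ξ₀) (r := r) (ξ₀ := ξ₀) (by simp [hr.ne])
  set k := curryOn fun (ξ : ℂ) (η : sphere ξ₀ r) => ((η : ℂ) - ξ)⁻¹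
  have h1 : AnalyticAt ℂ (fun q : ℂ × E => (k q.1, curryOn H q.2)) (ξ₀, z₀) :=
    (hk.comp_of_eq analyticAt_fst rfl).prod
      ((hΦ z₀ (mem_ball_self hr)).comp_of_eq analyticAt_snd rfl)
  have h2 := ((smulContinuousMapCLM (sphere ξ₀ r) F).analyticAt_bilinear
    (k ξ₀, curryOn H z₀)).comp_of_eq h1 rfl
  have h3 := ((circleIntegralCLM F ξ₀ hr.le).analyticAt _).comp_of_eq h2 rfl
  have h4 := h3.const_smul (c := ((2 * Real.pi * Complex.I : ℂ)⁻¹))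
  refine h4.congr ?_
  filter_upwards [(isOpen_ball.prod isOpen_ball).mem_nhds
    (mk_mem_prod (mem_ball_self hr) (mem_ball_self hr) :
      (ξ₀, z₀) ∈ ball ξ₀ r ×ˢ ball z₀ r)] with q hq
  obtain ⟨ξ, z⟩ := q
  have hc : ContinuousOn (fun η => f (η, z)) (closedBall ξ₀ r) :=
    hf.continuousOn.comp (by fun_prop) fun η hη => hmem z hq.2 η hη
  have hd : ∀ η ∈ ball ξ₀ r \ ∅, DifferentiableAt ℂ (fun η => f (η, z)) η := fun η hη => by
    have := (hf.differentiableAt (hV.mem_nhds (hmem z hq.2 η (ball_subset_closedBall hη.1))))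
    exact this.comp (f := fun η => (η, z)) η (by fun_prop)
  have hcau := Complex.two_pi_I_inv_smul_circleIntegral_sub_inv_smul_of_differentiable_on_off_countable
    countable_empty hq.1 hc hd
  have : circleIntegralCLM F ξ₀ hr.le (smulContinuousMapCLM (sphere ξ₀ r) F (k ξ) (curryOn H z))
      = ∮ η in C(ξ₀, r), (η - ξ)⁻¹ • f (η, z) := by
    refine circleIntegralCLM_apply hr.le fun η => ?_
    rw [smulContinuousMapCLM_apply]
    congr 1
    · have : Continuous fun η : sphere ξ₀ r => ((η : ℂ) - ξ)⁻¹ := by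
        refine Continuous.inv₀ (by fun_prop) fun η h => ?_
        rw [← sub_eq_zero.1 h] at hq
        have h1 := mem_ball.1 hq.1
        have h2 := mem_sphere.1 η.2
        linarith
      exact curryOn_apply this η
    · exact curryOn_apply (hHc.comp_continuous (by fun_prop : Continuous fun k : sphere ξ₀ r => (z, k))
        fun k => ⟨hq.2, trivial⟩) η
  simp only [Function.comp_def, Pi.smul_apply]
  rw [this, hcau]

theorem OsgoodProperty.of_equiv.{u, u', v} {E : Type u} {E' : Type u'}
    [NormedAddCommGroup E] [NormedSpace ℂ E]
    [NormedAddCommGroup E'] [NormedSpace ℂ E'] (e : E' ≃L[ℂ] E) (hE : OsgoodProperty.{u, v} E) :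
    OsgoodProperty.{u', v} E' := by
  intro F _ _ _ f V hV hf p hp
  have := hE F (f ∘ e.symm) (e.symm ⁻¹' V) (hV.preimage e.symm.continuous)
    (hf.comp e.symm.differentiable.differentiableOn (mapsTo_preimage _ _)) (e p) (by simpa using hp)
  have h2 := this.comp_of_eq ((e : E' →L[ℂ] E).analyticAt p) rfl
  simpa [Function.comp_def] using h2

theorem osgoodProperty_of_finiteDimensional.{u, v} {E : Type u} [NormedAddCommGroup E] [NormedSpace ℂ E]
    [FiniteDimensional ℂ E] : OsgoodProperty.{u, v} E := by
  have key : ∀ n, OsgoodProperty.{0, v} (Fin n → ℂ) := by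
    intro n
    induction n with
    | zero =>
      intro F _ _ _ f V _ _ p _
      have : f = fun _ => f p := by ext q; rw [Subsingleton.elim q p]
      rw [this]; exact analyticAt_const
    | succ n ih =>
      exact ih.prod.of_equiv (ContinuousLinearEquiv.ofFinrankEq (by simp [add_comm]))
  exact (key (Module.finrank ℂ E)).of_equiv (ContinuousLinearEquiv.ofFinrankEq (by simp))

/-- **Osgood's lemma**: a holomorphic map on an open subset of a finite dimensional complex space
is analytic. -/
theorem DifferentiableOn.analyticOnNhd_of_finiteDimensional {E F : Type*} [NormedAddCommGroup E]
    [NormedSpace ℂ E] [FiniteDimensional ℂ E] [NormedAddCommGroup F] [NormedSpace ℂ F]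
    [CompleteSpace F] {f : E → F} {V : Set E} (hf : DifferentiableOn ℂ f V) (hV : IsOpen V) :
    AnalyticOnNhd ℂ f V :=
  osgoodProperty_of_finiteDimensional F f V hV hf

/-- A circle integral depends analytically on parameters. -/
theorem analyticOnNhd_circleIntegral {E F : Type*} [NormedAddCommGroup E]
    [NormedSpace ℂ E] [FiniteDimensional ℂ E] [NormedAddCommGroup F] [NormedSpace ℂ F]
    [CompleteSpace F] {H : E → ℂ → F} {V : Set E} (hV : IsOpen V) {c : ℂ} {r : ℝ} (hr : 0 ≤ r)
    (hH : ∀ z ∈ V, ∀ ξ ∈ sphere c r, AnalyticAt ℂ (Function.uncurry H) (z, ξ)) :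
    AnalyticOnNhd ℂ (fun z => ∮ ξ in C(c, r), H z ξ) V := by
  set G : E → sphere c r → F := fun z ξ => H z ξ
  have hc : ContinuousOn (Function.uncurry G) (V ×ˢ univ) := by
    intro q hq
    have := (hH q.1 hq.1 q.2 q.2.2).continuousAt.comp (x := q)
      (f := fun q : E × sphere c r => (q.1, (q.2 : ℂ))) (by fun_prop)
    exact this.continuousWithinAt
  have hd : DifferentiableOn ℂ (curryOn G) V := differentiableOn_curryOn hV hc fun ξ z hz =>
    ((hH z hz ξ ξ.2).differentiableAt.comp (f := fun z => (z, (ξ : ℂ))) z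
      (by fun_prop)).differentiableWithinAt
  have ha := (circleIntegralCLM F c hr).comp_analyticOnNhd (hd.analyticOnNhd_of_finiteDimensional hV)
  refine ha.congr hV fun z hz => ?_
  exact circleIntegralCLM_apply hr fun ξ => curryOn_apply
    (hc.comp_continuous (by fun_prop : Continuous fun k : sphere c r => (z, k))
      fun k => ⟨hz, trivial⟩) ξ

theorem AnalyticOnNhd.comp_line {E : Type*} [NormedAddCommGroup E] [NormedSpace ℂ E]
    {f : E → ℂ} {ρ : ℝ} (hf : AnalyticOnNhd ℂ f (ball 0 ρ)) (a v : E) :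
    AnalyticOnNhd ℂ (fun s : ℂ => f (a + s • v)) ((fun s : ℂ => a + s • v) ⁻¹' ball 0 ρ) := by
  intro s hs
  have : AnalyticAt ℂ (fun s : ℂ => a + s • v) s :=
    analyticAt_const.add (analyticAt_id.smul analyticAt_const)
  exact (hf _ hs).comp_of_eq this rfl

theorem isPreconnected_line_preimage_ball {E : Type*} [NormedAddCommGroup E] [NormedSpace ℂ E]
    (a v c : E) (ρ : ℝ) : IsPreconnected ((fun s : ℂ => a + s • v) ⁻¹' ball c ρ) := by
  refine Convex.isPreconnected fun s hs t ht α β hα hβ hαβ => ?_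
  have := convex_ball c ρ hs ht hα hβ hαβ
  have e : a + (α • s + β • t) • v = α • (a + s • v) + β • (a + t • v) := by
    have : a = (α + β) • a := by rw [hαβ, one_smul]
    conv_lhs => rw [this]
    simp only [smul_add, add_smul, smul_assoc]; abel
  rwa [mem_preimage, e]

/-- A germ that does not vanish identically does not vanish identically on some line. -/
theorem not_eventually_line_eq_zero {E : Type*} [NormedAddCommGroup E] [NormedSpace ℂ E]
    {f : E → ℂ} {ρ : ℝ} (hf : AnalyticOnNhd ℂ f (ball 0 ρ)) {v : E} (hv : v ∈ ball 0 ρ)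
    (hfv : f v ≠ 0) : ¬ ∀ᶠ s : ℂ in 𝓝 0, f (s • v) = 0 := by
  intro h
  have hρ : 0 < ρ := nonempty_ball.1 ⟨v, hv⟩
  have := (hf.comp_line 0 v).eqOn_zero_of_preconnected_of_eventuallyEq_zero
    (isPreconnected_line_preimage_ball 0 v 0 ρ) (z₀ := 0) (by simp [hρ]) (by simpa [EventuallyEq] using h)
    (x := 1) (by simpa using hv)
  exact hfv (by simpa using this)

/-- First order Hadamard division in the first variable. -/
theorem exists_analyticAt_eq_add_mul {E : Type*} [NormedAddCommGroup E] [NormedSpace ℂ E]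
    [FiniteDimensional ℂ E] {f : ℂ × E → ℂ} (hf : AnalyticAt ℂ f 0) :
    ∃ q : ℂ × E → ℂ, AnalyticAt ℂ q 0 ∧ ∀ᶠ p in 𝓝 0, f p = f (0, p.2) + p.1 * q p := by
  obtain ⟨ρ, hρ, hfρ⟩ := hf.exists_ball_analyticOnNhd
  set r := ρ / 2 with hr
  have hr0 : 0 < r := by positivity
  have hmem : ∀ ξ ∈ closedBall (0 : ℂ) r, ∀ z ∈ ball (0 : E) ρ, (ξ, z) ∈ ball (0 : ℂ × E) ρ := by
    intro ξ hξ z hz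
    rw [mem_closedBall_zero_iff] at hξ
    rw [mem_ball_zero_iff] at hz
    rw [mem_ball_zero_iff, Prod.norm_mk]
    exact max_lt (by linarith) hz
  have hopen : IsOpen (ball (0 : ℂ) r ×ˢ ball (0 : E) ρ) := isOpen_ball.prod isOpen_ball
  have h0 : (0 : ℂ × E) ∈ ball (0 : ℂ) r ×ˢ ball (0 : E) ρ :=
    ⟨mem_ball_self hr0, mem_ball_self hρ⟩
  have hne : ∀ φ ∈ ball (0 : ℂ) r, ∀ ξ ∈ sphere (0 : ℂ) r, ξ - φ ≠ 0 := by
    intro φ hφ ξ hξ h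
    rw [sub_eq_zero.1 h] at hξ
    exact (mem_ball.1 hφ).ne (mem_sphere.1 hξ)
  have hne0 : ∀ ξ ∈ sphere (0 : ℂ) r, ξ ≠ 0 := fun ξ hξ => by
    simpa using hne 0 (mem_ball_self hr0) ξ hξ
  have han := analyticOnNhd_circleIntegral (F := ℂ) (c := 0)
    (H := fun (p : ℂ × E) (ξ : ℂ) => ((ξ - p.1)⁻¹ * ξ⁻¹) * f (ξ, p.2)) hopen hr0.le ?_
  · refine ⟨fun p => (2 * Real.pi * Complex.I : ℂ)⁻¹ *
      ∮ ξ in C(0, r), ((ξ - p.1)⁻¹ * ξ⁻¹) * f (ξ, p.2), analyticAt_const.mul (han 0 h0), ?_⟩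
    filter_upwards [hopen.mem_nhds h0] with p hp
    obtain ⟨φ, z⟩ := p
    have hz : z ∈ ball (0 : E) ρ := hp.2
    have hd : DifferentiableOn ℂ (fun ξ => f (ξ, z)) (closedBall 0 r) := fun ξ hξ =>
      (((hfρ _ (hmem ξ hξ z hz)).differentiableAt).comp (f := fun ξ => (ξ, z)) ξ
        (by fun_prop)).differentiableWithinAt
    have hcont : ContinuousOn (fun ξ => f (ξ, z)) (sphere 0 r) :=
      hd.continuousOn.mono sphere_subset_closedBall
    have c1 := hd.circleIntegral_sub_inv_smul hp.1
    have c2 := hd.circleIntegral_sub_inv_smul (w := 0) (mem_ball_self hr0)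
    have hi1 : CircleIntegrable (fun ξ => (ξ - φ)⁻¹ • f (ξ, z)) 0 r :=
      ContinuousOn.circleIntegrable hr0.le
        (ContinuousOn.smul (ContinuousOn.inv₀ (by fun_prop) (hne φ hp.1)) hcont)
    have hi2 : CircleIntegrable (fun ξ => (ξ - 0)⁻¹ • f (ξ, z)) 0 r :=
      ContinuousOn.circleIntegrable hr0.le
        (ContinuousOn.smul (ContinuousOn.inv₀ (by fun_prop) (hne 0 (mem_ball_self hr0))) hcont)
    have key : φ * (∮ ξ in C(0, r), ((ξ - φ)⁻¹ * ξ⁻¹) * f (ξ, z))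
        = (2 * Real.pi * Complex.I : ℂ) • f (φ, z) - (2 * Real.pi * Complex.I : ℂ) • f (0, z) := by
      rw [← c1, ← c2, ← circleIntegral.integral_sub hi1 hi2, ← smul_eq_mul,
        ← circleIntegral.integral_smul]
      refine circleIntegral.integral_congr hr0.le fun ξ hξ => ?_
      have h1 := hne φ hp.1 ξ hξ
      have h2 := hne0 ξ hξ
      simp only [smul_eq_mul, sub_zero]
      field_simp
      ring
    have hpi : (2 * Real.pi * Complex.I : ℂ) ≠ 0 := Complex.two_pi_I_ne_zero
    simp only
    rw [mul_left_comm, key, ← smul_sub, smul_eq_mul, inv_mul_cancel_left₀ hpi]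
    ring
  · intro p hp ξ hξ
    refine AnalyticAt.mul (AnalyticAt.mul (AnalyticAt.inv ?_ ?_) (AnalyticAt.inv ?_ ?_)) ?_
    · exact analyticAt_snd.sub (analyticAt_fst.comp_of_eq analyticAt_fst rfl)
    · exact hne _ hp.1 _ hξ
    · exact analyticAt_snd
    · exact hne0 _ hξ
    · refine (hfρ _ (hmem ξ (sphere_subset_closedBall hξ) p.2 hp.2)).comp_of_eq
        (f := fun q : (ℂ × E) × ℂ => (q.2, q.1.2)) ?_ rfl
      exact analyticAt_snd.prod (analyticAt_snd.comp_of_eq analyticAt_fst rfl)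

/-- A nonzero germ is a power of the first variable times a germ that is nonzero on the
hyperplane where the first variable vanishes. -/
theorem exists_analyticAt_eq_pow_mul {E : Type*} [NormedAddCommGroup E] [NormedSpace ℂ E]
    [FiniteDimensional ℂ E] {f : ℂ × E → ℂ} (hf : AnalyticAt ℂ f 0)
    (hne : ¬ ∀ᶠ p in 𝓝 0, f p = 0) :
    ∃ (c : ℕ) (u : E → ℂ) (q : ℂ × E → ℂ), AnalyticAt ℂ u 0 ∧ AnalyticAt ℂ q 0 ∧
      (¬ ∀ᶠ z in 𝓝 0, u z = 0) ∧
      ∀ᶠ p in 𝓝 0, f p = p.1 ^ c * (u p.2 + p.1 * q p) := by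
  set Q : ℕ → Prop := fun c => ∃ k : ℂ × E → ℂ, AnalyticAt ℂ k 0 ∧ ∀ᶠ p in 𝓝 0, f p = p.1 ^ c * k p
  have hQ0 : Q 0 := ⟨f, hf, by simp⟩
  have hnot : ∃ c, ¬ Q c := by
    by_contra! hall
    obtain ⟨ρ, hρ, hfρ⟩ := hf.exists_ball_analyticOnNhd
    have : ∃ v ∈ ball (0 : ℂ × E) ρ, f v ≠ 0 := by
      by_contra! h
      exact hne (eventually_of_mem (ball_mem_nhds 0 hρ) h)
    obtain ⟨v, hv, hfv⟩ := this
    have hline := not_eventually_line_eq_zero hfρ hv hfv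
    have hl : AnalyticAt ℂ (fun s : ℂ => f (s • v)) 0 := by
      have := hfρ.comp_line 0 v 0 (by simpa using hρ)
      simpa using this
    have htop : analyticOrderAt (fun s : ℂ => f (s • v)) 0 = ⊤ := by
      refine ENat.eq_top_iff_forall_ge.2 fun c => ?_
      obtain ⟨k, hk, hfk⟩ := hall c
      rw [natCast_le_analyticOrderAt hl]
      have ht : Tendsto (fun s : ℂ => s • v) (𝓝 0) (𝓝 0) := by
        have : Continuous fun s : ℂ => s • v := by fun_prop
        simpa using this.tendsto 0
      refine ⟨fun s => v.1 ^ c * k (s • v), ?_, ?_⟩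
      · refine analyticAt_const.mul (hk.comp_of_eq (f := fun s : ℂ => s • v) ?_ (by simp))
        exact analyticAt_id.smul analyticAt_const
      · filter_upwards [ht.eventually hfk] with s hs
        rw [hs]; simp; ring
    exact hline (analyticOrderAt_eq_top.1 htop)
  obtain ⟨c, ⟨k, hk, hfk⟩, hc⟩ : ∃ c, Q c ∧ ¬ Q (c + 1) := by
    by_contra! h
    obtain ⟨c, hc⟩ := hnot
    exact hc (Nat.rec hQ0 h c)
  obtain ⟨q, hq, hkq⟩ := exists_analyticAt_eq_add_mul hk
  refine ⟨c, fun z => k (0, z), q, ?_, hq, ?_, ?_⟩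
  · exact hk.comp_of_eq (f := fun z : E => ((0 : ℂ), z)) (analyticAt_const.prod analyticAt_id) rfl
  · intro hz
    refine hc ⟨q, hq, ?_⟩
    have : Tendsto (fun p : ℂ × E => p.2) (𝓝 0) (𝓝 0) := continuous_snd.tendsto 0
    filter_upwards [hfk, hkq, this.eventually hz] with p h1 h2 h3
    rw [h1, h2, h3]; ring
  · filter_upwards [hfk, hkq] with p h1 h2
    rw [h1, h2]

theorem AnalyticOnNhd.finite_zeros {f : ℂ → ℂ} {K : Set ℂ} (hK : IsCompact K)
    (hKc : IsPreconnected K) (hf : AnalyticOnNhd ℂ f K) {x : ℂ} (hx : x ∈ K) (hfx : f x ≠ 0) :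
    {z ∈ K | f z = 0}.Finite := by
  by_contra hinf
  obtain ⟨y, hyK, hy⟩ := Set.Infinite.exists_accPt_of_subset_isCompact hinf hK (sep_subset _ _)
  rw [accPt_iff_frequently_nhdsNE] at hy
  exact hfx (hf.eqOn_zero_of_preconnected_of_frequently_eq_zero hKc hyK
    (hy.mono fun z hz => hz.2) hx)

/-- Dividing out one zero of an analytic function, with its multiplicity. -/
theorem AnalyticOnNhd.exists_eq_pow_mul {f : ℂ → ℂ} {K : Set ℂ} (hf : AnalyticOnNhd ℂ f K)
    {a : ℂ} (ha : a ∈ K) (hfa : f a = 0) (hne : ¬ ∀ᶠ z in 𝓝 a, f z = 0) :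
    ∃ (k : ℕ) (u : ℂ → ℂ), AnalyticOnNhd ℂ u K ∧ u a ≠ 0 ∧ ∀ z, f z = (z - a) ^ k * u z := by
  classical
  obtain ⟨k, h, hh, hha, hfh⟩ := (hf a ha).exists_eventuallyEq_pow_smul_nonzero_iff.2 hne
  have hk : k ≠ 0 := by
    rintro rfl
    have := hfh.self_of_nhds
    simp only [pow_zero, one_smul] at this
    exact hha (this ▸ hfa)
  refine ⟨k, fun z => if z = a then h a else f z / (z - a) ^ k, ?_, by simpa using hha, ?_⟩
  · intro z hz
    by_cases hza : z = a
    · subst hza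
      refine hh.congr ?_
      filter_upwards [hfh] with w hw
      by_cases hwz : w = z
      · simp [hwz]
      · have : (w - z) ^ k ≠ 0 := pow_ne_zero _ (sub_ne_zero.2 hwz)
        simp only [hwz, if_false, hw, smul_eq_mul]
        field_simp
    · have h1 : AnalyticAt ℂ (fun z => f z / (z - a) ^ k) z :=
        (hf z hz).div ((analyticAt_id.sub analyticAt_const).pow k)
          (pow_ne_zero _ (sub_ne_zero.2 hza))
      refine h1.congr ?_
      filter_upwards [isOpen_ne.mem_nhds hza] with w hw
      have hw' : w ≠ a := hw
      simp [hw']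
  · intro z
    by_cases hza : z = a
    · subst hza; simp [hfa, hk]
    · have : (z - a) ^ k ≠ 0 := pow_ne_zero _ (sub_ne_zero.2 hza)
      simp only [hza, if_false]
      field_simp

/-- Factoring out all zeros of an analytic function on a compact connected set. -/
theorem AnalyticOnNhd.exists_eq_prod_mul {K : Set ℂ} (hK : IsCompact K)
    (hKc : IsPreconnected K) {f : ℂ → ℂ} (hf : AnalyticOnNhd ℂ f K) {x : ℂ} (hx : x ∈ K)
    (hfx : f x ≠ 0) :
    ∃ (s : Multiset ℂ) (u : ℂ → ℂ), (∀ a ∈ s, a ∈ K ∧ f a = 0) ∧ AnalyticOnNhd ℂ u K ∧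
      (∀ z ∈ K, u z ≠ 0) ∧ ∀ z, f z = (s.map fun a => z - a).prod * u z := by
  have hfin := hf.finite_zeros hK hKc hx hfx
  generalize hn : hfin.toFinset.card = n
  induction n using Nat.strong_induction_on generalizing f with
  | _ n ih =>
    by_cases hz : ∀ z ∈ K, f z ≠ 0
    · exact ⟨0, f, by simp, hf, hz, by simp⟩
    push Not at hz
    obtain ⟨a, haK, hfa⟩ := hz
    have hne : ¬ ∀ᶠ z in 𝓝 a, f z = 0 := fun h => hfx
      (hf.eqOn_zero_of_preconnected_of_eventuallyEq_zero hKc haK h hx)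
    obtain ⟨k, u, hu, hua, hfu⟩ := hf.exists_eq_pow_mul haK hfa hne
    have hux : u x ≠ 0 := fun h => hfx (by rw [hfu, h, mul_zero])
    have hufin := hu.finite_zeros hK hKc hx hux
    have hlt : hufin.toFinset.card < n := by
      rw [← hn]
      refine Finset.card_lt_card ⟨?_, ?_⟩
      · intro z hz
        simp only [Finite.mem_toFinset, mem_ofPred_eq] at hz ⊢
        exact ⟨hz.1, by rw [hfu, hz.2, mul_zero]⟩
      · intro h
        have : a ∈ hufin.toFinset := h (by simp [haK, hfa])
        simp only [Finite.mem_toFinset, mem_ofPred_eq] at this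
        exact hua this.2
    obtain ⟨s, v, hs, hv, hv0, huv⟩ := ih _ hlt hu hux hufin rfl
    refine ⟨Multiset.replicate k a + s, v, ?_, hv, hv0, ?_⟩
    · intro b hb
      rcases Multiset.mem_add.1 hb with hb | hb
      · rw [Multiset.eq_of_mem_replicate hb]; exact ⟨haK, hfa⟩
      · exact ⟨(hs b hb).1, by rw [hfu, (hs b hb).2, mul_zero]⟩
    · intro z
      rw [hfu, huv]
      simp [mul_assoc]

/-- The generalized argument principle for an explicitly factored function. -/
theorem circleIntegral_mul_logDeriv_prod {c : ℂ} {r : ℝ} (hr : 0 < r) {p u : ℂ → ℂ}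
    (hp : AnalyticOnNhd ℂ p (closedBall c r)) (hu : AnalyticOnNhd ℂ u (closedBall c r))
    (hu0 : ∀ z ∈ closedBall c r, u z ≠ 0) (s : Multiset ℂ) (hs : ∀ a ∈ s, a ∈ ball c r) :
    (∮ z in C(c, r), p z * logDeriv (fun z => (s.map fun a => z - a).prod * u z) z)
      = 2 * Real.pi * Complex.I * (s.map p).sum := by
  have hsub : sphere c r ⊆ closedBall c r := sphere_subset_closedBall
  have hprod : ∀ s : Multiset ℂ, AnalyticOnNhd ℂ
      (fun z => (s.map fun a => z - a).prod * u z) (closedBall c r) := by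
    intro s
    induction s using Multiset.induction with
    | empty => simpa using hu
    | cons a s ih =>
      simp only [Multiset.map_cons, Multiset.prod_cons, mul_assoc]
      exact fun z hz => (analyticAt_id.sub analyticAt_const).mul (ih z hz)
  have hcont : ∀ s : Multiset ℂ, (∀ a ∈ s, a ∈ ball c r) → (∀ z ∈ sphere c r,
      (s.map fun a => z - a).prod * u z ≠ 0) := by
    intro s hs z hz
    refine mul_ne_zero (Multiset.prod_ne_zero ?_) (hu0 z (hsub hz))
    rw [Multiset.mem_map]
    rintro ⟨a, ha, h⟩
    rw [sub_eq_zero.1 h] at hz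
    exact (mem_ball.1 (hs a ha)).ne (mem_sphere.1 hz)
  induction s using Multiset.induction with
  | empty =>
    simp only [Multiset.map_zero, Multiset.prod_zero, one_mul, Multiset.sum_zero, mul_zero]
    refine DiffContOnCl.circleIntegral_eq_zero hr.le ?_
    refine DifferentiableOn.diffContOnCl_ball (U := closedBall c r) ?_ Subset.rfl
    exact fun z hz => ((hp z hz).mul ((hu z hz).deriv.div (hu z hz)
      (hu0 z hz))).differentiableAt.differentiableWithinAt
  | cons a s ih =>
    have ha : a ∈ ball c r := hs a (Multiset.mem_cons_self a s)
    have hs' : ∀ b ∈ s, b ∈ ball c r := fun b hb => hs b (Multiset.mem_cons_of_mem hb)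
    have hne : ∀ z ∈ sphere c r, z - a ≠ 0 := fun z hz h => by
      rw [sub_eq_zero.1 h] at hz
      exact (mem_ball.1 ha).ne (mem_sphere.1 hz)
    have i1 : CircleIntegrable (fun z => (z - a)⁻¹ • p z) c r :=
      ContinuousOn.circleIntegrable hr.le (ContinuousOn.smul
        (ContinuousOn.inv₀ (by fun_prop) hne) (hp.continuousOn.mono hsub))
    have i2 : CircleIntegrable
        (fun z => p z * logDeriv (fun z => (s.map fun a => z - a).prod * u z) z) c r := by
      refine ContinuousOn.circleIntegrable hr.le fun z hz => ?_
      exact ((hp z (hsub hz)).mul ((hprod s z (hsub hz)).deriv.div (hprod s z (hsub hz))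
        (hcont s hs' z hz))).continuousAt.continuousWithinAt
    have hdp : DifferentiableOn ℂ p (closedBall c r) := hp.differentiableOn
    have c1 := hdp.circleIntegral_sub_inv_smul ha
    rw [Multiset.map_cons, Multiset.sum_cons, mul_add, ← ih hs', ← smul_eq_mul (_ * _) (p a), ← c1,
      ← circleIntegral.integral_add i1 i2]
    refine circleIntegral.integral_congr hr.le fun z hz => ?_
    have e : (fun z => ((a ::ₘ s).map fun a => z - a).prod * u z)
        = fun z => (z - a) * ((s.map fun a => z - a).prod * u z) := by
      ext w; simp [mul_assoc]
    simp only [e]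
    rw [logDeriv_mul z (hne z hz) (hcont s hs' z hz) (by fun_prop)
      (hprod s z (hsub hz)).differentiableAt]
    have : logDeriv (fun z => z - a) z = (z - a)⁻¹ := by
      simp [logDeriv_apply]
    rw [this, smul_eq_mul]
    ring

theorem Multiset.exists_map_univ_eq {α : Type*} (s : Multiset α) {m : ℕ} (hm : s.card = m) :
    ∃ f : Fin m → α, s = (Finset.univ : Finset (Fin m)).val.map f := by
  subst hm
  have h : ∀ l : List α, (l : Multiset α) = (Finset.univ : Finset (Fin l.length)).val.map l.get :=
    fun l => by rw [Fin.univ_val_map, List.ofFn_get]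
  induction s using Quotient.inductionOn with
  | h l => exact ⟨l.get, h l⟩

/-- Weierstrass factorization near the origin with locally constant number of roots and a uniform
lower bound for the unit factor. -/
theorem exists_weierstrass_data {E : Type*} [NormedAddCommGroup E] [NormedSpace ℂ E]
    [FiniteDimensional ℂ E] {G : E × ℂ → ℂ} (hG : AnalyticAt ℂ G 0)
    (hne : ¬ ∀ᶠ ω in 𝓝 0, G (0, ω) = 0) {W : Set (E × ℂ)} (hW : W ∈ 𝓝 0) :
    ∃ r > 0, ∃ ρ > 0, ∃ (m : ℕ) (c : ℝ), 0 < c ∧ ball 0 ρ ×ˢ closedBall 0 r ⊆ W ∧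
      (∀ q ∈ ball (0 : E) ρ ×ˢ closedBall (0 : ℂ) r, AnalyticAt ℂ G q) ∧
      (∀ z ∈ ball (0 : E) ρ, ∀ ω ∈ sphere (0 : ℂ) r, G (z, ω) ≠ 0) ∧
      (∀ ω ∈ closedBall (0 : ℂ) r, G (0, ω) = 0 → ω = 0) ∧
      ∀ z ∈ ball (0 : E) ρ, ∃ (s : Fin m → ℂ) (u : ℂ → ℂ), (∀ i, s i ∈ ball 0 r ∧ G (z, s i) = 0) ∧
        AnalyticOnNhd ℂ u (closedBall 0 r) ∧ (∀ ω ∈ closedBall 0 r, c ≤ ‖u ω‖) ∧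
        ∀ ω, G (z, ω) = (∏ i, (ω - s i)) * u ω := by
  have hG0 : AnalyticAt ℂ (fun ω => G (0, ω)) 0 :=
    hG.comp_of_eq (f := fun ω : ℂ => ((0 : E), ω)) (analyticAt_const.prod analyticAt_id) rfl
  obtain ⟨δ, hδ, hδW⟩ := Metric.nhds_basis_ball.mem_iff.1
    (inter_mem hW hG.eventually_analyticAt)
  have hpunct := hG0.eventually_eq_zero_or_eventually_ne_zero.resolve_left hne
  rw [eventually_nhdsWithin_iff, eventually_nhds_iff_ball] at hpunct
  obtain ⟨δ', hδ', hpunct⟩ := hpunct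
  set r := min δ δ' / 2 with hrdef
  have hr : 0 < r := by positivity
  have hrδ : r < δ := by have := min_le_left δ δ'; linarith [lt_min hδ hδ']
  have hrδ' : r < δ' := by have := min_le_right δ δ'; linarith [lt_min hδ hδ']
  have hbox : ∀ z ∈ ball (0 : E) δ, ∀ ω ∈ closedBall (0 : ℂ) r, (z, ω) ∈ ball (0 : E × ℂ) δ := by
    intro z hz ω hω
    rw [mem_closedBall_zero_iff] at hω
    rw [mem_ball_zero_iff] at hz
    rw [mem_ball_zero_iff, Prod.norm_mk]
    exact max_lt hz (by linarith)
  have hA : ∀ z ∈ ball (0 : E) δ, ∀ ω ∈ closedBall (0 : ℂ) r, AnalyticAt ℂ G (z, ω) :=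
    fun z hz ω hω => (hδW (hbox z hz ω hω)).2
  have hzero : ∀ ω ∈ closedBall (0 : ℂ) r, G (0, ω) = 0 → ω = 0 := by
    intro ω hω h
    by_contra h0
    refine hpunct ω ?_ h0 h
    rw [mem_closedBall_zero_iff] at hω
    rw [mem_ball_zero_iff]; linarith
  -- uniform lower bound on the circle
  obtain ⟨κ, hκ, ρ, hρ, hρδ, hlow⟩ : ∃ κ > 0, ∃ ρ > 0, ρ ≤ δ ∧
      ∀ z ∈ ball (0 : E) ρ, ∀ ω ∈ sphere (0 : ℂ) r, κ < ‖G (z, ω)‖ := by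
    have hS : IsCompact (sphere (0 : ℂ) r) := isCompact_sphere _ _
    have hSc : ContinuousOn (fun ω => ‖G (0, ω)‖) (sphere (0 : ℂ) r) := fun ω hω =>
      ((hA 0 (mem_ball_self hδ) ω (sphere_subset_closedBall hω)).continuousAt.comp (f := fun ω : ℂ => ((0 : E), ω))
        (by fun_prop)).norm.continuousWithinAt
    obtain ⟨ω₀, hω₀, hmin⟩ := hS.exists_isMinOn (NormedSpace.sphere_nonempty.2 hr.le) hSc
    have hpos : 0 < ‖G (0, ω₀)‖ := norm_pos_iff.2 fun h => by
      have := hzero ω₀ (sphere_subset_closedBall hω₀) h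
      rw [this] at hω₀
      simp [hr.ne] at hω₀
    have : ∀ᶠ z in 𝓝 (0 : E), ∀ ω ∈ sphere (0 : ℂ) r, ‖G (0, ω₀)‖ / 2 < ‖G (z, ω)‖ := by
      refine hS.eventually_forall_of_forall_eventually fun ω hω => ?_
      have hc := (hA 0 (mem_ball_self hδ) ω (sphere_subset_closedBall hω)).continuousAt.norm
      refine hc.eventually (lt_mem_nhds ?_)
      have : ‖G (0, ω₀)‖ ≤ ‖G (0, ω)‖ := hmin hω
      linarith
    obtain ⟨ρ, hρ, h⟩ := eventually_nhds_iff_ball.1 this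
    exact ⟨_, half_pos hpos, min ρ δ, lt_min hρ hδ, min_le_right _ _, fun z hz =>
      h z (ball_subset_ball (min_le_left _ _) hz)⟩
  have hballδ : ball (0 : E) ρ ⊆ ball 0 δ := ball_subset_ball hρδ
  have hnz : ∀ z ∈ ball (0 : E) ρ, ∀ ω ∈ sphere (0 : ℂ) r, G (z, ω) ≠ 0 := fun z hz ω hω =>
    norm_pos_iff.1 (hκ.trans (hlow z hz ω hω))
  obtain ⟨ω₁, hω₁⟩ : (sphere (0 : ℂ) r).Nonempty := NormedSpace.sphere_nonempty.2 hr.le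
  have hslice : ∀ z ∈ ball (0 : E) ρ, AnalyticOnNhd ℂ (fun ω => G (z, ω)) (closedBall 0 r) :=
    fun z hz ω hω => (hA z (hballδ hz) ω hω).comp_of_eq (f := fun ω : ℂ => (z, ω))
      (analyticAt_const.prod analyticAt_id) rfl
  have hfac : ∀ z : ball (0 : E) ρ, ∃ (s : Multiset ℂ) (u : ℂ → ℂ),
      (∀ a ∈ s, a ∈ ball 0 r ∧ G (z, a) = 0) ∧
      AnalyticOnNhd ℂ u (closedBall 0 r) ∧ (∀ ω ∈ closedBall 0 r, u ω ≠ 0) ∧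
        ∀ ω, G (z, ω) = (s.map fun a => ω - a).prod * u ω := by
    intro z
    obtain ⟨s, u, hs, hu, hu0, hf⟩ := AnalyticOnNhd.exists_eq_prod_mul (isCompact_closedBall 0 r)
      (convex_closedBall 0 r).isPreconnected (hslice z z.2) (sphere_subset_closedBall hω₁)
      (hnz z z.2 ω₁ hω₁)
    refine ⟨s, u, fun a ha => ⟨?_, (hs a ha).2⟩, hu, hu0, hf⟩
    rw [← closedBall_sdiff_sphere]
    exact ⟨(hs a ha).1, fun h => hnz z z.2 a h (hs a ha).2⟩
  choose s u hs hu hu0 hf using hfac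
  have hcount : ∀ z : ball (0 : E) ρ, ((s z).card : ℂ) = (2 * Real.pi * Complex.I : ℂ)⁻¹ *
      ∮ ω in C(0, r), logDeriv (fun ω => G (z, ω)) ω := by
    intro z
    have := circleIntegral_mul_logDeriv_prod (c := 0) hr (p := fun _ => 1)
      (fun _ _ => analyticAt_const) (hu z) (hu0 z) (s z) fun a ha => (hs z a ha).1
    have e : (fun ω => ((s z).map fun a => ω - a).prod * u z ω) = fun ω => G (z, ω) :=
      funext fun ω => (hf z ω).symm
    rw [e] at this
    simp only [one_mul] at this
    rw [this, inv_mul_cancel_left₀ Complex.two_pi_I_ne_zero]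
    simp
  have hcont : Continuous fun z : ball (0 : E) ρ => (s z).card := by
    have hderiv : ∀ z ∈ ball (0 : E) ρ, ∀ ω ∈ sphere (0 : ℂ) r,
        deriv (fun ω => G (z, ω)) ω = fderiv ℂ G (z, ω) (0, 1) := by
      intro z hz ω hω
      have h1 := (hA z (hballδ hz) ω (sphere_subset_closedBall hω)).differentiableAt.hasFDerivAt
      have h2 : HasDerivAt (fun ω : ℂ => (z, ω)) (0, 1) ω :=
        (hasDerivAt_const ω z).prodMk (hasDerivAt_id ω)
      exact (h1.comp_hasDerivAt_of_eq ω h2 rfl).deriv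
    have han := analyticOnNhd_circleIntegral (F := ℂ) (c := 0)
      (H := fun (z : E) (ω : ℂ) => fderiv ℂ G (z, ω) (0, 1) / G (z, ω))
      (V := ball (0 : E) ρ) isOpen_ball hr.le fun z hz ω hω => by
        have h := hA z (hballδ hz) ω (sphere_subset_closedBall hω)
        exact (((ContinuousLinearMap.apply ℂ ℂ ((0 : E), (1 : ℂ))).analyticAt _).comp
          h.fderiv).div h (hnz z hz ω hω)
    have hcr : Continuous fun z : ball (0 : E) ρ => ((s z).card : ℂ) := by
      have h2 := han.continuousOn.domRestrict
      have : (fun z : ball (0 : E) ρ => ((s z).card : ℂ)) = fun z =>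
          (2 * Real.pi * Complex.I : ℂ)⁻¹ * (ball (0 : E) ρ).domRestrict
            (fun z => ∮ ω in C(0, r), fderiv ℂ G (z, ω) (0, 1) / G (z, ω)) z := by
        ext z
        rw [hcount z]
        congr 1
        refine circleIntegral.integral_congr (g := fun ω => fderiv ℂ G (z, ω) (0, 1) / G (z, ω))
          hr.le fun ω hω => ?_
        rw [logDeriv_apply, hderiv z z.2 ω hω]
      rw [this]
      exact continuous_const.mul h2
    have hre : Continuous fun z : ball (0 : E) ρ => ((s z).card : ℝ) := by
      simpa [Function.comp_def] using Complex.continuous_re.comp hcr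
    exact Nat.isClosedEmbedding_coe_real.isInducing.continuous_iff.2 hre
  have hconst : ∀ z z' : ball (0 : E) ρ, (s z).card = (s z').card := by
    have : PreconnectedSpace (ball (0 : E) ρ) :=
      Subtype.preconnectedSpace (convex_ball (0 : E) ρ).isPreconnected
    exact fun z z' => PreconnectedSpace.constant this hcont
  set m := (s ⟨0, mem_ball_self hρ⟩).card
  refine ⟨r, hr, ρ, hρ, m, κ / (2 * r) ^ m, by positivity, ?_, ?_, hnz, hzero, ?_⟩
  · exact fun q hq => (hδW (hbox q.1 (hballδ hq.1) q.2 hq.2)).1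
  · exact fun q hq => hA q.1 (hballδ hq.1) q.2 hq.2
  · intro z hz
    obtain ⟨t, ht⟩ := (s ⟨z, hz⟩).exists_map_univ_eq (hconst ⟨z, hz⟩ ⟨0, mem_ball_self hρ⟩)
    have htb : ∀ i, t i ∈ ball (0 : ℂ) r ∧ G (z, t i) = 0 := fun i =>
      hs ⟨z, hz⟩ (t i) (by rw [ht]; exact Multiset.mem_map_of_mem _ (Finset.mem_univ i))
    have hfz : ∀ ω, G (z, ω) = (∏ i, (ω - t i)) * u ⟨z, hz⟩ ω := fun ω => by
      rw [hf ⟨z, hz⟩ ω, ht, Multiset.map_map]; rfl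
    refine ⟨t, u ⟨z, hz⟩, htb, hu _, ?_, hfz⟩
    have hsph : ∀ ω ∈ sphere (0 : ℂ) r, ‖(u ⟨z, hz⟩ ω)⁻¹‖ ≤ (κ / (2 * r) ^ m)⁻¹ := by
      intro ω hω
      rw [norm_inv]
      refine inv_anti₀ (by positivity) ?_
      rw [div_le_iff₀ (by positivity)]
      refine (hlow z hz ω hω).le.trans ?_
      rw [hfz ω, norm_mul, mul_comm, norm_prod]
      gcongr
      calc ∏ i, ‖ω - t i‖ ≤ ∏ _i : Fin m, (2 * r) := by
            refine Finset.prod_le_prod (fun _ _ => norm_nonneg _) fun i _ => ?_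
            have h1 := mem_ball_zero_iff.1 (htb i).1
            have h2 := mem_sphere_zero_iff_norm.1 hω
            linarith [norm_sub_le ω (t i)]
        _ = (2 * r) ^ m := by simp
    intro ω hω
    have hinv : DiffContOnCl ℂ (fun ω => (u ⟨z, hz⟩ ω)⁻¹) (ball 0 r) := by
      refine DifferentiableOn.diffContOnCl_ball (U := closedBall 0 r) ?_ Subset.rfl
      exact fun w hw => ((hu _ w hw).inv (hu0 _ w hw)).differentiableAt.differentiableWithinAt
    have := Complex.norm_le_of_forall_mem_frontier_norm_le isBounded_ball hinv
      (C := (κ / (2 * r) ^ m)⁻¹) (fun w hw => hsph w (by rwa [frontier_ball _ hr.ne'] at hw))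
      (z := ω) (by rwa [closure_ball _ hr.ne'])
    rw [norm_inv] at this
    exact (inv_le_inv₀ (norm_pos_iff.2 (hu0 _ ω hω)) (by positivity)).1 this

/-- On the zero set of a germ that is regular in the last variable, every germ is integral over the
germs in the remaining variables. -/
theorem exists_integral_relation {E : Type*} [NormedAddCommGroup E] [NormedSpace ℂ E]
    [FiniteDimensional ℂ E] {G p : E × ℂ → ℂ} (hG : AnalyticAt ℂ G 0)
    (hne : ¬ ∀ᶠ ω in 𝓝 0, G (0, ω) = 0) (hp : AnalyticAt ℂ p 0) :
    ∃ (m : ℕ) (c : ℕ → E → ℂ), (∀ j, AnalyticAt ℂ (c j) 0) ∧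
      ∀ᶠ q in 𝓝 (0 : E × ℂ), G q = 0 →
        p q ^ m + ∑ j ∈ Finset.range m, c j q.1 * p q ^ j = 0 := by
  obtain ⟨r, hr, ρ, hρ, m, κ, hκ, hsubW, hGan, hGne, -, hroots⟩ :=
    exists_weierstrass_data hG hne hp.eventually_analyticAt
  choose! s u hs hu hulow hfac using hroots
  have hpan : ∀ z ∈ ball (0 : E) ρ, ∀ ω ∈ closedBall (0 : ℂ) r, AnalyticAt ℂ p (z, ω) :=
    fun z hz ω hω => hsubW ⟨hz, hω⟩
  have hderiv : ∀ z ∈ ball (0 : E) ρ, ∀ ω ∈ sphere (0 : ℂ) r,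
      deriv (fun ω => G (z, ω)) ω = fderiv ℂ G (z, ω) (0, 1) := by
    intro z hz ω hω
    have h1 := (hGan (z, ω) ⟨hz, sphere_subset_closedBall hω⟩).differentiableAt.hasFDerivAt
    have h2 : HasDerivAt (fun ω : ℂ => (z, ω)) (0, 1) ω :=
      (hasDerivAt_const ω z).prodMk (hasDerivAt_id ω)
    exact (h1.comp_hasDerivAt_of_eq ω h2 rfl).deriv
  -- power sums
  have hpsum : ∀ l : ℕ, AnalyticOnNhd ℂ (fun z => ∑ i, p (z, s z i) ^ l) (ball (0 : E) ρ) := by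
    intro l
    have han := analyticOnNhd_circleIntegral (F := ℂ) (c := 0)
      (H := fun (z : E) (ω : ℂ) => p (z, ω) ^ l * (fderiv ℂ G (z, ω) (0, 1) / G (z, ω)))
      (V := ball (0 : E) ρ) isOpen_ball hr.le fun z hz ω hω => by
        have hω' := sphere_subset_closedBall hω
        have h := hGan (z, ω) ⟨hz, hω'⟩
        exact ((hpan z hz ω hω').pow l).mul
          ((((ContinuousLinearMap.apply ℂ ℂ ((0 : E), (1 : ℂ))).analyticAt _).comp
          h.fderiv).div h (hGne z hz ω hω))
    have han' : AnalyticOnNhd ℂ (fun z => (2 * Real.pi * Complex.I : ℂ)⁻¹ *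
        ∮ ω in C(0, r), p (z, ω) ^ l * (fderiv ℂ G (z, ω) (0, 1) / G (z, ω))) (ball (0 : E) ρ) :=
      fun z hz => analyticAt_const.mul (han z hz)
    refine han'.congr isOpen_ball fun z hz => ?_
    have hu0 : ∀ ω ∈ closedBall (0 : ℂ) r, u z ω ≠ 0 := fun ω hω =>
      norm_pos_iff.1 (hκ.trans_le (hulow z hz ω hω))
    have hpz : AnalyticOnNhd ℂ (fun ω => p (z, ω) ^ l) (closedBall 0 r) := fun ω hω =>
      ((hpan z hz ω hω).comp_of_eq (f := fun ω : ℂ => (z, ω))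
        (analyticAt_const.prod analyticAt_id) rfl).pow l
    have key := circleIntegral_mul_logDeriv_prod (c := 0) hr hpz (hu z hz) hu0
      ((Finset.univ : Finset (Fin m)).val.map (s z)) (by
        intro a ha
        obtain ⟨i, -, rfl⟩ := Multiset.mem_map.1 ha
        exact (hs z hz i).1)
    have e : (fun ω => ((((Finset.univ : Finset (Fin m)).val.map (s z)).map
        fun a => ω - a).prod * u z ω)) = fun ω => G (z, ω) := by
      ext ω
      rw [hfac z hz ω, Multiset.map_map]; rfl
    rw [e, Multiset.map_map] at key
    have e2 : (∮ ω in C(0, r), p (z, ω) ^ l * (fderiv ℂ G (z, ω) (0, 1) / G (z, ω)))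
        = ∮ ω in C(0, r), p (z, ω) ^ l * logDeriv (fun ω => G (z, ω)) ω := by
      refine circleIntegral.integral_congr hr.le fun ω hω => ?_
      simp only [logDeriv_apply, hderiv z hz ω hω]
    rw [e2, key, inv_mul_cancel_left₀ Complex.two_pi_I_ne_zero]
    rfl
  -- elementary symmetric functions
  set e : ℕ → E → ℂ := fun k z =>
    MvPolynomial.aeval (fun i => p (z, s z i)) (MvPolynomial.esymm (Fin m) ℂ k) with he
  have hean : ∀ k, AnalyticOnNhd ℂ (e k) (ball (0 : E) ρ) := by
    intro k
    induction k using Nat.strong_induction_on with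
    | _ k ih =>
      rcases Nat.eq_zero_or_pos k with rfl | hk
      · have : e 0 = fun _ => 1 := by ext z; simp [he]
        rw [this]; exact fun _ _ => analyticAt_const
      have hnewton : ∀ z, e k z = (k : ℂ)⁻¹ * ((-1) ^ (k + 1) *
          ∑ a ∈ Finset.HasAntidiagonal.antidiagonal k with a.1 < k,
            (-1) ^ a.1 * e a.1 z * ∑ i, p (z, s z i) ^ a.2) := by
        intro z
        have h := congrArg (MvPolynomial.aeval (fun i => p (z, s z i)))
          (MvPolynomial.mul_esymm_eq_sum (Fin m) ℂ k)
        simp only [map_mul, map_natCast, map_pow, map_neg, map_one, map_sum,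
          MvPolynomial.psum, MvPolynomial.aeval_X] at h
        rw [← h, inv_mul_cancel_left₀ (Nat.cast_ne_zero.2 hk.ne')]
      rw [funext hnewton]
      refine fun z hz => analyticAt_const.mul (analyticAt_const.mul ?_)
      refine Finset.analyticAt_fun_sum _ fun a ha => ?_
      exact (analyticAt_const.mul (ih a.1 (Finset.mem_filter.1 ha).2 z hz)).mul (hpsum a.2 z hz)
  refine ⟨m, fun j z => (-1) ^ (m - j) * e (m - j) z, fun j =>
    analyticAt_const.mul (hean _ 0 (mem_ball_self hρ)), ?_⟩
  have hmem : ball (0 : E) ρ ×ˢ ball (0 : ℂ) r ∈ 𝓝 (0 : E × ℂ) :=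
    (isOpen_ball.prod isOpen_ball).mem_nhds ⟨mem_ball_self hρ, mem_ball_self hr⟩
  filter_upwards [hmem] with q hq hGq
  obtain ⟨z, ω⟩ := q
  obtain ⟨hz, hω⟩ := hq
  have hω' := ball_subset_closedBall hω
  rw [hfac z hz ω] at hGq
  have h0 := (mul_eq_zero.1 hGq).resolve_right
    (norm_pos_iff.1 (hκ.trans_le (hulow z hz ω hω')))
  obtain ⟨i, -, hi⟩ := Finset.prod_eq_zero_iff.1 h0
  rw [sub_eq_zero] at hi
  have hprod : ∏ j, (p (z, ω) - p (z, s z j)) = 0 :=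
    Finset.prod_eq_zero (Finset.mem_univ i) (by rw [← hi, sub_self])
  have hv := congrArg (Polynomial.eval (p (z, ω))) (Multiset.prod_X_sub_X_eq_sum_esymm
    ((Finset.univ : Finset (Fin m)).val.map fun j => p (z, s z j)))
  rw [Multiset.map_map] at hv
  have hl : Polynomial.eval (p (z, ω)) ((Finset.univ : Finset (Fin m)).val.map
      ((fun t => Polynomial.X - Polynomial.C t) ∘ fun j => p (z, s z j))).prod = 0 := by
    rw [← hprod]
    change Polynomial.eval _ (∏ j, (Polynomial.X - Polynomial.C (p (z, s z j)))) = _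
    simp [Polynomial.eval_prod]
  rw [hl] at hv
  have hes : ∀ k, ((Finset.univ : Finset (Fin m)).val.map fun j => p (z, s z j)).esymm k = e k z :=
    fun k => (MvPolynomial.aeval_esymm_eq_multiset_esymm (Fin m) ℂ _ _).symm
  simp only [Multiset.card_map, Finset.card_val, Finset.card_univ, Fintype.card_fin,
    Polynomial.eval_finsetSum, Polynomial.eval_mul, Polynomial.eval_pow, Polynomial.eval_neg,
    Polynomial.eval_one, Polynomial.eval_C, Polynomial.eval_X, hes] at hv
  rw [← Finset.sum_range_reflect, Finset.sum_range_succ] at hv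
  have he0 : e 0 z = 1 := by simp [he]
  rw [hv]
  simp only [Nat.add_sub_cancel, tsub_self, pow_zero, he0, one_mul, tsub_zero]
  rw [add_comm]
  congr 1
  refine Finset.sum_congr rfl fun j hj => ?_
  have : j < m := Finset.mem_range.1 hj
  rw [Nat.sub_sub_self this.le, mul_assoc]

/-- A continuous germ vanishing at `0` that satisfies a monic polynomial relation whose coefficients
vanish identically as soon as they vanish at `0`, vanishes identically. -/
theorem eventually_eq_zero_of_monic_relation {v : ℂ → ℂ} {C : ℕ → ℂ → ℂ} {m : ℕ}
    (hv : ContinuousAt v 0) (hv0 : v 0 = 0) (hC : ∀ j < m, ContinuousAt (C j) 0)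
    (hC0 : ∀ j < m, C j 0 = 0 → ∀ᶠ σ in 𝓝 0, C j σ = 0)
    (hrel : ∀ᶠ σ in 𝓝 0, v σ ^ m + ∑ j ∈ Finset.range m, C j σ * v σ ^ j = 0) :
    ∀ᶠ σ in 𝓝 0, v σ = 0 := by
  classical
  set D : ℕ → ℂ → ℂ := fun j σ => if j < m then C j σ else 1 with hD
  have hDm : D m 0 ≠ 0 := by simp [hD]
  have hex : ∃ j, D j 0 ≠ 0 := ⟨m, hDm⟩
  set a := Nat.find hex
  have ha : D a 0 ≠ 0 := Nat.find_spec hex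
  have ham : a ≤ m := Nat.find_min' hex hDm
  have hDc : ∀ j, ContinuousAt (D j) 0 := by
    intro j
    by_cases h : j < m
    · simpa [hD, h] using hC j h
    · simpa [hD, h] using continuousAt_const
  have hlow : ∀ᶠ σ in 𝓝 0, ∀ j ∈ Finset.range a, D j σ = 0 := by
    rw [Filter.eventually_all_finset]
    intro j hj
    have hja := Finset.mem_range.1 hj
    have hjm := hja.trans_le ham
    have h0 : D j 0 = 0 := by simpa using Nat.find_min hex hja
    simpa [hD, hjm] using hC0 j hjm (by simpa [hD, hjm] using h0)
  set R : ℂ → ℂ := fun σ => ∑ i ∈ Finset.range (m - a + 1), D (a + i) σ * v σ ^ i with hR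
  have hRc : ContinuousAt R 0 := by
    refine tendsto_finsetSum _ fun i _ => ?_
    exact ((hDc (a + i)).mul (hv.pow i))
  have hR0 : R 0 ≠ 0 := by
    have : R 0 = D a 0 := by
      simp only [hR, hv0]
      rw [Finset.sum_eq_single 0] <;> simp +contextual
    rwa [this]
  filter_upwards [hlow, hRc.eventually_ne hR0, hrel] with σ hl hr hs
  have hsum : ∑ j ∈ Finset.range (m + 1), D j σ * v σ ^ j = 0 := by
    rw [Finset.sum_range_succ, ← hs, add_comm]
    congr 1
    · simp [hD]
    · exact Finset.sum_congr rfl fun j hj => by simp [hD, Finset.mem_range.1 hj]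
  rw [show m + 1 = a + (m - a + 1) by omega, Finset.sum_range_add,
    Finset.sum_eq_zero fun j hj => by rw [hl j hj, zero_mul], zero_add] at hsum
  have : v σ ^ a * R σ = 0 := by
    rw [← hsum, hR, Finset.mul_sum]
    exact Finset.sum_congr rfl fun i _ => by rw [pow_add]; ring
  exact eq_zero_of_pow_eq_zero ((mul_eq_zero.1 this).resolve_right hr)

/-- The implicit function theorem in one complex unknown. -/
theorem AnalyticAt.exists_implicit_root {E : Type*} [NormedAddCommGroup E] [NormedSpace ℂ E]
    [FiniteDimensional ℂ E] {G : E × ℂ → ℂ} {q : E × ℂ} (hG : AnalyticAt ℂ G q) (hq : G q = 0)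
    (hd : fderiv ℂ G q (0, 1) ≠ 0) :
    ∃ ψ : E → ℂ, ψ q.1 = q.2 ∧ DifferentiableAt ℂ ψ q.1 ∧ ∀ᶠ z in 𝓝 q.1, G (z, ψ z) = 0 := by
  have : CompleteSpace E := FiniteDimensional.complete ℂ E
  have hs := hG.hasStrictFDerivAt
  have hinv : ((fderiv ℂ G q) ∘L .inr ℂ E ℂ).IsInvertible := by
    refine ⟨ContinuousLinearEquiv.unitsEquivAut ℂ (Units.mk0 _ hd), ?_⟩
    ext
    simp
  refine ⟨hs.implicitFunctionOfProdDomain hinv,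
    (hs.eventually_apply_eq_iff_implicitFunctionOfProdDomain hinv).self_of_nhds.1 rfl,
    (hs.hasStrictFDerivAt_implicitFunctionOfProdDomain hinv).hasFDerivAt.differentiableAt, ?_⟩
  simpa [hq] using hs.eventually_apply_implicitFunctionOfProdDomain hinv

/-- A germ regular in the last variable and vanishing along `q k` can be replaced by one of its
derivatives which has a simple root along `q k`. -/
theorem exists_simple_root_along {E : Type*} [NormedAddCommGroup E] [NormedSpace ℂ E]
    [FiniteDimensional ℂ E] {𝒰 : Ultrafilter ℕ} {q : ℕ → E × ℂ} (hq : Tendsto q 𝒰 (𝓝 0))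
    {G : E × ℂ → ℂ} (hG : AnalyticAt ℂ G 0) (hne : ¬ ∀ᶠ ω in 𝓝 0, G (0, ω) = 0)
    (hz : ∀ᶠ k in 𝒰, G (q k) = 0) :
    ∃ D : E × ℂ → ℂ, AnalyticAt ℂ D 0 ∧ (¬ ∀ᶠ ω in 𝓝 0, D (0, ω) = 0) ∧
      ∀ᶠ k in 𝒰, D (q k) = 0 ∧ fderiv ℂ D (q k) (0, 1) ≠ 0 := by
  have hline : ∀ {G : E × ℂ → ℂ}, AnalyticAt ℂ G 0 → AnalyticAt ℂ (fun ω => G (0, ω)) 0 :=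
    fun hG => hG.comp_of_eq (f := fun ω : ℂ => ((0 : E), ω))
      (analyticAt_const.prod analyticAt_id) rfl
  have main : ∀ (m : ℕ) (G : E × ℂ → ℂ), AnalyticAt ℂ G 0 →
      analyticOrderAt (fun ω => G (0, ω)) 0 = m → (∀ᶠ k in 𝒰, G (q k) = 0) →
      ∃ D : E × ℂ → ℂ, AnalyticAt ℂ D 0 ∧ (¬ ∀ᶠ ω in 𝓝 0, D (0, ω) = 0) ∧
        ∀ᶠ k in 𝒰, D (q k) = 0 ∧ fderiv ℂ D (q k) (0, 1) ≠ 0 := by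
    intro m
    induction m with
    | zero =>
      intro G hG hm hz
      exfalso
      have h0 : G (0, 0) ≠ 0 := (hline hG).analyticOrderAt_eq_zero.1 (by simpa using hm)
      have := (hG.continuousAt.tendsto.comp hq).eventually_ne h0
      exact (this.and hz).exists.elim fun k hk => hk.1 hk.2
    | succ m ih =>
      intro G hG hm hz
      by_cases hd : ∀ᶠ k in 𝒰, fderiv ℂ G (q k) (0, 1) = 0
      · refine ih (fun p => fderiv ℂ G p (0, 1))
          (((ContinuousLinearMap.apply ℂ ℂ ((0 : E), (1 : ℂ))).analyticAt _).comp hG.fderiv) ?_ hd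
        have h0 : G (0, 0) = 0 := by
          have := hG.continuousAt.tendsto.comp hq
          refine tendsto_nhds_unique this (tendsto_const_nhds.congr' ?_)
          filter_upwards [hz] with k hk using hk.symm
        have hder : deriv (fun ω => G (0, ω)) =ᶠ[𝓝 0] fun ω => fderiv ℂ G (0, ω) (0, 1) := by
          have hc : ContinuousAt (fun ω : ℂ => ((0 : E), ω)) 0 := by fun_prop
          filter_upwards [hc.eventually (by exact hG.eventually_analyticAt)] with ω hω
          exact (hω.differentiableAt.hasFDerivAt.comp_hasDerivAt_of_eq ω
            ((hasDerivAt_const ω (0 : E)).prodMk (hasDerivAt_id ω)) rfl).deriv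
        rw [← analyticOrderAt_congr hder]
        have := (hline hG).analyticOrderAt_deriv_add_one
        simp only [h0, sub_zero, hm, Nat.cast_succ] at this
        exact ENat.add_left_injective_of_ne_top ENat.one_ne_top this
      · refine ⟨G, hG, ?_, hz.and (Ultrafilter.eventually_not.2 hd)⟩
        intro h
        have : analyticOrderAt (fun ω => G (0, ω)) 0 = ⊤ := analyticOrderAt_eq_top.2 h
        simp [hm] at this
  obtain ⟨m, hm⟩ := ENat.ne_top_iff_exists.1
    (fun h => hne (analyticOrderAt_eq_top.1 h) : analyticOrderAt (fun ω => G (0, ω)) 0 ≠ ⊤)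
  exact main m G hG hm.symm hz

/-- Three positive infinitesimal scales, each flat with respect to the previous one. -/
structure HierarchicalScales (𝒰 : Ultrafilter ℕ) (t h φ : ℕ → ℝ) : Prop where
  pos : ∀ᶠ k in 𝒰, 0 < t k ∧ 0 < h k ∧ 0 < φ k
  tendsto : Tendsto t 𝒰 (𝓝 0)
  flat_left : ∀ N : ℕ, ∀ᶠ k in 𝒰, h k ≤ t k ^ N
  flat_right : ∀ N : ℕ, ∀ᶠ k in 𝒰, φ k ≤ h k ^ N

/-- The points `(φ k, h k, t k, w k)` can be moved in the direction of `φ` by a differentiable curve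
along which each member of `Fs` that vanishes at the starting point keeps vanishing. -/
def CurveLifting (𝒰 : Ultrafilter ℕ) (t h φ : ℕ → ℝ) {M : ℕ} (w : ℕ → Fin M → ℂ)
    (Fs : Set (ℂ × ℂ × ℂ × (Fin M → ℂ) → ℂ)) : Prop :=
  ∀ᶠ k in 𝒰, ∃ γ : ℂ → Fin M → ℂ, γ 0 = w k ∧ DifferentiableAt ℂ γ 0 ∧
    ∀ f ∈ Fs, f (φ k, h k, t k, w k) = 0 → ∀ᶠ σ in 𝓝 0, f (φ k + σ, h k, t k, γ σ) = 0

namespace HierarchicalScales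

variable {𝒰 : Ultrafilter ℕ} {t h φ : ℕ → ℝ}

theorem tendsto_left (H : HierarchicalScales 𝒰 t h φ) : Tendsto h 𝒰 (𝓝 0) := by
  refine squeeze_zero' (H.pos.mono fun k hk => hk.2.1.le) (H.flat_left 1) ?_
  simpa using H.tendsto

theorem tendsto_right (H : HierarchicalScales 𝒰 t h φ) : Tendsto φ 𝒰 (𝓝 0) := by
  refine squeeze_zero' (H.pos.mono fun k hk => hk.2.2.le) (H.flat_right 1) ?_
  simpa using H.tendsto_left

theorem tendsto_point (H : HierarchicalScales 𝒰 t h φ) {M : ℕ} {w : ℕ → Fin M → ℂ}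
    (hw : Tendsto w 𝒰 (𝓝 0)) :
    Tendsto (fun k => ((φ k : ℂ), (h k : ℂ), (t k : ℂ), w k)) 𝒰 (𝓝 0) := by
  have ofReal : ∀ {u : ℕ → ℝ}, Tendsto u 𝒰 (𝓝 0) → Tendsto (fun k => (u k : ℂ)) 𝒰 (𝓝 0) :=
    fun hu => (Complex.continuous_ofReal.tendsto' 0 0 rfl).comp hu
  exact (ofReal H.tendsto_right).prodMk_nhds ((ofReal H.tendsto_left).prodMk_nhds
    ((ofReal H.tendsto).prodMk_nhds hw))

theorem rescale (H : HierarchicalScales 𝒰 t h φ) (a b : ℕ) :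
    HierarchicalScales 𝒰 t (fun k => h k / t k ^ a) (fun k => φ k / (t k ^ a * h k ^ b)) where
  pos := by
    filter_upwards [H.pos] with k ⟨h1, h2, h3⟩
    exact ⟨h1, by positivity, by positivity⟩
  tendsto := H.tendsto
  flat_left N := by
    filter_upwards [H.pos, H.flat_left (N + a)] with k ⟨h1, _, _⟩ hk
    rwa [div_le_iff₀ (by positivity), ← pow_add]
  flat_right N := by
    filter_upwards [H.pos, H.flat_left a, H.flat_right (b + N + 1),
      H.tendsto.eventually (gt_mem_nhds zero_lt_one)] with k ⟨h1, h2, h3⟩ hk hk' hlt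
    rw [div_le_iff₀ (by positivity)]
    have hle : h k ≤ h k / t k ^ a := by
      rw [le_div_iff₀ (by positivity)]
      exact mul_le_of_le_one_right h2.le (pow_le_one₀ h1.le hlt.le)
    calc φ k ≤ h k ^ (b + N + 1) := hk'
      _ = h k ^ N * (h k * h k ^ b) := by ring
      _ ≤ (h k / t k ^ a) ^ N * (t k ^ a * h k ^ b) := by gcongr

end HierarchicalScales

/-- After rescaling, a nonzero germ becomes nonzero on the zero fibre of the scales. -/
theorem exists_rescaled_germ {𝒰 : Ultrafilter ℕ} {t h φ : ℕ → ℝ} (H : HierarchicalScales 𝒰 t h φ)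
    {M : ℕ} {w : ℕ → Fin M → ℂ} (hw : Tendsto w 𝒰 (𝓝 0)) {f : ℂ × ℂ × ℂ × (Fin M → ℂ) → ℂ}
    (hf : AnalyticAt ℂ f 0) (hne : ¬ ∀ᶠ p in 𝓝 0, f p = 0)
    (hz : ∀ᶠ k in 𝒰, f (φ k, h k, t k, w k) = 0) :
    ∃ (a b : ℕ) (F : ℂ × ℂ × ℂ × (Fin M → ℂ) → ℂ), AnalyticAt ℂ F 0 ∧
      (¬ ∀ᶠ w in 𝓝 0, F (0, 0, 0, w) = 0) ∧
      ∀ᶠ k in 𝒰, F (((φ k / (t k ^ a * h k ^ b) : ℝ) : ℂ), ((h k / t k ^ a : ℝ) : ℂ), t k, w k)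
        = 0 := by
  obtain ⟨c, u₁, q₁, hu₁, hq₁, hne₁, he₁⟩ := exists_analyticAt_eq_pow_mul hf hne
  obtain ⟨b, u₂, q₂, hu₂, hq₂, hne₂, he₂⟩ := exists_analyticAt_eq_pow_mul hu₁ hne₁
  obtain ⟨a, u₃, q₃, hu₃, hq₃, hne₃, he₃⟩ := exists_analyticAt_eq_pow_mul hu₂ hne₂
  have hzk := H.tendsto_point hw
  have hzk₂ := (continuous_snd.tendsto' (0 : ℂ × ℂ × ℂ × (Fin M → ℂ)) 0 rfl).comp hzk
  have hzk₃ := (continuous_snd.tendsto' (0 : ℂ × ℂ × (Fin M → ℂ)) 0 rfl).comp hzk₂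
  let F : ℂ × ℂ × ℂ × (Fin M → ℂ) → ℂ := fun p => u₃ p.2.2.2 + p.2.2.1 * q₃ p.2.2 +
    p.2.1 * q₂ (p.2.2.1 ^ a * p.2.1, p.2.2) +
    p.1 * q₁ (p.2.2.1 ^ a * (p.2.2.1 ^ a * p.2.1) ^ b * p.1, p.2.2.1 ^ a * p.2.1, p.2.2)
  have a₁ : AnalyticAt ℂ (fun p : ℂ × ℂ × ℂ × (Fin M → ℂ) => p.1) 0 := analyticAt_fst
  have s₁ : AnalyticAt ℂ (fun p : ℂ × ℂ × ℂ × (Fin M → ℂ) => p.2) 0 := analyticAt_snd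
  have a₂ : AnalyticAt ℂ (fun p : ℂ × ℂ × ℂ × (Fin M → ℂ) => p.2.1) 0 :=
    analyticAt_fst.comp s₁
  have s₂ : AnalyticAt ℂ (fun p : ℂ × ℂ × ℂ × (Fin M → ℂ) => p.2.2) 0 :=
    analyticAt_snd.comp s₁
  have a₃ : AnalyticAt ℂ (fun p : ℂ × ℂ × ℂ × (Fin M → ℂ) => p.2.2.1) 0 :=
    analyticAt_fst.comp s₂
  have s₃ : AnalyticAt ℂ (fun p : ℂ × ℂ × ℂ × (Fin M → ℂ) => p.2.2.2) 0 :=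
    analyticAt_snd.comp s₂
  have hh := (a₃.pow a).mul a₂
  have hφ := ((a₃.pow a).mul (hh.pow b)).mul a₁
  have hF : AnalyticAt ℂ F 0 := by
    refine ((hu₃.comp_of_eq s₃ rfl).add (a₃.mul (hq₃.comp_of_eq s₂ rfl))).add
      (a₂.mul (hq₂.comp_of_eq (hh.prod s₂) ?_)) |>.add
      (a₁.mul (hq₁.comp_of_eq (hφ.prod (hh.prod s₂)) ?_)) <;> simp
  refine ⟨a, b, F, hF, by simpa [F] using hne₃, ?_⟩
  filter_upwards [hz, H.pos, hzk.eventually he₁, hzk₂.eventually he₂, hzk₃.eventually he₃]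
    with k hk ⟨h1, h2, h3⟩ k₁ k₂ k₃
  have t0 : (t k : ℂ) ≠ 0 := Complex.ofReal_ne_zero.2 h1.ne'
  have h0 : (h k : ℂ) ≠ 0 := Complex.ofReal_ne_zero.2 h2.ne'
  have φ0 : (φ k : ℂ) ≠ 0 := Complex.ofReal_ne_zero.2 h3.ne'
  simp only [Function.comp_apply] at k₂ k₃
  rw [k₃] at k₂
  rw [k₂, hk] at k₁
  have e1 : (t k : ℂ) ^ a * (h k / t k ^ a) = h k := by field_simp
  have e2 : (t k : ℂ) ^ a * h k ^ b * (φ k / (t k ^ a * h k ^ b)) = φ k := by field_simp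
  have := (mul_eq_zero.1 k₁.symm).resolve_left (pow_ne_zero _ φ0)
  simp only [F, Complex.ofReal_div, Complex.ofReal_mul, Complex.ofReal_pow, e1, e2]
  refine (mul_eq_zero.1 (?_ : (t k : ℂ) ^ a * h k ^ b * _ = 0)).resolve_left
    (mul_ne_zero (pow_ne_zero _ t0) (pow_ne_zero _ h0))
  rw [← this]
  field_simp

/-- Curve lifting descends along the rescaling of the parameters. -/
theorem CurveLifting.of_rescale {𝒰 : Ultrafilter ℕ} {t h φ : ℕ → ℝ}
    (H : HierarchicalScales 𝒰 t h φ) {M : ℕ} {w : ℕ → Fin M → ℂ}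
    {Fs : Set (ℂ × ℂ × ℂ × (Fin M → ℂ) → ℂ)} (a b : ℕ)
    (hL : CurveLifting 𝒰 t (fun k => h k / t k ^ a) (fun k => φ k / (t k ^ a * h k ^ b)) w
      ((fun (f : ℂ × ℂ × ℂ × (Fin M → ℂ) → ℂ) p => f (p.2.2.1 ^ a * (p.2.2.1 ^ a * p.2.1) ^ b * p.1,
        p.2.2.1 ^ a * p.2.1, p.2.2)) '' Fs)) :
    CurveLifting 𝒰 t h φ w Fs := by
  filter_upwards [hL, H.pos] with k ⟨γ, hγ0, hγd, hγ⟩ ⟨h1, h2, h3⟩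
  have t0 : (t k : ℂ) ≠ 0 := Complex.ofReal_ne_zero.2 h1.ne'
  have h0 : (h k : ℂ) ≠ 0 := Complex.ofReal_ne_zero.2 h2.ne'
  have e1 : (t k : ℂ) ^ a * (h k / t k ^ a) = h k := by field_simp
  set κ : ℂ := t k ^ a * h k ^ b with hκ
  have κ0 : κ ≠ 0 := mul_ne_zero (pow_ne_zero _ t0) (pow_ne_zero _ h0)
  have e2 : κ * (φ k / κ) = φ k := by field_simp
  have hdiv : Tendsto (fun σ : ℂ => σ / κ) (𝓝 0) (𝓝 0) := by
    simpa using (continuous_id.div_const κ).tendsto (0 : ℂ)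
  refine ⟨fun σ => γ (σ / κ), by simpa using hγ0, ?_, fun f hf hf0 => ?_⟩
  · exact DifferentiableAt.comp (0 : ℂ) (by simpa using hγd) (differentiableAt_id.div_const κ)
  · have := hγ _ ⟨f, hf, rfl⟩
    simp only [Complex.ofReal_div, Complex.ofReal_mul, Complex.ofReal_pow, e1, ← hκ, e2] at this
    filter_upwards [hdiv.eventually (this hf0)] with σ hσ
    rwa [mul_add, e2, mul_div_cancel₀ _ κ0] at hσ

/-- Reduction of curve lifting to one variable less, given a germ that is regular in the last
variable and vanishes along the sequence. -/
theorem CurveLifting.of_regular {𝒰 : Ultrafilter ℕ} {t h φ : ℕ → ℝ}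
    (H : HierarchicalScales 𝒰 t h φ) {M : ℕ}
    (ih : ∀ (w : ℕ → Fin M → ℂ) (Fs : Set (ℂ × ℂ × ℂ × (Fin M → ℂ) → ℂ)),
      Tendsto w 𝒰 (𝓝 0) → Fs.Finite → (∀ f ∈ Fs, AnalyticAt ℂ f 0) → CurveLifting 𝒰 t h φ w Fs)
    {w : ℕ → Fin (M + 1) → ℂ} (hw : Tendsto w 𝒰 (𝓝 0))
    {Fs : Set (ℂ × ℂ × ℂ × (Fin (M + 1) → ℂ) → ℂ)} (hfin : Fs.Finite)
    (hFs : ∀ f ∈ Fs, AnalyticAt ℂ f 0) {F : ℂ × ℂ × ℂ × (Fin (M + 1) → ℂ) → ℂ}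
    (hF : AnalyticAt ℂ F 0) (hne : ¬ ∀ᶠ w in 𝓝 0, F (0, 0, 0, w) = 0)
    (hz : ∀ᶠ k in 𝒰, F (φ k, h k, t k, w k) = 0) :
    CurveLifting 𝒰 t h φ w Fs := by
  -- a direction in which `F` is regular
  have hF0 : AnalyticAt ℂ (fun w => F (0, 0, 0, w)) 0 :=
    hF.comp_of_eq (f := fun w : Fin (M + 1) → ℂ => ((0 : ℂ), (0 : ℂ), (0 : ℂ), w))
      (analyticAt_const.prod (analyticAt_const.prod (analyticAt_const.prod analyticAt_id))) rfl
  obtain ⟨v, hv⟩ : ∃ v, ¬ ∀ᶠ s : ℂ in 𝓝 0, F (0, 0, 0, s • v) = 0 := by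
    obtain ⟨ρ, hρ, hFρ⟩ := hF0.exists_ball_analyticOnNhd
    by_contra! hall
    refine hne ?_
    filter_upwards [ball_mem_nhds 0 hρ] with v hv
    by_contra hFv
    exact not_eventually_line_eq_zero hFρ hv hFv (hall v)
  by_cases hv0 : v = 0
  · subst hv0
    have h00 : F (0, 0, 0, 0) ≠ 0 := by simpa using hv
    obtain ⟨k, hk, hk'⟩ := (((hF.continuousAt.tendsto.comp (H.tendsto_point hw)).eventually_ne
      h00).and hz).exists
    exact absurd hk' hk
  obtain ⟨Λ, hΛ⟩ : ∃ Λ : ((Fin M → ℂ) × ℂ) ≃L[ℂ] (Fin (M + 1) → ℂ), Λ (0, 1) = v := by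
    let Λ₀ : ((Fin M → ℂ) × ℂ) ≃L[ℂ] (Fin (M + 1) → ℂ) :=
      ContinuousLinearEquiv.ofFinrankEq (by simp)
    obtain ⟨A, hA⟩ := SeparatingDual.exists_continuousLinearEquiv_apply_eq (R := ℂ)
      (x := Λ₀ (0, 1)) (y := v) (by simp) hv0
    exact ⟨Λ₀.trans A, hA⟩
  let θ : (ℂ × ℂ × ℂ × (Fin M → ℂ)) × ℂ → ℂ × ℂ × ℂ × (Fin (M + 1) → ℂ) := fun p =>
    (p.1.1, p.1.2.1, p.1.2.2.1, Λ (p.1.2.2.2, p.2))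
  have hθd : Differentiable ℂ θ := by fun_prop
  have hθan : ∀ p, AnalyticAt ℂ θ p := fun p =>
    hθd.differentiableOn.analyticOnNhd_of_finiteDimensional isOpen_univ p (mem_univ p)
  have hθ0 : θ 0 = 0 := by simp [θ]
  let w' : ℕ → Fin M → ℂ := fun k => (Λ.symm (w k)).1
  let q : ℕ → (ℂ × ℂ × ℂ × (Fin M → ℂ)) × ℂ := fun k =>
    ((φ k, h k, t k, w' k), (Λ.symm (w k)).2)
  have hΛw : Tendsto (fun k => Λ.symm (w k)) 𝒰 (𝓝 0) := by
    exact (Λ.symm.continuous.tendsto' 0 0 (map_zero _)).comp hw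
  have hw' : Tendsto w' 𝒰 (𝓝 0) := (continuous_fst.tendsto' (0 : (Fin M → ℂ) × ℂ) 0 rfl).comp hΛw
  have hq : Tendsto q 𝒰 (𝓝 0) := (H.tendsto_point hw').prodMk_nhds
    ((continuous_snd.tendsto' (0 : (Fin M → ℂ) × ℂ) 0 rfl).comp hΛw)
  have hθq : ∀ k, θ (q k) = ((φ k : ℂ), (h k : ℂ), (t k : ℂ), w k) := fun k => by simp [θ, q, w']
  have hpull : ∀ {f : ℂ × ℂ × ℂ × (Fin (M + 1) → ℂ) → ℂ}, AnalyticAt ℂ f 0 →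
      AnalyticAt ℂ (f ∘ θ) 0 := fun hf => hf.comp_of_eq (hθan 0) hθ0
  obtain ⟨D, hD, hDne, hDz⟩ := exists_simple_root_along (G := F ∘ θ) hq (hpull hF)
    (by
      have : ∀ s : ℂ, θ (0, s) = (0, 0, 0, s • v) := fun s => by
        have : ((0 : Fin M → ℂ), s) = s • ((0 : Fin M → ℂ), (1 : ℂ)) := by simp
        simp only [θ, Prod.fst_zero, Prod.snd_zero, this, map_smul, hΛ]
      simpa only [Function.comp_apply, this] using hv)
    (by simpa only [Function.comp_apply, hθq] using hz)
  have hrel : ∀ f : ℂ × ℂ × ℂ × (Fin (M + 1) → ℂ) → ℂ, ∃ (m : ℕ)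
      (c : ℕ → ℂ × ℂ × ℂ × (Fin M → ℂ) → ℂ), f ∈ Fs → (∀ j, AnalyticAt ℂ (c j) 0) ∧
      ∀ᶠ q in 𝓝 (0 : (ℂ × ℂ × ℂ × (Fin M → ℂ)) × ℂ), D q = 0 →
        (f ∘ θ) q ^ m + ∑ j ∈ Finset.range m, c j q.1 * (f ∘ θ) q ^ j = 0 := by
    intro f
    by_cases hf : f ∈ Fs
    · obtain ⟨m, c, h⟩ := exists_integral_relation hD hDne (hpull (hFs f hf))
      exact ⟨m, c, fun _ => h⟩
    · exact ⟨0, 0, fun h => absurd h hf⟩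
  choose m c hmc using hrel
  have hcoef := ih w' (⋃ f ∈ Fs, (fun j => c f j) '' (Finset.range (m f) : Set ℕ)) hw'
    (hfin.biUnion fun f _ => (Finset.finite_toSet _).image _) (by
      intro f' hf'
      simp only [mem_iUnion, mem_image] at hf'
      obtain ⟨f, hf, j, -, rfl⟩ := hf'
      exact (hmc f hf).1 j)
  have hev : ∀ᶠ p in 𝓝 (0 : (ℂ × ℂ × ℂ × (Fin M → ℂ)) × ℂ), ∀ f ∈ Fs, ∀ᶠ q in 𝓝 p, D q = 0 →
        (f ∘ θ) q ^ m f + ∑ j ∈ Finset.range (m f), c f j q.1 * (f ∘ θ) q ^ j = 0 :=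
    (Filter.eventually_all_finite hfin).2 fun f hf => (hmc f hf).2.eventually_nhds
  have hcan : ∀ᶠ p in 𝓝 (0 : (ℂ × ℂ × ℂ × (Fin M → ℂ)) × ℂ), ∀ f ∈ Fs,
      ∀ j ∈ Finset.range (m f), AnalyticAt ℂ (c f j) p.1 :=
    (Filter.eventually_all_finite hfin).2 fun f hf => (Filter.eventually_all_finset _).2 fun j _ =>
      (continuous_fst.tendsto' (0 : (ℂ × ℂ × ℂ × (Fin M → ℂ)) × ℂ) 0 rfl).eventually
        ((hmc f hf).1 j).eventually_analyticAt
  have hfan : ∀ᶠ p in 𝓝 (0 : (ℂ × ℂ × ℂ × (Fin M → ℂ)) × ℂ), ∀ f ∈ Fs,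
      AnalyticAt ℂ (f ∘ θ) p :=
    (Filter.eventually_all_finite hfin).2 fun f hf => (hpull (hFs f hf)).eventually_analyticAt
  filter_upwards [hcoef, hDz, hq.eventually hev, hq.eventually hcan, hq.eventually hfan,
    hq.eventually hD.eventually_analyticAt] with k ⟨γ, hγ0, hγd, hγ⟩ ⟨hDk, hDk'⟩ hevk hck hfk hDank
  obtain ⟨ψ, hψ0, hψd, hψ⟩ := hDank.exists_implicit_root hDk hDk'
  let z : ℂ → ℂ × ℂ × ℂ × (Fin M → ℂ) := fun σ => (φ k + σ, h k, t k, γ σ)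
  have hz0 : z 0 = (q k).1 := by simp [z, q, hγ0]
  have hzd : DifferentiableAt ℂ z 0 := by fun_prop
  have hψzd : DifferentiableAt ℂ (fun σ => ψ (z σ)) 0 :=
    DifferentiableAt.comp (0 : ℂ) (by rwa [hz0]) hzd
  have hcurve : ContinuousAt (fun σ => (z σ, ψ (z σ))) 0 :=
    (hzd.prodMk hψzd).continuousAt
  have hcurve0 : (z 0, ψ (z 0)) = q k := by rw [hz0, hψ0]
  refine ⟨fun σ => Λ (γ σ, ψ (z σ)), ?_, ?_, ?_⟩
  · simp only [hz0, hψ0, hγ0]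
    simp [q, w']
  · exact Λ.differentiable.differentiableAt.comp (0 : ℂ) (hγd.prodMk hψzd)
  intro f hf hf0
  have hcurvet : Tendsto (fun σ => (z σ, ψ (z σ))) (𝓝 0) (𝓝 (q k)) := by
    simpa only [ContinuousAt, hcurve0] using hcurve
  have hzt : Tendsto z (𝓝 0) (𝓝 (q k).1) := by
    simpa only [ContinuousAt, hz0] using hzd.continuousAt
  have := eventually_eq_zero_of_monic_relation (v := fun σ => (f ∘ θ) (z σ, ψ (z σ)))
    (C := fun j σ => c f j (z σ)) (m := m f)
    (by
      change Tendsto _ _ _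
      simp only [hcurve0]
      exact (hfk f hf).continuousAt.tendsto.comp hcurvet)
    (by
      simp only [hcurve0, Function.comp_apply, hθq]
      exact hf0)
    (fun j hj => by
      change Tendsto _ _ _
      simp only [hz0]
      exact (hck f hf j (Finset.mem_range.2 hj)).continuousAt.tendsto.comp hzt)
    (fun j hj h0 => by
      refine hγ (c f j) ?_ ?_
      · simp only [mem_iUnion, mem_image]
        exact ⟨f, hf, j, by simpa using hj, rfl⟩
      · simpa only [hz0] using h0)
    (by
      filter_upwards [hcurvet.eventually (hevk f hf), hzt.eventually hψ] with σ h1 h2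
      exact h1 h2)
  exact this

/-- Curve lifting is trivial if all vanishing members of the family vanish identically. -/
theorem CurveLifting.of_forall_eq_zero {𝒰 : Ultrafilter ℕ} {t h φ : ℕ → ℝ}
    (H : HierarchicalScales 𝒰 t h φ) {M : ℕ} {w : ℕ → Fin M → ℂ} (hw : Tendsto w 𝒰 (𝓝 0))
    {Fs : Set (ℂ × ℂ × ℂ × (Fin M → ℂ) → ℂ)} (hfin : Fs.Finite)
    (hall : ∀ f ∈ Fs, (∀ᶠ k in 𝒰, f (φ k, h k, t k, w k) = 0) → ∀ᶠ p in 𝓝 0, f p = 0) :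
    CurveLifting 𝒰 t h φ w Fs := by
  have hev : ∀ᶠ k in 𝒰, ∀ f ∈ Fs, f (φ k, h k, t k, w k) = 0 →
      ∀ᶠ p in 𝓝 ((φ k : ℂ), (h k : ℂ), (t k : ℂ), w k), f p = 0 := by
    refine (Filter.eventually_all_finite hfin).2 fun f hf => ?_
    by_cases h0 : ∀ᶠ k in 𝒰, f (φ k, h k, t k, w k) = 0
    · filter_upwards [(H.tendsto_point hw).eventually (hall f hf h0).eventually_nhds] with k hk _
        using hk
    · filter_upwards [Ultrafilter.eventually_not.2 h0] with k hk hk' using absurd hk' hk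
  filter_upwards [hev] with k hk
  refine ⟨fun _ => w k, rfl, differentiableAt_const _, fun f hf h0 => ?_⟩
  have : Tendsto (fun σ : ℂ => ((φ k : ℂ) + σ, (h k : ℂ), (t k : ℂ), w k)) (𝓝 0)
      (𝓝 ((φ k : ℂ), (h k : ℂ), (t k : ℂ), w k)) := by
    refine Continuous.tendsto' (by fun_prop) _ _ (by simp)
  exact this.eventually (hk f hf h0)

/-- Curve lifting holds for every finite family of analytic germs. -/
theorem curveLifting {𝒰 : Ultrafilter ℕ} {M : ℕ} : ∀ {t h φ : ℕ → ℝ},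
    HierarchicalScales 𝒰 t h φ → ∀ {w : ℕ → Fin M → ℂ}, Tendsto w 𝒰 (𝓝 0) →
    ∀ {Fs : Set (ℂ × ℂ × ℂ × (Fin M → ℂ) → ℂ)}, Fs.Finite → (∀ f ∈ Fs, AnalyticAt ℂ f 0) →
    CurveLifting 𝒰 t h φ w Fs := by
  induction M with
  | zero =>
    intro t h φ H w hw Fs hfin hFs
    refine CurveLifting.of_forall_eq_zero H hw hfin fun f hf h0 => ?_
    by_contra hne
    obtain ⟨a, b, F, hF, hFne, hFz⟩ := exists_rescaled_germ H hw (hFs f hf) hne h0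
    have h00 : F 0 ≠ 0 := fun h0 => hFne <| Eventually.of_forall fun w => by
      rw [Subsingleton.elim w 0]; exact h0
    obtain ⟨k, hk, hk'⟩ := (((hF.continuousAt.tendsto.comp
      ((H.rescale a b).tendsto_point hw)).eventually_ne h00).and hFz).exists
    exact hk hk'
  | succ M ih =>
    intro t h φ H w hw Fs hfin hFs
    by_cases hall : ∀ f ∈ Fs, (∀ᶠ k in 𝒰, f (φ k, h k, t k, w k) = 0) → ∀ᶠ p in 𝓝 0, f p = 0
    · exact CurveLifting.of_forall_eq_zero H hw hfin hall
    simp only [not_forall] at hall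
    obtain ⟨f, hf, h0, hne⟩ := hall
    obtain ⟨a, b, F, hF, hFne, hFz⟩ := exists_rescaled_germ H hw (hFs f hf) hne h0
    refine CurveLifting.of_rescale H a b (CurveLifting.of_regular (H.rescale a b)
      (fun w Fs hw hfin hFs => ih (H.rescale a b) hw hfin hFs) hw (hfin.image _) ?_ hF hFne hFz)
    rintro _ ⟨f, hf, rfl⟩
    have a₁ : Differentiable ℂ (fun p : ℂ × ℂ × ℂ × (Fin (M + 1) → ℂ) =>
        (p.2.2.1 ^ a * (p.2.2.1 ^ a * p.2.1) ^ b * p.1, p.2.2.1 ^ a * p.2.1, p.2.2)) := by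
      fun_prop
    exact (hFs f hf).comp_of_eq
      (a₁.differentiableOn.analyticOnNhd_of_finiteDimensional isOpen_univ 0 (mem_univ _)) (by simp)

/-- Curve lifting for germs on an arbitrary finite dimensional space. -/
theorem curveLifting_of_finiteDimensional {V : Type*} [NormedAddCommGroup V] [NormedSpace ℂ V]
    [FiniteDimensional ℂ V] {𝒰 : Ultrafilter ℕ} {t h φ : ℕ → ℝ} (H : HierarchicalScales 𝒰 t h φ)
    {w : ℕ → V} (hw : Tendsto w 𝒰 (𝓝 0)) {Fs : Set (ℂ × ℂ × ℂ × V → ℂ)} (hfin : Fs.Finite)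
    (hFs : ∀ f ∈ Fs, AnalyticAt ℂ f 0) :
    ∀ᶠ k in 𝒰, ∃ γ : ℂ → V, γ 0 = w k ∧ DifferentiableAt ℂ γ 0 ∧
      ∀ f ∈ Fs, f (φ k, h k, t k, w k) = 0 → ∀ᶠ σ in 𝓝 0, f (φ k + σ, h k, t k, γ σ) = 0 := by
  let e : V ≃L[ℂ] (Fin (Module.finrank ℂ V) → ℂ) := ContinuousLinearEquiv.ofFinrankEq (by simp)
  let θ : ℂ × ℂ × ℂ × (Fin (Module.finrank ℂ V) → ℂ) → ℂ × ℂ × ℂ × V :=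
    fun p => (p.1, p.2.1, p.2.2.1, e.symm p.2.2.2)
  have hθd : Differentiable ℂ θ := by fun_prop
  have hθ : AnalyticAt ℂ θ 0 :=
    hθd.differentiableOn.analyticOnNhd_of_finiteDimensional isOpen_univ 0 (mem_univ _)
  have hew : Tendsto (fun k => e (w k)) 𝒰 (𝓝 0) := (e.continuous.tendsto' 0 0 (map_zero e)).comp hw
  have := curveLifting H hew (Fs := (fun f => f ∘ θ) '' Fs) (hfin.image _) (by
    rintro _ ⟨f, hf, rfl⟩
    exact (hFs f hf).comp_of_eq hθ (by simp [θ]))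
  filter_upwards [this] with k ⟨γ, hγ0, hγd, hγ⟩
  refine ⟨fun σ => e.symm (γ σ), by simp [hγ0], e.symm.differentiableAt.comp (0 : ℂ) hγd,
    fun f hf h0 => ?_⟩
  simpa [θ] using hγ _ ⟨f, hf, rfl⟩ (by simpa [θ] using h0)

/-- The convex hull of a compact set in a finite dimensional space is compact. -/
theorem IsCompact.isCompact_convexHull_of_finiteDimensional {E : Type*} [NormedAddCommGroup E]
    [NormedSpace ℝ E] [FiniteDimensional ℝ E] {s : Set E} (hs : IsCompact s) :
    IsCompact (convexHull ℝ s) ∧ ∀ x ∈ convexHull ℝ s,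
      ∃ (c : Fin (Module.finrank ℝ E + 1) → ℝ) (z : Fin (Module.finrank ℝ E + 1) → E),
        (∀ i, 0 ≤ c i) ∧ ∑ i, c i = 1 ∧ (∀ i, z i ∈ s) ∧ ∑ i, c i • z i = x := by
  classical
  set d := Module.finrank ℝ E + 1
  have hrep : ∀ x ∈ convexHull ℝ s, ∃ (c : Fin d → ℝ) (z : Fin d → E),
      (∀ i, 0 ≤ c i) ∧ ∑ i, c i = 1 ∧ (∀ i, z i ∈ s) ∧ ∑ i, c i • z i = x := by
    intro x hx
    obtain ⟨ι, _, z, c, hz, hind, hc, hsum, hx'⟩ := eq_pos_convex_span_of_mem_convexHull hx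
    have hcard : Fintype.card ι ≤ Fintype.card (Fin d) := by
      rw [Fintype.card_fin]
      refine hind.card_le_finrank_succ.trans ?_
      exact Nat.succ_le_succ (Submodule.finrank_le _)
    obtain ⟨emb⟩ := Function.Embedding.nonempty_of_card_le hcard
    obtain ⟨z₀, hz₀⟩ : s.Nonempty := convexHull_nonempty_iff.1 ⟨x, hx⟩
    refine ⟨Function.extend emb c 0, Function.extend emb z fun _ => z₀, ?_, ?_, ?_, ?_⟩
    · intro i
      by_cases hi : ∃ j, emb j = i
      · obtain ⟨j, rfl⟩ := hi
        rw [emb.injective.extend_apply]; exact (hc j).le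
      · rw [Function.extend_apply' _ _ _ hi]; rfl
    · rw [← hsum]
      symm
      refine Fintype.sum_of_injective emb emb.injective _ _ (fun i hi => ?_) fun j => ?_
      · rw [Function.extend_apply' _ _ _ hi]; rfl
      · rw [emb.injective.extend_apply]
    · intro i
      by_cases hi : ∃ j, emb j = i
      · obtain ⟨j, rfl⟩ := hi
        rw [emb.injective.extend_apply]; exact hz ⟨j, rfl⟩
      · rw [Function.extend_apply' _ _ _ hi]; exact hz₀
    · rw [← hx']
      symm
      refine Fintype.sum_of_injective emb emb.injective _ _ (fun i hi => ?_) fun j => ?_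
      · rw [Function.extend_apply' _ _ _ hi]; simp
      · rw [emb.injective.extend_apply, emb.injective.extend_apply]
  refine ⟨?_, hrep⟩
  have himg : convexHull ℝ s = (fun p : (Fin d → ℝ) × (Fin d → E) => ∑ i, p.1 i • p.2 i) ''
      (stdSimplex ℝ (Fin d) ×ˢ univ.pi fun _ => s) := by
    ext x
    constructor
    · intro hx
      obtain ⟨c, z, h1, h2, h3, h4⟩ := hrep x hx
      exact ⟨(c, z), ⟨⟨h1, h2⟩, fun i _ => h3 i⟩, h4⟩
    · rintro ⟨⟨c, z⟩, ⟨⟨h1, h2⟩, h3⟩, rfl⟩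
      exact (convex_convexHull ℝ s).sum_mem (fun i _ => h1 i) h2
        fun i _ => subset_convexHull ℝ s (h3 i (mem_univ i))
  rw [himg]
  exact ((isCompact_stdSimplex ℝ (Fin d)).prod (isCompact_univ_pi fun _ => hs)).image
    (by fun_prop)

/-- A compact family of linear forms without a common positivity direction contains a bounded number
of members without a common positivity direction. -/
theorem exists_fin_family_not_forall_pos {E X : Type*} [NormedAddCommGroup E] [NormedSpace ℝ E]
    [FiniteDimensional ℝ E] [TopologicalSpace X] {A : Set X} (hA : IsCompact A)
    {l : X → E →L[ℝ] ℝ} (hl : ContinuousOn l A) (hno : ¬ ∃ v, ∀ a ∈ A, 0 < l a v) :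
    ∃ a : Fin (Module.finrank ℝ E + 1) → X, (∀ i, a i ∈ A) ∧ ¬ ∃ v, ∀ i, 0 < l (a i) v := by
  set d := Module.finrank ℝ E
  let b := Module.finBasis ℝ E
  let κ : X → (Fin d → ℝ) := fun a i => l a (b i)
  have hκ : ContinuousOn κ A := continuousOn_pi.2 fun i =>
    hl.clm_apply continuousOn_const
  have hcomp := (hA.image_of_continuousOn hκ).isCompact_convexHull_of_finiteDimensional
  rw [Module.finrank_fin_fun] at hcomp
  by_cases h0 : (0 : Fin d → ℝ) ∈ convexHull ℝ (κ '' A)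
  · obtain ⟨c, z, hc, hsum, hz, h⟩ := hcomp.2 0 h0
    choose a ha haz using hz
    refine ⟨a, ha, ?_⟩
    rintro ⟨v, hv⟩
    have hlin : ∀ a, l a v = ∑ i, b.repr v i * κ a i := fun a => by
      conv_lhs => rw [← b.sum_repr v, map_sum]
      simp only [κ, map_smul, smul_eq_mul]
    have hzero : ∑ i, c i * l (a i) v = 0 := by
      simp only [hlin, haz, Finset.mul_sum]
      rw [Finset.sum_comm]
      refine Finset.sum_eq_zero fun j _ => ?_
      have := congrFun h j
      simp only [Finset.sum_apply, Pi.smul_apply, smul_eq_mul, Pi.zero_apply] at this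
      calc _ = b.repr v j * ∑ i, c i * z i j := by
            rw [Finset.mul_sum]; exact Finset.sum_congr rfl fun i _ => by ring
        _ = 0 := by rw [this, mul_zero]
    have hall := (Finset.sum_eq_zero_iff_of_nonneg
      fun i _ => mul_nonneg (hc i) (hv i).le).1 hzero
    have : ∑ i, c i = 0 := Finset.sum_eq_zero fun i hi =>
      (mul_eq_zero.1 (hall i hi)).resolve_right (hv i).ne'
    rw [hsum] at this
    exact one_ne_zero this
  · exfalso
    obtain ⟨f, u, hf0, hf⟩ := geometric_hahn_banach_point_closed (convex_convexHull ℝ (κ '' A))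
      hcomp.1.isClosed h0
    refine hno ⟨∑ i, f (fun j => if i = j then 1 else 0) • b i, fun a ha => ?_⟩
    have h1 : f (κ a) = l a (∑ i, f (fun j => if i = j then 1 else 0) • b i) := by
      have := f.toLinearMap.pi_apply_eq_sum_univ (κ a)
      simp only [ContinuousLinearMap.coe_coe, smul_eq_mul] at this
      rw [this, map_sum]
      refine Finset.sum_congr rfl fun i _ => ?_
      rw [map_smul, smul_eq_mul, mul_comm]
    rw [← h1]
    rw [map_zero] at hf0
    exact hf0.trans (hf _ (subset_convexHull ℝ _ ⟨a, ha, rfl⟩))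

/-- At a local maximum of a minimum function, no direction increases all active functions. -/
theorem not_exists_forall_active_pos {E X : Type*} [NormedAddCommGroup E] [NormedSpace ℝ E]
    [NormedAddCommGroup X] [NormedSpace ℝ X] {P : Set X} (hP : IsCompact P) {G : E × X → ℝ}
    {x : E} {φ : ℝ} (hG : ∀ w ∈ P, ContDiffAt ℝ 1 G (x, w)) (hmin : ∀ w ∈ P, φ ≤ G (x, w))
    (hmax : ∀ᶠ y in 𝓝 x, ∃ w ∈ P, G (y, w) ≤ φ) :
    ¬ ∃ v, ∀ w ∈ {w ∈ P | G (x, w) = φ}, 0 < (fderiv ℝ G (x, w) ∘L .inl ℝ E X) v := by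
  rintro ⟨v, hv⟩
  obtain ⟨𝒱, h𝒱⟩ := Ultrafilter.exists_le (𝓝[>] (0 : ℝ))
  have hx : Tendsto (fun s : ℝ => x + s • v) (𝓝 0) (𝓝 x) := by
    refine Continuous.tendsto' (by fun_prop) _ _ (by simp)
  have hs0 : Tendsto (fun s : ℝ => s) 𝒱 (𝓝 0) := h𝒱.trans nhdsWithin_le_nhds
  have hpos : ∀ᶠ s in 𝒱, (0 : ℝ) < s := h𝒱 self_mem_nhdsWithin
  have hev := (hx.comp hs0).eventually hmax
  have : ∀ s : ℝ, ∃ w, (∃ w ∈ P, G (x + s • v, w) ≤ φ) → w ∈ P ∧ G (x + s • v, w) ≤ φ := by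
    intro s
    by_cases h : ∃ w ∈ P, G (x + s • v, w) ≤ φ
    · obtain ⟨w, hw⟩ := h
      exact ⟨w, fun _ => hw⟩
    · exact ⟨0, fun h' => absurd h' h⟩
  choose w hw using this
  obtain ⟨w₀, hw₀P, hw₀⟩ := hP.ultrafilter_le_nhds (𝒱.map w) (by
    rw [le_principal_iff]
    exact hev.mono fun s hs => (hw s hs).1)
  have hwt : Tendsto w 𝒱 (𝓝 w₀) := hw₀
  have hpt : Tendsto (fun s => (x + s • v, w s)) 𝒱 (𝓝 (x, w₀)) := (hx.comp hs0).prodMk_nhds hwt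
  have hpt' : Tendsto (fun s => (x, w s)) 𝒱 (𝓝 (x, w₀)) := tendsto_const_nhds.prodMk_nhds hwt
  have hact : G (x, w₀) = φ := le_antisymm (le_of_tendsto ((hG w₀ hw₀P).continuousAt.tendsto.comp hpt)
    (hev.mono fun s hs => (hw s hs).2)) (hmin w₀ hw₀P)
  have hvpos := hv w₀ ⟨hw₀P, hact⟩
  set κ := (fderiv ℝ G (x, w₀) ∘L .inl ℝ E X) v with hκ
  have hstrict := (hG w₀ hw₀P).hasStrictFDerivAt one_ne_zero
  have hlo := hstrict.isLittleO.comp_tendsto (hpt.prodMk_nhds hpt')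
  have hbd := hlo.def (c := κ / (2 * (‖v‖ + 1))) (by positivity)
  obtain ⟨s, hs, hsw, hspos⟩ := (hbd.and (hev.and hpos)).exists
  obtain ⟨hwP, hwle⟩ := hw s hsw
  have hge := hmin _ hwP
  have e1 : (x + s • v, w s) - (x, w s) = s • ContinuousLinearMap.inl ℝ E X v := by simp
  simp only [Function.comp_apply, e1, map_smul] at hs
  rw [← ContinuousLinearMap.comp_apply, ← hκ, norm_smul, Real.norm_of_nonneg hspos.le] at hs
  have h2 : ‖ContinuousLinearMap.inl ℝ E X v‖ = ‖v‖ := by simp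
  rw [h2, Real.norm_eq_abs] at hs
  have h3 := (abs_le.1 hs).1
  rw [smul_eq_mul] at h3
  have h4 : κ / (2 * (‖v‖ + 1)) * (s * ‖v‖) < s * κ := by
    have : κ / (2 * (‖v‖ + 1)) * (s * ‖v‖) = s * κ * (‖v‖ / (2 * (‖v‖ + 1))) := by ring
    rw [this]
    refine mul_lt_of_lt_one_right (by positivity) ?_
    rw [div_lt_one (by positivity)]
    linarith [norm_nonneg v]
  linarith

/-- Directional derivatives of a conjugation symmetric function at a real point along the real part
of a complex direction. -/
theorem hasDerivAt_symmetrized_line {V : Type*} [NormedAddCommGroup V] [NormedSpace ℂ V]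
    {N : V → ℂ} {c : V → V} {p v : V} (hN : DifferentiableAt ℂ N p)
    (hadd : ∀ v w, c (v + w) = c v + c w) (hsmul : ∀ (s : ℝ) v, c ((s : ℂ) • v) = (s : ℂ) • c v)
    (hp : c p = p) (hNc : ∀ v, N (c v) = star (N v)) :
    HasDerivAt (fun s : ℝ => N (p + (s : ℂ) • ((1 / 2 : ℂ) • (v + c v))))
      ((fderiv ℂ N p v).re : ℂ) 0 := by
  have hline : ∀ u : V, HasDerivAt (fun s : ℝ => N (p + (s : ℂ) • u)) (fderiv ℂ N p u) 0 := by
    intro u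
    have h1 : HasDerivAt (fun s : ℝ => p + (s : ℂ) • u) u 0 := by
      have := ((hasDerivAt_id (0 : ℝ)).ofReal_comp.smul_const u).const_add p
      simpa using this
    have h2 : HasFDerivAt N ((fderiv ℂ N p).restrictScalars ℝ) p := hN.hasFDerivAt.restrictScalars ℝ
    exact h2.comp_hasDerivAt_of_eq 0 h1 (by simp)
  have hconj : fderiv ℂ N p (c v) = star (fderiv ℂ N p v) := by
    have h1 := (hline v).star
    refine (hline (c v)).unique (h1.congr_of_eventuallyEq (Eventually.of_forall fun s => ?_))
    simp only [← hNc, hadd, hsmul, hp]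
  convert hline ((1 / 2 : ℂ) • (v + c v)) using 1
  rw [map_smul, map_add, hconj, smul_eq_mul]
  simp [Complex.add_conj]

/-- Complexified configurations: a centre, finitely many points, and slack variables. The centre
and the points come with independent conjugate coordinates. -/
abbrev Configuration (n d : ℕ) : Type :=
  (Fin n → ℂ) × (Fin n → ℂ) × (Fin d → Fin n → ℂ) × (Fin d → Fin n → ℂ) × (Fin d → Fin n → ℂ)

namespace Configuration

variable {n d : ℕ}

/-- The conjugation whose fixed points are the actual configurations. -/
def conj (v : Configuration n d) : Configuration n d :=
  (star v.2.1, star v.1, star v.2.2.2.1, star v.2.2.1, star v.2.2.2.2)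

/-- The complexification of `‖g y‖ ^ 2 * ∏ j, (t ^ 2 - ‖x j‖ ^ 2)`. -/
def value (g : (Fin n → ℂ) → ℂ) (t : ℂ) (i : Fin d) (v : Configuration n d) : ℂ :=
  g (v.2.2.1 i) * star (g (star (v.2.2.2.1 i))) * ∏ j, (t ^ 2 - v.1 j * v.2.1 j)

/-- The complexification of `‖y j - x j‖ ^ 2 + s j ^ 2`. -/
def radius (i : Fin d) (j : Fin n) (v : Configuration n d) : ℂ :=
  (v.2.2.1 i j - v.1 j) * (v.2.2.2.1 i j - v.2.1 j) + v.2.2.2.2 i j ^ 2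

theorem conj_add (v w : Configuration n d) : conj (v + w) = conj v + conj w := by
  simp [conj]

theorem conj_smul (s : ℝ) (v : Configuration n d) : conj ((s : ℂ) • v) = (s : ℂ) • conj v := by
  simp [conj, star_smul]

theorem conj_conj (v : Configuration n d) : conj (conj v) = v := by
  simp [conj]

theorem value_conj (g : (Fin n → ℂ) → ℂ) (t : ℝ) (i : Fin d) (v : Configuration n d) :
    value g t i (conj v) = star (value g t i v) := by
  have : star (t : ℂ) = t := Complex.conj_ofReal t
  simp only [value, conj, star_mul', star_star, star_prod, star_sub, star_pow, this, Pi.star_apply]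
  rw [mul_comm (g (star _))]
  congr 1
  exact Finset.prod_congr rfl fun j _ => by rw [mul_comm]

theorem radius_conj (i : Fin d) (j : Fin n) (v : Configuration n d) :
    radius i j (conj v) = star (radius i j v) := by
  simp only [radius, conj, star_mul', star_add, star_sub, star_pow, Pi.star_apply]
  ring

theorem value_of_conj_eq {g : (Fin n → ℂ) → ℂ} {t : ℝ} {i : Fin d} {v : Configuration n d}
    (hv : conj v = v) :
    value g t i v = ((‖g (v.2.2.1 i)‖ ^ 2 * ∏ j, (t ^ 2 - ‖v.1 j‖ ^ 2) : ℝ) : ℂ) := by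
  have h1 : v.2.1 = star v.1 := (congrArg (fun v => v.2.1) hv).symm
  have h2 : v.2.2.2.1 = star v.2.2.1 := (congrArg (fun v => v.2.2.2.1) hv).symm
  have hm : ∀ z : ℂ, z * star z = ((‖z‖ ^ 2 : ℝ) : ℂ) := fun z => by
    rw [Complex.star_def, Complex.mul_conj, Complex.normSq_eq_norm_sq]
  simp only [value, h1, h2, Pi.star_apply, star_star, hm]
  push_cast
  rfl

theorem radius_of_conj_eq {i : Fin d} {j : Fin n} {v : Configuration n d} (hv : conj v = v) :
    radius i j v = ((‖v.2.2.1 i j - v.1 j‖ ^ 2 + (v.2.2.2.2 i j).re ^ 2 : ℝ) : ℂ) := by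
  have h1 : v.2.1 = star v.1 := (congrArg (fun v => v.2.1) hv).symm
  have h2 : v.2.2.2.1 = star v.2.2.1 := (congrArg (fun v => v.2.2.2.1) hv).symm
  have h3 : star v.2.2.2.2 = v.2.2.2.2 := congrArg (fun v => v.2.2.2.2) hv
  have hm : ∀ z : ℂ, z * star z = ((‖z‖ ^ 2 : ℝ) : ℂ) := fun z => by
    rw [Complex.star_def, Complex.mul_conj, Complex.normSq_eq_norm_sq]
  have h4 : ((v.2.2.2.2 i j).re : ℂ) = v.2.2.2.2 i j :=
    Complex.conj_eq_iff_re.1 (congrFun (congrFun h3 i) j)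
  simp only [radius, h1, h2, Pi.star_apply, ← star_sub, hm]
  push_cast
  rw [h4]

end Configuration

theorem DifferentiableAt.star_comp_star {n : ℕ} {g : (Fin n → ℂ) → ℂ} {v : Fin n → ℂ}
    (hg : DifferentiableAt ℂ g (star v)) :
    DifferentiableAt ℂ (fun v => star (g (star v))) v := by
  have := hg.star_star
  rw [_root_.star_star] at this
  exact this

theorem Configuration.differentiableAt_value {n d : ℕ} {g : (Fin n → ℂ) → ℂ} {i : Fin d}
    {p : ℂ × Configuration n d} (h1 : DifferentiableAt ℂ g (p.2.2.2.1 i))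
    (h2 : DifferentiableAt ℂ g (star (p.2.2.2.2.1 i))) :
    DifferentiableAt ℂ (fun p : ℂ × Configuration n d => value g p.1 i p.2) p := by
  unfold value
  refine (DifferentiableAt.mul ?_ ?_).mul ?_
  · exact h1.comp (f := fun p : ℂ × Configuration n d => p.2.2.2.1 i) p (by fun_prop)
  · exact h2.star_comp_star.comp (f := fun p : ℂ × Configuration n d => p.2.2.2.2.1 i) p
      (by fun_prop)
  · fun_prop

theorem Configuration.differentiable_radius {n d : ℕ} (i : Fin d) (j : Fin n) :
    Differentiable ℂ (radius (n := n) (d := d) i j) := by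
  unfold radius
  fun_prop

/-- First order analysis of a curve of configurations along which the value increases. -/
theorem exists_increasing_direction {n d : ℕ} {g : (Fin n → ℂ) → ℂ} {t h φ : ℝ} (hh : 0 < h)
    {x : Fin n → ℂ} {w : Fin d → Fin n → ℂ} (hw : ∀ i, w i ∈ closedBall (0 : Fin n → ℂ) 1)
    (hg : ∀ i, AnalyticAt ℂ g (x + (h : ℂ) • w i)) {γ : ℂ → Configuration n d}
    (hγ0 : γ 0 = (x, star x, fun i => x + (h : ℂ) • w i, star fun i => x + (h : ℂ) • w i,
      fun i j => ((h * √(1 - ‖w i j‖ ^ 2) : ℝ) : ℂ)))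
    (hγ : DifferentiableAt ℂ γ 0)
    (hval : ∀ i, ∀ᶠ σ in 𝓝 0, Configuration.value g t i (γ σ) = φ + σ)
    (hrad : ∀ i j, ∀ᶠ σ in 𝓝 0, Configuration.radius i j (γ σ) = h ^ 2)
    {G : (Fin n → ℂ) × (Fin n → ℂ) → ℝ}
    (hG : G = fun p => ‖g (p.1 + (h : ℂ) • p.2)‖ ^ 2 * ∏ j, (t ^ 2 - ‖p.1 j‖ ^ 2))
    (hGd : ∀ i, DifferentiableAt ℝ G (x, w i)) (hGw : ∀ i, G (x, w i) = φ)
    (hmin : ∀ w ∈ closedBall (0 : Fin n → ℂ) 1, φ ≤ G (x, w)) :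
    ∃ a, ∀ i, 0 < (fderiv ℝ G (x, w i) ∘L .inl ℝ _ _) a := by
  set p := γ 0 with hp
  have hpc : p.conj = p := by
    rw [hγ0]
    simp only [Configuration.conj, star_star]
    congr
    ext i j
    simp only [Pi.star_apply]
    exact Complex.conj_ofReal _
  set v := deriv γ 0
  have hγd : HasDerivAt γ v 0 := hγ.hasDerivAt
  have hpy : ∀ i, p.2.2.1 i = x + (h : ℂ) • w i := fun i => by rw [hγ0]
  have hpy' : ∀ i, star (p.2.2.2.1 i) = x + (h : ℂ) • w i := fun i => by
    rw [hγ0]; exact star_star (x + (h : ℂ) • w i)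
  have hvd : ∀ i, DifferentiableAt ℂ (Configuration.value g t i) p := fun i =>
    (Configuration.differentiableAt_value (p := ((t : ℂ), p)) (by
      rw [hpy i]; exact (hg i).differentiableAt) (by
      rw [hpy' i]; exact (hg i).differentiableAt)).comp p
      (f := fun p : Configuration n d => ((t : ℂ), p)) (by fun_prop)
  have hrd : ∀ i j, DifferentiableAt ℂ (Configuration.radius i j) p := fun i j =>
    (Configuration.differentiable_radius i j) p
  have hvalv : ∀ i, fderiv ℂ (Configuration.value g t i) p v = 1 := fun i => by
    have h1 := (hvd i).hasFDerivAt.comp_hasDerivAt_of_eq 0 hγd rfl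
    refine h1.unique (((hasDerivAt_id (0 : ℂ)).const_add (φ : ℂ)).congr_of_eventuallyEq (hval i))
  have hradv : ∀ i j, fderiv ℂ (Configuration.radius i j) p v = 0 := fun i j => by
    have h1 := (hrd i j).hasFDerivAt.comp_hasDerivAt_of_eq 0 hγd rfl
    refine h1.unique ((hasDerivAt_const (0 : ℂ) ((h : ℂ) ^ 2)).congr_of_eventuallyEq (hrad i j))
  set u : Configuration n d := (1 / 2 : ℂ) • (v + v.conj) with hu
  have huc : u.conj = u := by
    have : (1 / 2 : ℂ) = ((1 / 2 : ℝ) : ℂ) := by norm_num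
    rw [hu, this, Configuration.conj_smul, Configuration.conj_add, Configuration.conj_conj,
      add_comm]
  have hline : ∀ s : ℝ, (p + (s : ℂ) • u).conj = p + (s : ℂ) • u := fun s => by
    rw [Configuration.conj_add, Configuration.conj_smul, hpc, huc]
  set a := u.1
  refine ⟨a, fun i => ?_⟩
  set b := u.2.2.1 i
  set β : Fin n → ℂ := (h : ℂ)⁻¹ • (b - a) with hβ
  have hh0 : (h : ℂ) ≠ 0 := Complex.ofReal_ne_zero.2 hh.ne'
  have hab : b = a + (h : ℂ) • β := by rw [hβ, smul_inv_smul₀ hh0]; abel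
  have hp1 : p.1 = x := by rw [hγ0]
  -- the value along the real line
  have hd1 : HasDerivAt (fun s : ℝ => G (x + s • a, w i + s • β)) 1 0 := by
    have h1 := hasDerivAt_symmetrized_line (hvd i) (c := Configuration.conj) (v := v)
      Configuration.conj_add Configuration.conj_smul hpc (Configuration.value_conj g t i)
    rw [← hu, hvalv i] at h1
    have h2 := Complex.reCLM.hasFDerivAt.comp_hasDerivAt (0 : ℝ) h1
    simp only [Complex.one_re, Complex.ofReal_one, Complex.reCLM_apply] at h2
    refine h2.congr_of_eventuallyEq (Eventually.of_forall fun s => ?_)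
    simp only [Function.comp_apply, Complex.reCLM_apply,
      Configuration.value_of_conj_eq (hline s), Complex.ofReal_re, hG]
    have e1 : (p + (s : ℂ) • u).2.2.1 i = x + s • a + (h : ℂ) • (w i + s • β) := by
      change p.2.2.1 i + (s : ℂ) • b = _
      rw [hpy i, hab]
      ext j
      simp
      ring
    have e2 : (p + (s : ℂ) • u).1 = x + s • a := by
      change p.1 + (s : ℂ) • a = _
      rw [hp1]
      ext j; simp
    rw [e1, e2]
  have hd2 : HasDerivAt (fun s : ℝ => G (x + s • a, w i + s • β)) (fderiv ℝ G (x, w i) (a, β)) 0 := by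
    have h1 : HasDerivAt (fun s : ℝ => (x + s • a, w i + s • β)) (a, β) 0 := by
      have h1 := ((hasDerivAt_id (0 : ℝ)).smul_const a).const_add x
      have h2 := ((hasDerivAt_id (0 : ℝ)).smul_const β).const_add (w i)
      simpa using h1.prodMk h2
    exact (hGd i).hasFDerivAt.comp_hasDerivAt_of_eq 0 h1 (by simp)
  have hsum : fderiv ℝ G (x, w i) (a, 0) + fderiv ℝ G (x, w i) (0, β) = 1 := by
    have e : ((a, 0) : (Fin n → ℂ) × (Fin n → ℂ)) + (0, β) = (a, β) := by simp
    rw [← map_add, e]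
    exact hd2.unique hd1
  -- the radius along the real line
  have hwj : ∀ j, ‖w i j‖ ≤ 1 := fun j =>
    (norm_le_pi_norm (w i) j).trans (mem_closedBall_zero_iff.1 (hw i))
  have hradj : ∀ j, ∃ A : ℝ, 0 ≤ A ∧ ∀ s : ℝ, ‖w i j + s • β j‖ ^ 2 ≤ 1 + s ^ 2 * A := by
    intro j
    have h1 := hasDerivAt_symmetrized_line (hrd i j) (c := Configuration.conj) (v := v)
      Configuration.conj_add Configuration.conj_smul hpc (Configuration.radius_conj i j)
    rw [← hu, hradv i j] at h1
    have h2 := Complex.reCLM.hasFDerivAt.comp_hasDerivAt (0 : ℝ) h1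
    simp only [Complex.zero_re, Complex.ofReal_zero, map_zero] at h2
    set κ := (u.2.2.2.2 i j).re
    set τ := √(1 - ‖w i j‖ ^ 2)
    have hτ : τ ^ 2 = 1 - ‖w i j‖ ^ 2 := Real.sq_sqrt (by
      have := hwj j; have := norm_nonneg (w i j); nlinarith)
    have hexp : ∀ s : ℝ, ‖w i j + s • β j‖ ^ 2 =
        ‖w i j‖ ^ 2 + s * (2 * inner ℝ (w i j) (β j)) + s ^ 2 * ‖β j‖ ^ 2 := fun s => by
      rw [norm_add_sq_real, norm_smul, inner_smul_right, mul_pow, Real.norm_eq_abs, sq_abs]; ring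
    set l := h ^ 2 * (2 * inner ℝ (w i j) (β j)) + 2 * h * τ * κ
    have hpoly : HasDerivAt (fun s : ℝ => h ^ 2 + s * l + s ^ 2 * (h ^ 2 * ‖β j‖ ^ 2 + κ ^ 2)) l 0 := by
      have h3 := (((hasDerivAt_id (0 : ℝ)).mul_const l).const_add (h ^ 2)).fun_add
        (((hasDerivAt_id (0 : ℝ)).fun_pow 2).mul_const (h ^ 2 * ‖β j‖ ^ 2 + κ ^ 2))
      simpa using h3
    have hl : l = 0 := by
      refine hpoly.unique (h2.congr_of_eventuallyEq (Eventually.of_forall fun s => ?_))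
      simp only [Function.comp_apply, Complex.reCLM_apply,
        Configuration.radius_of_conj_eq (hline s), Complex.ofReal_re]
      have e1 : (p + (s : ℂ) • u).2.2.1 i j - (p + (s : ℂ) • u).1 j =
          (h : ℂ) * (w i j + s • β j) := by
        change p.2.2.1 i j + (s : ℂ) • b j - (p.1 j + (s : ℂ) • a j) = _
        rw [hpy i, hab, hp1]
        simp
        ring
      have e2 : ((p + (s : ℂ) • u).2.2.2.2 i j).re = h * τ + s * κ := by
        change (p.2.2.2.2 i j + (s : ℂ) • u.2.2.2.2 i j).re = _
        rw [hγ0]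
        simp only [Complex.add_re, Complex.ofReal_re, smul_eq_mul, Complex.re_ofReal_mul]
        rfl
      rw [e1, e2, norm_mul, mul_pow, hexp, Complex.norm_real, Real.norm_eq_abs, sq_abs]
      simp only [l]
      linear_combination (-h ^ 2) * hτ
    refine ⟨‖β j‖ ^ 2 + κ ^ 2 / h ^ 2, by positivity, fun s => ?_⟩
    have h3 : 0 ≤ (τ + s * κ / h) ^ 2 := sq_nonneg _
    have h4 : (τ + s * κ / h) ^ 2 =
        τ ^ 2 + s * (2 * h * τ * κ) / h ^ 2 + s ^ 2 * (κ ^ 2 / h ^ 2) := by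
      field_simp
      ring
    have h5 : s * (2 * h * τ * κ) / h ^ 2 = - (s * (2 * inner ℝ (w i j) (β j))) := by
      rw [div_eq_iff (by positivity)]
      simp only [l] at hl
      linear_combination s * hl
    rw [hexp]
    rw [h4, h5, hτ] at h3
    linarith
  choose A hA0 hA using hradj
  set B := ∑ j, A j
  have hB0 : 0 ≤ B := Finset.sum_nonneg fun j _ => hA0 j
  have hball : ∀ s : ℝ, (1 + B * s ^ 2)⁻¹ • (w i + s • β) ∈ closedBall (0 : Fin n → ℂ) 1 := by
    intro s
    have hpos : 0 < 1 + B * s ^ 2 := by positivity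
    rw [mem_closedBall_zero_iff, norm_smul, norm_inv, Real.norm_of_nonneg hpos.le,
      inv_mul_le_iff₀ hpos, mul_one, pi_norm_le_iff_of_nonneg hpos.le]
    intro j
    refine abs_le_of_sq_le_sq' ?_ hpos.le |>.2
    have hAB : A j ≤ B := Finset.single_le_sum (fun j _ => hA0 j) (Finset.mem_univ j)
    calc ‖(w i + s • β) j‖ ^ 2 ≤ 1 + s ^ 2 * A j := hA j s
      _ ≤ (1 + B * s ^ 2) ^ 2 := by
        nlinarith [sq_nonneg s, sq_nonneg (B * s ^ 2),
          mul_le_mul_of_nonneg_left hAB (sq_nonneg s), mul_nonneg hB0 (sq_nonneg s)]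
  have hd3 : HasDerivAt (fun s : ℝ => (x, (1 + B * s ^ 2)⁻¹ • (w i + s • β))) (0, β) 0 := by
    have h1 : HasDerivAt (fun s : ℝ => (1 + B * s ^ 2)⁻¹) 0 0 := by
      have := ((((hasDerivAt_id (0 : ℝ)).fun_pow 2).const_mul B).const_add 1).fun_inv (by simp)
      simpa using this
    have h2 : HasDerivAt (fun s : ℝ => w i + s • β) β 0 := by
      simpa using ((hasDerivAt_id (0 : ℝ)).smul_const β).const_add (w i)
    have h3 := h1.fun_smul h2
    have h4 := (hasDerivAt_const (0 : ℝ) x).prodMk h3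
    simpa using h4
  have hd4 : HasDerivAt (fun s : ℝ => G (x, (1 + B * s ^ 2)⁻¹ • (w i + s • β)))
      (fderiv ℝ G (x, w i) (0, β)) 0 :=
    (hGd i).hasFDerivAt.comp_hasDerivAt_of_eq 0 hd3 (by simp)
  have hlocmin : IsLocalMin (fun s : ℝ => G (x, (1 + B * s ^ 2)⁻¹ • (w i + s • β))) 0 := by
    refine Eventually.of_forall fun s => ?_
    have : G (x, (1 + B * (0 : ℝ) ^ 2)⁻¹ • (w i + (0 : ℝ) • β)) = φ := by simp [hGw i]
    exact this.trans_le (hmin _ (hball s))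
  have hzero := hlocmin.hasDerivAt_eq_zero hd4
  rw [hzero, add_zero] at hsum
  change 0 < fderiv ℝ G (x, w i) (a, 0)
  rw [hsum]
  exact one_pos

theorem IsCompact.exists_max_min {X Y : Type*} [TopologicalSpace X] [TopologicalSpace Y]
    {K : Set X} {P : Set Y} (hK : IsCompact K) (hP : IsCompact P) (hKne : K.Nonempty)
    (hPne : P.Nonempty) {G : X × Y → ℝ} (hG : ContinuousOn G (K ×ˢ P)) :
    ∃ x ∈ K, ∃ φ, (∀ w ∈ P, φ ≤ G (x, w)) ∧ ∀ y ∈ K, ∃ w ∈ P, G (y, w) ≤ φ := by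
  have hmin : ∀ x ∈ K, ∃ w ∈ P, ∀ w' ∈ P, G (x, w) ≤ G (x, w') := fun x hx => by
    obtain ⟨w, hw, hmin⟩ := hP.exists_isMinOn hPne (f := fun w => G (x, w))
      (hG.comp (by fun_prop) fun w hw => ⟨hx, hw⟩)
    exact ⟨w, hw, fun w' hw' => hmin hw'⟩
  have : CompactSpace K := isCompact_iff_compactSpace.1 hK
  have : CompactSpace P := isCompact_iff_compactSpace.1 hP
  have : Nonempty K := hKne.to_subtype
  have : Nonempty P := hPne.to_subtype
  have hcont : Continuous fun x : K => sInf ((fun w : P => G (x, w)) '' univ) := by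
    refine IsCompact.continuous_sInf (f := fun (x : K) (w : P) => G (x, w)) isCompact_univ ?_
    exact hG.comp_continuous (f := fun p : K × P => ((p.1 : X), (p.2 : Y))) (by fun_prop)
      fun p => ⟨p.1.2, p.2.2⟩
  obtain ⟨x, -, hx⟩ := isCompact_univ.exists_isMaxOn univ_nonempty hcont.continuousOn
  have hval : ∀ y : K, ∃ w : P, G (y, w) = sInf ((fun w : P => G (y, w)) '' univ) ∧
      ∀ w' : P, sInf ((fun w : P => G (y, w)) '' univ) ≤ G (y, w') := fun y => by
    obtain ⟨w, hw, hwmin⟩ := hmin y y.2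
    have hleast : IsLeast ((fun w : P => G (y, w)) '' univ) (G (y, w)) :=
      ⟨⟨⟨w, hw⟩, mem_univ _, rfl⟩, by rintro _ ⟨w', -, rfl⟩; exact hwmin w' w'.2⟩
    rw [hleast.csInf_eq]
    exact ⟨⟨w, hw⟩, rfl, fun w' => hwmin w' w'.2⟩
  refine ⟨x, x.2, sInf ((fun w : P => G (x, w)) '' univ), fun w hw => ?_, fun y hy => ?_⟩
  · obtain ⟨_, -, h⟩ := hval x
    exact h ⟨w, hw⟩
  · obtain ⟨w, h, -⟩ := hval ⟨y, hy⟩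
    exact ⟨w, w.2, h.le.trans (hx (mem_univ (⟨y, hy⟩ : K)))⟩

/-- The weight `‖g‖ ^ 2` at scale `h`, cut off at the boundary of the polydisc of radius `t`. -/
noncomputable def peakWeight {n : ℕ} (g : (Fin n → ℂ) → ℂ) (t h : ℝ) (p : (Fin n → ℂ) × (Fin n → ℂ)) : ℝ :=
  ‖g (p.1 + (h : ℂ) • p.2)‖ ^ 2 * ∏ j, (t ^ 2 - ‖p.1 j‖ ^ 2)

theorem mem_connectedComponentIn_of_mem_closure {X : Type*} [TopologicalSpace X] {O : Set X}
    {x₀ x : X} (hx₀ : x₀ ∈ O) (hx : x ∈ closure (connectedComponentIn O x₀)) (hxO : x ∈ O) :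
    x ∈ connectedComponentIn O x₀ := by
  have h1 : IsPreconnected (insert x (connectedComponentIn O x₀)) :=
    isPreconnected_connectedComponentIn.subset_closure (subset_insert _ _)
      (insert_subset hx subset_closure)
  exact h1.subset_connectedComponentIn (mem_insert_of_mem _ (mem_connectedComponentIn hx₀))
    (insert_subset hxO (connectedComponentIn_subset _ _)) (mem_insert _ _)

/-- On a component of `{‖x‖ < t, h₀ < dist (x, S)}` staying close to `S`, the peak weight has
a max-min point at a suitable scale. -/
theorem exists_peak {n : ℕ} {g : (Fin n → ℂ) → ℂ} {S : Set (Fin n → ℂ)} {ε₀ L t h₀ : ℝ} {k : ℕ}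
    (hgc : ContinuousOn g (ball 0 ε₀))
    (hS : S = {x ∈ ball (0 : Fin n → ℂ) ε₀ | g x = 0})
    (hL : ∀ x ∈ ball (0 : Fin n → ℂ) ε₀, ∀ y ∈ ball (0 : Fin n → ℂ) ε₀,
      ‖x‖ ≤ 3 * t → ‖y‖ ≤ 3 * t → ‖g x - g y‖ ≤ L * ‖x - y‖)
    (ht : 0 < t) (ht1 : t < 1) (htε : 3 * t < ε₀) (hh₀ : 0 < h₀) (hk : 1 ≤ k) (hSne : S.Nonempty)
    {x₀ : Fin n → ℂ} (hx₀ : ‖x₀‖ < t ∧ h₀ < infDist x₀ S)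
    (hW : ∀ x ∈ connectedComponentIn {x | ‖x‖ < t ∧ h₀ < infDist x S} x₀, infDist x S < t ^ k) :
    ∃ h φ : ℝ, ∃ x₁ : Fin n → ℂ, 0 < h ∧ h ≤ t ^ k ∧ 0 < φ ∧ φ ≤ h ^ k ∧ ‖x₁‖ < t ∧
      (∀ w ∈ closedBall 0 1, φ ≤ peakWeight g t h (x₁, w)) ∧
      ∀ᶠ x in 𝓝 x₁, ∃ w ∈ closedBall 0 1, peakWeight g t h (x, w) ≤ φ := by
  set O : Set (Fin n → ℂ) := {x | ‖x‖ < t ∧ h₀ < infDist x S} with hO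
  set W := connectedComponentIn O x₀ with hWdef
  have hOo : IsOpen O := (isOpen_lt continuous_norm continuous_const).inter
    (isOpen_lt continuous_const (continuous_infDist_pt S))
  have hWo : IsOpen W := hOo.connectedComponentIn
  have hWO : W ⊆ O := connectedComponentIn_subset _ _
  have hx₀W : x₀ ∈ W := mem_connectedComponentIn hx₀
  have htk : t ^ k ≤ t := pow_le_of_le_one ht.le ht1.le (by omega)
  set H := sSup ((fun x => infDist x S) '' W) with hH
  have hbdd : BddAbove ((fun x => infDist x S) '' W) :=
    ⟨t ^ k, by rintro _ ⟨x, hx, rfl⟩; exact (hW x hx).le⟩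
  have hleH : ∀ x ∈ W, infDist x S ≤ H := fun x hx => le_csSup hbdd ⟨x, hx, rfl⟩
  have hHle : H ≤ t ^ k := csSup_le ⟨_, x₀, hx₀W, rfl⟩ (by
    rintro _ ⟨x, hx, rfl⟩; exact (hW x hx).le)
  have hh₀H : h₀ < H := hx₀.2.trans_le (hleH x₀ hx₀W)
  obtain ⟨h, ⟨hh₀h, hhH⟩, hhk⟩ : ∃ h ∈ Ioo h₀ H, (L * (2 * (H - h))) ^ 2 < h₀ ^ k := by
    have h1 : Tendsto (fun h => (L * (2 * (H - h))) ^ 2) (𝓝[<] H) (𝓝 0) := by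
      have : Continuous fun h => (L * (2 * (H - h))) ^ 2 := by fun_prop
      exact (this.tendsto' H 0 (by simp)).mono_left nhdsWithin_le_nhds
    have h2 := h1.eventually_lt_const (pow_pos hh₀ k)
    have h3 : ∀ᶠ h in 𝓝[<] H, h ∈ Ioo h₀ H := Ioo_mem_nhdsLT hh₀H
    exact (h3.and h2).exists
  have hh : 0 < h := hh₀.trans hh₀h
  have hhc : (h : ℂ) ≠ 0 := Complex.ofReal_ne_zero.2 hh.ne'
  have hht : h ≤ t := hhH.le.trans (hHle.trans htk)
  have hnorm : ∀ x w : Fin n → ℂ, ‖x‖ ≤ t → w ∈ closedBall (0 : Fin n → ℂ) 1 →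
      ‖(h : ℂ) • w‖ ≤ h ∧ ‖x + (h : ℂ) • w‖ ≤ 2 * t := by
    intro x w hx hw
    rw [mem_closedBall_zero_iff] at hw
    have h1 : ‖(h : ℂ) • w‖ ≤ h := by
      rw [norm_smul, Complex.norm_real, Real.norm_of_nonneg hh.le]
      exact mul_le_of_le_one_right hh.le hw
    exact ⟨h1, (norm_add_le _ _).trans (by linarith)⟩
  have hWt : closure W ⊆ closedBall 0 t := by
    refine closure_minimal (fun x hx => ?_) isClosed_closedBall
    exact mem_closedBall_zero_iff.2 (hWO hx).1.le
  have hcont : ContinuousOn (peakWeight g t h) (closure W ×ˢ closedBall 0 1) := by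
    unfold peakWeight
    refine ContinuousOn.mul (ContinuousOn.pow (ContinuousOn.norm ?_) 2) (by fun_prop)
    refine hgc.comp (by fun_prop) fun p hp => ?_
    have := (hnorm p.1 p.2 (mem_closedBall_zero_iff.1 (hWt hp.1)) hp.2).2
    rw [mem_ball_zero_iff]
    linarith
  obtain ⟨x₁, hx₁, φ, hφmin, hφmax⟩ := IsCompact.exists_max_min
    ((isCompact_closedBall (0 : Fin n → ℂ) t).of_isClosed_subset isClosed_closure hWt)
    (isCompact_closedBall (0 : Fin n → ℂ) 1) ⟨x₀, subset_closure hx₀W⟩ ⟨0, by simp⟩ hcont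
  have hprod : ∀ x : Fin n → ℂ, ‖x‖ < t → 0 < ∏ j, (t ^ 2 - ‖x j‖ ^ 2) := fun x hx => by
    refine Finset.prod_pos fun j _ => ?_
    have h1 := (norm_le_pi_norm x j).trans_lt hx
    have h2 := norm_nonneg (x j)
    nlinarith
  have hφpos : 0 < φ := by
    obtain ⟨_, ⟨x₂, hx₂, rfl⟩, hlt⟩ := exists_lt_of_lt_csSup
      (⟨_, x₀, hx₀W, rfl⟩ : ((fun x => infDist x S) '' W).Nonempty) hhH
    obtain ⟨w, hw, hle⟩ := hφmax x₂ (subset_closure hx₂)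
    refine lt_of_lt_of_le (mul_pos ?_ (hprod x₂ (hWO hx₂).1)) hle
    obtain ⟨h1, h2⟩ := hnorm x₂ w (hWO hx₂).1.le hw
    refine pow_pos (norm_pos_iff.2 fun h0 => ?_) 2
    have hmem : x₂ + (h : ℂ) • w ∈ S := by
      rw [hS]; exact ⟨mem_ball_zero_iff.2 (by linarith), h0⟩
    have := infDist_le_dist_of_mem (x := x₂) hmem
    rw [dist_self_add_right] at this
    exact absurd hlt (not_lt.2 (this.trans h1))
  have hx₁t : ‖x₁‖ ≤ t := mem_closedBall_zero_iff.1 (hWt hx₁)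
  -- a zero at distance at most `h` would make the minimum vanish
  have hzero : ∀ y ∈ S, h < ‖y - x₁‖ := by
    intro y hy
    by_contra! hle
    have hw : (h : ℂ)⁻¹ • (y - x₁) ∈ closedBall (0 : Fin n → ℂ) 1 := by
      rw [mem_closedBall_zero_iff, norm_smul, norm_inv, Complex.norm_real,
        Real.norm_of_nonneg hh.le, inv_mul_le_iff₀ hh]
      linarith
    have h1 := hφmin _ hw
    rw [hS] at hy
    rw [peakWeight, smul_inv_smul₀ hhc, add_sub_cancel, hy.2] at h1
    simp at h1
    linarith
  have hx₁lt : ‖x₁‖ < t := by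
    refine lt_of_le_of_ne hx₁t fun heq => ?_
    obtain ⟨j, hj⟩ : ∃ j, t ≤ ‖x₁ j‖ := by
      by_contra! hcon
      exact absurd heq ((pi_norm_lt_iff ht).2 hcon).ne
    have hj' : ‖x₁ j‖ = t := le_antisymm ((norm_le_pi_norm x₁ j).trans hx₁t) hj
    have h1 := hφmin 0 (by simp)
    rw [peakWeight, Finset.prod_eq_zero (Finset.mem_univ j) (by simp [hj']), mul_zero] at h1
    linarith
  have hx₁W : x₁ ∈ W := by
    refine mem_connectedComponentIn_of_mem_closure hx₀ hx₁ ⟨hx₁lt, ?_⟩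
    refine hh₀h.trans_le ((le_infDist hSne).2 fun y hy => ?_)
    rw [dist_comm, dist_eq_norm]
    exact (hzero y hy).le
  refine ⟨h, φ, x₁, hh, hhH.le.trans hHle, hφpos, ?_, hx₁lt, hφmin,
    eventually_of_mem (hWo.mem_nhds hx₁W) fun x hx => hφmax x (subset_closure hx)⟩
  obtain ⟨y, hyS, hyd⟩ := (infDist_lt_iff hSne).1
    ((hleH x₁ hx₁W).trans_lt (by linarith : H < 2 * H - h))
  rw [dist_comm, dist_eq_norm] at hyd
  have hyh := hzero y hyS
  set ℓ := ‖y - x₁‖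
  have hℓ : 0 < ℓ := hh.trans hyh
  set w : Fin n → ℂ := (ℓ : ℂ)⁻¹ • (y - x₁) with hw
  have hwball : w ∈ closedBall (0 : Fin n → ℂ) 1 := by
    rw [mem_closedBall_zero_iff, norm_smul, norm_inv, Complex.norm_real,
      Real.norm_of_nonneg hℓ.le, inv_mul_cancel₀ hℓ.ne']
  have hℓc : (ℓ : ℂ) ≠ 0 := Complex.ofReal_ne_zero.2 hℓ.ne'
  have hdiff : x₁ + (h : ℂ) • w - y = ((h - ℓ : ℝ) : ℂ) • w := by
    have : y - x₁ = (ℓ : ℂ) • w := by rw [hw, smul_inv_smul₀ hℓc]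
    rw [Complex.ofReal_sub, sub_smul, ← this]
    abel
  have hyt : ‖y‖ ≤ 3 * t := by
    have : ‖y‖ ≤ ‖x₁‖ + ℓ := by simpa using norm_add_le x₁ (y - x₁)
    have : H ≤ t := hHle.trans htk
    linarith
  have hdist : ‖x₁ + (h : ℂ) • w - y‖ ≤ ℓ - h := by
    rw [hdiff, norm_smul, Complex.norm_real, Real.norm_of_nonpos (by linarith)]
    rw [mem_closedBall_zero_iff] at hwball
    nlinarith
  have hpt := (hnorm x₁ w hx₁t hwball).2
  rw [hS] at hyS
  have hLL := hL (x₁ + (h : ℂ) • w) (mem_ball_zero_iff.2 (by linarith)) y hyS.1 (by linarith) hyt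
  rw [hyS.2, sub_zero] at hLL
  have hprodle : ∏ j, (t ^ 2 - ‖x₁ j‖ ^ 2) ≤ 1 := by
    refine Finset.prod_le_one (fun j _ => ?_) fun j _ => ?_
    · have h1 := (norm_le_pi_norm x₁ j).trans hx₁t
      have h2 := norm_nonneg (x₁ j)
      nlinarith
    · have := sq_nonneg ‖x₁ j‖
      nlinarith
  calc φ ≤ ‖g (x₁ + (h : ℂ) • w)‖ ^ 2 * ∏ j, (t ^ 2 - ‖x₁ j‖ ^ 2) := hφmin w hwball
    _ ≤ ‖g (x₁ + (h : ℂ) • w)‖ ^ 2 := mul_le_of_le_one_right (sq_nonneg _) hprodle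
    _ ≤ (L * (2 * (H - h))) ^ 2 := by
      rcases le_or_gt 0 L with hL0 | hL0
      · refine pow_le_pow_left₀ (norm_nonneg _) (hLL.trans ?_) 2
        exact mul_le_mul_of_nonneg_left (by linarith) hL0
      · have h1 : ‖g (x₁ + (h : ℂ) • w)‖ ≤ 0 :=
          hLL.trans (mul_nonpos_of_nonpos_of_nonneg hL0.le (norm_nonneg _))
        rw [le_antisymm h1 (norm_nonneg _)]
        simpa using sq_nonneg _
    _ ≤ h₀ ^ k := hhk.le
    _ ≤ h ^ k := pow_le_pow_left₀ hh₀.le hh₀h.le k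

theorem contDiffAt_peakWeight {n : ℕ} {g : (Fin n → ℂ) → ℂ} {t h : ℝ}
    {p : (Fin n → ℂ) × (Fin n → ℂ)} (hg : AnalyticAt ℂ g (p.1 + (h : ℂ) • p.2)) :
    ContDiffAt ℝ 1 (peakWeight g t h) p := by
  unfold peakWeight
  refine ContDiffAt.mul (ContDiffAt.norm_sq ℝ ?_) ?_
  · have h1 : ContDiffAt ℝ 1 g (p.1 + (h : ℂ) • p.2) := (hg.contDiffAt (n := 1)).restrict_scalars ℝ
    refine ContDiffAt.comp (f := fun p : (Fin n → ℂ) × (Fin n → ℂ) => p.1 + (h : ℂ) • p.2) p h1 ?_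
    fun_prop
  · refine contDiffAt_prod fun j _ => contDiffAt_const.sub (ContDiffAt.norm_sq ℝ ?_)
    fun_prop

/-- The configuration of the points `x + h • w i`, with slack in the unit polydisc. -/
noncomputable def Configuration.ofPoints {n d : ℕ} (h : ℝ) (x : Fin n → ℂ) (w : Fin d → Fin n → ℂ) :
    Configuration n d :=
  (x, star x, fun i => x + (h : ℂ) • w i, star fun i => x + (h : ℂ) • w i,
    fun i j => ((h * √(1 - ‖w i j‖ ^ 2) : ℝ) : ℂ))

namespace Configuration

variable {n d : ℕ} {h t : ℝ} {x : Fin n → ℂ} {w : Fin d → Fin n → ℂ}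

theorem conj_ofPoints : (ofPoints h x w).conj = ofPoints h x w := by
  simp only [conj, ofPoints, star_star]
  congr
  ext i j
  simp only [Pi.star_apply]
  exact Complex.conj_ofReal _

theorem value_ofPoints (g : (Fin n → ℂ) → ℂ) (i : Fin d) :
    value g t i (ofPoints h x w) = peakWeight g t h (x, w i) :=
  value_of_conj_eq conj_ofPoints

theorem radius_ofPoints (hw : ∀ i, w i ∈ closedBall (0 : Fin n → ℂ) 1) (i : Fin d) (j : Fin n) :
    radius i j (ofPoints h x w) = h ^ 2 := by
  rw [radius_of_conj_eq conj_ofPoints]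
  have h1 : ‖w i j‖ ≤ 1 := (norm_le_pi_norm (w i) j).trans (mem_closedBall_zero_iff.1 (hw i))
  have h2 : √(1 - ‖w i j‖ ^ 2) ^ 2 = 1 - ‖w i j‖ ^ 2 := Real.sq_sqrt (by
    have := norm_nonneg (w i j); nlinarith)
  simp only [ofPoints, Pi.add_apply, add_sub_cancel_left, Pi.smul_apply, smul_eq_mul, norm_mul,
    Complex.norm_real, Complex.ofReal_re, mul_pow, h2, Real.norm_eq_abs, sq_abs]
  push_cast
  ring

theorem norm_ofPoints_le (hh : 0 ≤ h) (hht : h ≤ t) (hx : ‖x‖ ≤ t)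
    (hw : ∀ i, w i ∈ closedBall (0 : Fin n → ℂ) 1) : ‖ofPoints h x w‖ ≤ 2 * t := by
  have ht : 0 ≤ t := hh.trans hht
  have hy : ∀ i, ‖x + (h : ℂ) • w i‖ ≤ 2 * t := fun i => by
    have h1 := mem_closedBall_zero_iff.1 (hw i)
    refine (norm_add_le _ _).trans ?_
    rw [norm_smul, Complex.norm_real, Real.norm_of_nonneg hh]
    nlinarith
  refine norm_prod_le_iff.2 ⟨by simp only [ofPoints]; linarith, norm_prod_le_iff.2
    ⟨by simp only [ofPoints, norm_star]; linarith, norm_prod_le_iff.2 ⟨?_, norm_prod_le_iff.2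
      ⟨?_, ?_⟩⟩⟩⟩
  · exact (pi_norm_le_iff_of_nonneg (by positivity)).2 hy
  · simp only [ofPoints, norm_star]
    exact (pi_norm_le_iff_of_nonneg (by positivity)).2 hy
  · refine (pi_norm_le_iff_of_nonneg (by positivity)).2 fun i =>
      (pi_norm_le_iff_of_nonneg (by positivity)).2 fun j => ?_
    simp only [ofPoints]
    rw [Complex.norm_real, norm_mul, Real.norm_of_nonneg hh, Real.norm_of_nonneg (Real.sqrt_nonneg _)]
    have : √(1 - ‖w i j‖ ^ 2) ≤ 1 := Real.sqrt_le_one.2 (by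
      have := sq_nonneg ‖w i j‖; linarith)
    nlinarith [Real.sqrt_nonneg (1 - ‖w i j‖ ^ 2)]

theorem analyticAt_value_sub {g : (Fin n → ℂ) → ℂ} (hg : AnalyticAt ℂ g 0) (i : Fin d) :
    AnalyticAt ℂ (fun p : ℂ × ℂ × ℂ × Configuration n d => value g p.2.2.1 i p.2.2.2 - p.1) 0 := by
  obtain ⟨r, hr, hgr⟩ := hg.exists_ball_analyticOnNhd
  have hd : DifferentiableOn ℂ
      (fun p : ℂ × ℂ × ℂ × Configuration n d => value g p.2.2.1 i p.2.2.2 - p.1) (ball 0 r) := by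
    intro p hp
    rw [mem_ball_zero_iff] at hp
    have hn : ‖p.2.2.2.2.2‖ < r :=
      ((norm_snd_le p.2.2.2.2).trans ((norm_snd_le p.2.2.2).trans ((norm_snd_le p.2.2).trans
        ((norm_snd_le p.2).trans (norm_snd_le p))))).trans_lt hp
    have h1 : DifferentiableAt ℂ g (p.2.2.2.2.2.1 i) := by
      refine (hgr _ (mem_ball_zero_iff.2 ?_)).differentiableAt
      exact ((norm_le_pi_norm _ i).trans (norm_fst_le p.2.2.2.2.2)).trans_lt hn
    have h2 : DifferentiableAt ℂ g (star (p.2.2.2.2.2.2.1 i)) := by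
      refine (hgr _ (mem_ball_zero_iff.2 ?_)).differentiableAt
      rw [norm_star]
      exact ((norm_le_pi_norm _ i).trans ((norm_fst_le p.2.2.2.2.2.2).trans
        (norm_snd_le p.2.2.2.2.2))).trans_lt hn
    have h3 := (differentiableAt_value (p := p.2.2) h1 h2).comp p
      (f := fun p : ℂ × ℂ × ℂ × Configuration n d => p.2.2) (by fun_prop)
    exact (h3.sub (by fun_prop : DifferentiableAt ℂ
      (fun p : ℂ × ℂ × ℂ × Configuration n d => p.1) p)).differentiableWithinAt
  exact hd.analyticOnNhd_of_finiteDimensional isOpen_ball 0 (mem_ball_self hr)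

theorem analyticAt_radius_sub (i : Fin d) (j : Fin n) :
    AnalyticAt ℂ (fun p : ℂ × ℂ × ℂ × Configuration n d => radius i j p.2.2.2 - p.2.1 ^ 2) 0 := by
  have hd : Differentiable ℂ
      (fun p : ℂ × ℂ × ℂ × Configuration n d => radius i j p.2.2.2 - p.2.1 ^ 2) := by
    unfold radius
    fun_prop
  exact hd.differentiableOn.analyticOnNhd_of_finiteDimensional isOpen_univ 0 (mem_univ _)

end Configuration

/-- Every component of `{‖x‖ < t, h₀ < dist (x, S)}` contains a point whose distance to `S` is at
least a fixed power of `t`. -/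
theorem exists_pow_le_infDist_of_component {n : ℕ} {ε₀ : ℝ} (hε₀ : 0 < ε₀)
    {g : (Fin n → ℂ) → ℂ} (hgan : AnalyticOnNhd ℂ g (ball (0 : Fin n → ℂ) ε₀)) (hg0 : g 0 = 0)
    {S : Set (Fin n → ℂ)} (hS : S = {x ∈ ball (0 : Fin n → ℂ) ε₀ | g x = 0}) :
    ∃ N : ℕ, ∃ δ > 0, ∀ t, 0 < t → t < δ → ∀ h₀ > 0, ∀ x₀ : Fin n → ℂ,
      ‖x₀‖ < t → h₀ < infDist x₀ S →
      ∃ x₁ ∈ connectedComponentIn {x | ‖x‖ < t ∧ h₀ < infDist x S} x₀, t ^ N ≤ infDist x₁ S := by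
  have hg0an : AnalyticAt ℂ g 0 := hgan 0 (mem_ball_self hε₀)
  have hSne : S.Nonempty := ⟨0, by rw [hS]; exact ⟨mem_ball_self hε₀, hg0⟩⟩
  obtain ⟨L, s, hs, hLs⟩ := (hg0an.contDiffAt (n := 1)).exists_lipschitzOnWith
  obtain ⟨ε₁, hε₁, hε₁s⟩ := Metric.mem_nhds_iff.1 hs
  by_contra! hcon
  have hpeak : ∀ k : ℕ, ∃ t h φ : ℝ, ∃ x₁ : Fin n → ℂ, 0 < t ∧ t < 1 ∧ t < 1 / ((k : ℝ) + 1) ∧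
      3 * t < ε₀ ∧ 0 < h ∧ h ≤ t ^ (k + 1) ∧ 0 < φ ∧ φ ≤ h ^ (k + 1) ∧ ‖x₁‖ < t ∧
      (∀ w ∈ closedBall 0 1, φ ≤ peakWeight g t h (x₁, w)) ∧
      ∀ᶠ x in 𝓝 x₁, ∃ w ∈ closedBall 0 1, peakWeight g t h (x, w) ≤ φ := by
    intro k
    obtain ⟨t, ht, htδ, h₀, hh₀, x₀, hx₀, hh₀x, hfar⟩ := hcon (k + 1)
      (min (min 1 (1 / ((k : ℝ) + 1))) (min (ε₀ / 3) (ε₁ / 3))) (by positivity)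
    simp only [lt_min_iff] at htδ
    obtain ⟨⟨ht1, htk⟩, htε, htε₁⟩ := htδ
    obtain ⟨h, φ, x₁, H⟩ := exists_peak (L := L) (k := k + 1) hgan.continuousOn hS
      (fun x _ y _ hx hy => by
        have h1 := hLs.dist_le_mul x (hε₁s (mem_ball_zero_iff.2 (by linarith))) y
          (hε₁s (mem_ball_zero_iff.2 (by linarith)))
        rwa [dist_eq_norm, dist_eq_norm] at h1)
      ht ht1 (by linarith) hh₀ (by omega) hSne ⟨hx₀, hh₀x⟩ hfar
    exact ⟨t, h, φ, x₁, ht, ht1, htk, by linarith, H⟩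
  choose t h φ x ht ht1 htk htε hh hhk hφ hφk hx hmin hmax using hpeak
  have hht : ∀ k, h k ≤ t k := fun k =>
    (hhk k).trans (pow_le_of_le_one (ht k).le (ht1 k).le (by omega))
  have hball : ∀ k, ∀ w ∈ closedBall (0 : Fin n → ℂ) 1,
      x k + (h k : ℂ) • w ∈ ball (0 : Fin n → ℂ) ε₀ := by
    intro k w hw
    rw [mem_closedBall_zero_iff] at hw
    rw [mem_ball_zero_iff]
    refine (norm_add_le _ _).trans_lt ?_
    rw [norm_smul, Complex.norm_real, Real.norm_of_nonneg (hh k).le]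
    have := hx k; have := hht k; have := htε k; have := ht k; have := hh k
    nlinarith
  have hGd : ∀ k, ∀ w ∈ closedBall (0 : Fin n → ℂ) 1,
      ContDiffAt ℝ 1 (peakWeight g (t k) (h k)) (x k, w) := fun k w hw =>
    contDiffAt_peakWeight (hgan _ (hball k w hw))
  have hcert : ∀ k, ∃ w : Fin (Module.finrank ℝ (Fin n → ℂ) + 1) → Fin n → ℂ,
      (∀ i, w i ∈ closedBall (0 : Fin n → ℂ) 1 ∧ peakWeight g (t k) (h k) (x k, w i) = φ k) ∧
      ¬ ∃ v, ∀ i, 0 < (fderiv ℝ (peakWeight g (t k) (h k)) (x k, w i) ∘L .inl ℝ _ _) v := by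
    intro k
    have hP := isCompact_closedBall (0 : Fin n → ℂ) 1
    have hA : IsCompact {w ∈ closedBall (0 : Fin n → ℂ) 1 |
        peakWeight g (t k) (h k) (x k, w) = φ k} := by
      refine hP.of_isClosed_subset ?_ fun w hw => hw.1
      refine ContinuousOn.preimage_isClosed_of_isClosed
        (f := fun w => peakWeight g (t k) (h k) (x k, w)) (t := {φ k}) (fun w hw => ?_)
        isClosed_closedBall isClosed_singleton
      exact ((hGd k w hw).continuousAt.comp
        (f := fun w => (x k, w)) (by fun_prop)).continuousWithinAt
    refine exists_fin_family_not_forall_pos hA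
      (l := fun w => fderiv ℝ (peakWeight g (t k) (h k)) (x k, w) ∘L .inl ℝ _ _)
      (fun w hw => ?_) (not_exists_forall_active_pos hP (hGd k) (hmin k) (hmax k))
    have h1 : ContinuousAt (fderiv ℝ (peakWeight g (t k) (h k))) (x k, w) :=
      ((hGd k w hw.1).fderiv_right (m := 0) le_rfl).continuousAt
    have h2 := h1.comp (f := fun w => (x k, w)) (by fun_prop)
    exact (h2.clm_comp continuousAt_const).continuousWithinAt
  choose w hw hno using hcert
  set 𝒰 : Ultrafilter ℕ := hyperfilter ℕ
  have h𝒰 : (𝒰 : Filter ℕ) ≤ atTop := Nat.hyperfilter_le_atTop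
  have ht0 : Tendsto t atTop (𝓝 0) :=
    squeeze_zero (fun k => (ht k).le) (fun k => (htk k).le) tendsto_one_div_add_atTop_nhds_zero_nat
  have hscales : HierarchicalScales 𝒰 t h φ :=
    { pos := Eventually.of_forall fun k => ⟨ht k, hh k, hφ k⟩
      tendsto := ht0.mono_left h𝒰
      flat_left := fun N => h𝒰 ((eventually_ge_atTop N).mono fun k hk =>
        (hhk k).trans (pow_le_pow_of_le_one (ht k).le (ht1 k).le (by omega)))
      flat_right := fun N => h𝒰 ((eventually_ge_atTop N).mono fun k hk =>
        (hφk k).trans (pow_le_pow_of_le_one (hh k).le ((hht k).trans (ht1 k).le) (by omega))) }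
  have hconf : Tendsto (fun k => Configuration.ofPoints (h k) (x k) (w k)) 𝒰 (𝓝 0) := by
    refine squeeze_zero_norm (a := fun k => 2 * t k) (fun k =>
      Configuration.norm_ofPoints_le (hh k).le (hht k) (hx k).le fun i => (hw k i).1) ?_
    simpa using (ht0.mono_left h𝒰).const_mul 2
  set d := Module.finrank ℝ (Fin n → ℂ) + 1
  obtain ⟨k, γ, hγ0, hγ, hFs⟩ := (curveLifting_of_finiteDimensional hscales hconf
    (Fs := range (fun (i : Fin d) (p : ℂ × ℂ × ℂ × Configuration n d) =>
        Configuration.value g p.2.2.1 i p.2.2.2 - p.1) ∪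
      range (fun (ij : Fin d × Fin n) (p : ℂ × ℂ × ℂ × Configuration n d) =>
        Configuration.radius ij.1 ij.2 p.2.2.2 - p.2.1 ^ 2))
    ((finite_range _).union (finite_range _)) (by
      rintro _ (⟨i, rfl⟩ | ⟨ij, rfl⟩)
      · exact Configuration.analyticAt_value_sub hg0an i
      · exact Configuration.analyticAt_radius_sub ij.1 ij.2)).exists
  refine hno k (exists_increasing_direction (hh k) (fun i => (hw k i).1)
    (fun i => hgan _ (hball k _ (hw k i).1)) hγ0 hγ (fun i => ?_) (fun i j => ?_) rfl
    (fun i => (hGd k _ (hw k i).1).differentiableAt one_ne_zero) (fun i => (hw k i).2) (hmin k))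
  · refine (hFs _ (.inl ⟨i, rfl⟩) ?_).mono fun σ hσ => sub_eq_zero.1 hσ
    simp only [Configuration.value_ofPoints, (hw k i).2, sub_self]
  · refine (hFs _ (.inr ⟨(i, j), rfl⟩) ?_).mono fun σ hσ => sub_eq_zero.1 hσ
    simp only [Configuration.radius_ofPoints (fun i => (hw k i).1), sub_self]

/-- The Cauchy integral of `φ` over the circle of radius `R` about the origin. -/
noncomputable def cauchyTransform (φ : ℂ → ℂ) (R : ℝ) (ζ : ℂ) : ℂ :=
  (2 * Real.pi * Complex.I : ℂ)⁻¹ • ∮ ξ in C(0, R), (ξ - ζ)⁻¹ * φ ξ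

theorem norm_cauchyTransform_le {φ : ℂ → ℂ} {R C δ : ℝ} {ζ : ℂ} (hR : 0 ≤ R) (hδ : 0 < δ)
    (hφ : ∀ ξ ∈ sphere (0 : ℂ) R, ‖φ ξ‖ ≤ C) (hζ : ∀ ξ ∈ sphere (0 : ℂ) R, δ ≤ ‖ξ - ζ‖) :
    ‖cauchyTransform φ R ζ‖ ≤ R * (δ⁻¹ * C) := by
  refine circleIntegral.norm_two_pi_i_inv_smul_integral_le_of_norm_le_const hR fun ξ hξ => ?_
  rw [norm_mul, norm_inv]
  exact mul_le_mul (inv_anti₀ hδ (hζ ξ hξ)) (hφ ξ hξ) (norm_nonneg _) (by positivity)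

theorem analyticOnNhd_cauchyTransform {φ : ℂ → ℂ} {R : ℝ} (hR : 0 ≤ R)
    (hφ : ∀ ξ ∈ sphere (0 : ℂ) R, AnalyticAt ℂ φ ξ) :
    AnalyticOnNhd ℂ (cauchyTransform φ R) (sphere 0 R)ᶜ := by
  intro ζ hζ
  refine analyticAt_const.mul (analyticOnNhd_circleIntegral
    (H := fun ζ ξ => (ξ - ζ)⁻¹ * φ ξ) isClosed_sphere.isOpen_compl hR ?_ ζ hζ)
  intro z hz ξ hξ
  refine AnalyticAt.mul (AnalyticAt.inv (analyticAt_snd.sub analyticAt_fst) ?_) ?_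
  · exact sub_ne_zero.2 fun h : ξ = z => hz (h ▸ hξ)
  · exact (hφ ξ hξ).comp_of_eq (f := fun p : ℂ × ℂ => p.2) analyticAt_snd rfl

/-- Cauchy's integral formula in an annulus. -/
theorem eq_cauchyTransform_sub {φ : ℂ → ℂ} {r R : ℝ} (hr : 0 < r)
    (hφ : ∀ ξ : ℂ, r ≤ ‖ξ‖ → ‖ξ‖ ≤ R → AnalyticAt ℂ φ ξ) {ζ : ℂ} (hrζ : r < ‖ζ‖) (hζR : ‖ζ‖ < R) :
    φ ζ = cauchyTransform φ R ζ - cauchyTransform φ r ζ := by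
  have hrR : r ≤ R := (hrζ.trans hζR).le
  have hφζ := hφ ζ hrζ.le hζR.le
  have hann : ∮ ξ in C(0, R), dslope φ ζ ξ = ∮ ξ in C(0, r), dslope φ ζ ξ := by
    refine Complex.circleIntegral_eq_of_differentiable_on_annulus_off_countable hr hrR
      (countable_singleton ζ) (fun ξ hξ => ?_) fun ξ hξ => ?_
    · rcases eq_or_ne ξ ζ with rfl | hne
      · exact (continuousAt_dslope_same.2 hφζ.differentiableAt).continuousWithinAt
      · rw [Set.mem_sdiff, mem_closedBall_zero_iff, mem_ball_zero_iff, not_lt] at hξ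
        exact ((continuousAt_dslope_of_ne hne).2
          (hφ ξ hξ.2 hξ.1).continuousAt).continuousWithinAt
    · rw [Set.mem_sdiff, Set.mem_sdiff, mem_closedBall_zero_iff, mem_ball_zero_iff, not_le] at hξ
      exact (differentiableAt_dslope_of_ne hξ.2).2
        (hφ ξ hξ.1.2.le hξ.1.1.le).differentiableAt
  have hsplit : ∀ ρ : ℝ, r ≤ ρ → ρ ≤ R → ρ ≠ ‖ζ‖ → ∮ ξ in C(0, ρ), dslope φ ζ ξ =
      (∮ ξ in C(0, ρ), (ξ - ζ)⁻¹ * φ ξ) - (∮ ξ in C(0, ρ), (ξ - ζ)⁻¹) * φ ζ := by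
    intro ρ hrρ hρR hρ
    have hρ0 : 0 ≤ ρ := hr.le.trans hrρ
    have hne : ∀ ξ ∈ sphere (0 : ℂ) ρ, ξ ≠ ζ := fun ξ hξ h => hρ (by simpa [h] using hξ.symm)
    have hinv : ContinuousOn (fun ξ : ℂ => (ξ - ζ)⁻¹) (sphere 0 ρ) := fun ξ hξ =>
      ((by fun_prop : Continuous fun ξ : ℂ => ξ - ζ).continuousAt.inv₀
        (sub_ne_zero.2 (hne ξ hξ))).continuousWithinAt
    have hφc : ContinuousOn φ (sphere 0 ρ) := fun ξ hξ => by
      have h : ‖ξ‖ = ρ := by simpa using hξ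
      exact (hφ ξ (h ▸ hrρ) (h ▸ hρR)).continuousAt.continuousWithinAt
    have h1 : (∮ ξ in C(0, ρ), (ξ - ζ)⁻¹) * φ ζ = ∮ ξ in C(0, ρ), (ξ - ζ)⁻¹ * φ ζ := by
      simpa using (circleIntegral.integral_smul_const (fun ξ : ℂ => (ξ - ζ)⁻¹) (φ ζ) 0 ρ).symm
    rw [h1, ← circleIntegral.integral_sub ((hinv.fun_mul hφc).circleIntegrable hρ0)
      ((hinv.fun_mul continuousOn_const).circleIntegrable hρ0)]
    refine circleIntegral.integral_congr hρ0 fun ξ hξ => ?_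
    rw [dslope_of_ne _ (hne ξ hξ), slope_def_field]
    ring
  have hout : ∮ ξ in C(0, R), (ξ - ζ)⁻¹ = 2 * Real.pi * Complex.I :=
    circleIntegral.integral_sub_inv_of_mem_ball (mem_ball_zero_iff.2 hζR)
  have hin : ∮ ξ in C(0, r), (ξ - ζ)⁻¹ = 0 := by
    have hne : ∀ ξ ∈ closedBall (0 : ℂ) r, ξ - ζ ≠ 0 := fun ξ hξ h => by
      rw [sub_eq_zero.1 h, mem_closedBall_zero_iff] at hξ
      linarith
    refine Complex.circleIntegral_eq_zero_of_differentiable_on_off_countable hr.le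
      countable_empty (fun ξ hξ => ?_) fun ξ hξ => ?_
    · exact ((by fun_prop : Continuous fun ξ : ℂ => ξ - ζ).continuousAt.inv₀
        (hne ξ hξ)).continuousWithinAt
    · exact DifferentiableAt.inv (by fun_prop) (hne ξ (ball_subset_closedBall hξ.1))
  rw [hsplit R hrR le_rfl hζR.ne', hsplit r le_rfl hrR hrζ.ne, hout, hin] at hann
  have hpi : (2 * Real.pi * Complex.I : ℂ) ≠ 0 := Complex.two_pi_I_ne_zero
  rw [cauchyTransform, cauchyTransform, ← smul_sub, smul_eq_mul, eq_inv_mul_iff_mul_eq₀ hpi]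
  linear_combination -hann

section LemniscateEstimates

variable {φ P : ℂ → ℂ} {r η C : ℝ} {m : ℕ}

theorem norm_sub_cauchyTransform_le (hr : 0 < r)
    (hann : ∀ ζ : ℂ, r / 2 ≤ ‖ζ‖ → η < ‖P ζ‖)
    (hφC : ∀ ζ : ℂ, ‖ζ‖ ≤ r → η ≤ ‖P ζ‖ → ‖φ ζ‖ ≤ C) {ζ : ℂ} (hζ : ‖ζ‖ ≤ 3 * r / 4)
    (hPζ : η ≤ ‖P ζ‖) : ‖φ ζ - cauchyTransform φ r ζ‖ ≤ 5 * C := by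
  have h1 : ‖cauchyTransform φ r ζ‖ ≤ r * ((r / 4)⁻¹ * C) := by
    refine norm_cauchyTransform_le hr.le (by positivity) (fun ξ hξ => ?_) fun ξ hξ => ?_
    · rw [mem_sphere_zero_iff_norm] at hξ
      exact hφC ξ hξ.le (hann ξ (by linarith)).le
    · rw [mem_sphere_zero_iff_norm] at hξ
      have := norm_sub_norm_le ξ ζ
      linarith
  have h2 : r * ((r / 4)⁻¹ * C) = 4 * C := by field_simp
  have h3 := hφC ζ (by linarith) hPζ
  exact (norm_sub_le _ _).trans (by linarith)

theorem norm_cauchyTransform_half_le (hr : 0 < r)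
    (hann : ∀ ζ : ℂ, r / 2 ≤ ‖ζ‖ → η < ‖P ζ‖)
    (hφC : ∀ ζ : ℂ, ‖ζ‖ ≤ r → η ≤ ‖P ζ‖ → ‖φ ζ‖ ≤ C) {ζ : ℂ} (hζ : r / 2 < ‖ζ‖) :
    ‖cauchyTransform φ (r / 2) ζ‖ ≤ r / 2 * ((‖ζ‖ - r / 2)⁻¹ * C) := by
  refine norm_cauchyTransform_le (by positivity) (by linarith) (fun ξ hξ => ?_) fun ξ hξ => ?_
  · rw [mem_sphere_zero_iff_norm] at hξ
    exact hφC ξ (by linarith) (hann ξ hξ.ge).le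
  · rw [mem_sphere_zero_iff_norm] at hξ
    have := norm_sub_norm_le ζ ξ
    rw [norm_sub_rev, hξ] at this
    exact this

/-- The singular part of a function bounded off the set where `P` is small is small. -/
theorem norm_cauchyTransform_pow_mul_le (hr : 0 < r) (hη : 0 < η) (hP : Differentiable ℂ P)
    (hgrow : ∀ ζ : ℂ, r ≤ ‖ζ‖ → ‖P ζ‖ ≤ (2 * ‖ζ‖) ^ m)
    (hann : ∀ ζ : ℂ, r / 2 ≤ ‖ζ‖ → η < ‖P ζ‖)
    (hφ : ∀ ζ : ℂ, ‖ζ‖ ≤ r → η ≤ ‖P ζ‖ → AnalyticAt ℂ φ ζ)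
    (hφC : ∀ ζ : ℂ, ‖ζ‖ ≤ r → η ≤ ‖P ζ‖ → ‖φ ζ‖ ≤ C) {ζ₀ : ℂ} (hζ₀ : 3 * r / 4 ≤ ‖ζ₀‖) :
    ‖cauchyTransform φ (r / 2) ζ₀‖ ^ (m + 1) * ‖P ζ₀‖ ≤ (5 * C) ^ (m + 1) * η := by
  have hC : 0 ≤ C := by
    have h : ‖((r / 2 : ℝ) : ℂ)‖ = r / 2 := by
      rw [Complex.norm_real, Real.norm_of_nonneg (by positivity)]
    exact (norm_nonneg _).trans (hφC ((r / 2 : ℝ) : ℂ) (by rw [h]; linarith) (hann _ h.ge).le)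
  set v : ℂ → ℂ := fun ζ =>
    if ‖ζ‖ < 3 * r / 4 then φ ζ - cauchyTransform φ r ζ else - cauchyTransform φ (r / 2) ζ with hv
  have hvin : ∀ ζ : ℂ, ‖ζ‖ < 3 * r / 4 → v ζ = φ ζ - cauchyTransform φ r ζ := fun ζ h => if_pos h
  have hvout : ∀ ζ : ℂ, r / 2 < ‖ζ‖ → v ζ = - cauchyTransform φ (r / 2) ζ := fun ζ h => by
    by_cases hζ : ‖ζ‖ < 3 * r / 4
    · rw [hvin ζ hζ, eq_cauchyTransform_sub (R := r) (by positivity : 0 < r / 2)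
        (fun ξ h1 h2 => hφ ξ h2 (hann ξ h1).le) h (by linarith)]
      ring
    · exact if_neg hζ
  have hvC : ∀ ζ : ℂ, η ≤ ‖P ζ‖ → ‖v ζ‖ ≤ 5 * C := by
    intro ζ hPζ
    by_cases hζ : ‖ζ‖ < 3 * r / 4
    · rw [hvin ζ hζ]
      exact norm_sub_cauchyTransform_le hr hann hφC hζ.le hPζ
    · push Not at hζ
      have h1 : r / 2 < ‖ζ‖ := by linarith
      rw [hvout ζ h1, norm_neg]
      refine (norm_cauchyTransform_half_le hr hann hφC h1).trans ?_
      have h2 : (‖ζ‖ - r / 2)⁻¹ ≤ (r / 4)⁻¹ := inv_anti₀ (by positivity) (by linarith)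
      calc r / 2 * ((‖ζ‖ - r / 2)⁻¹ * C) ≤ r / 2 * ((r / 4)⁻¹ * C) := by gcongr
        _ = 2 * C := by field_simp; norm_num
        _ ≤ 5 * C := by linarith
  have hvd : ∀ ζ : ℂ, η ≤ ‖P ζ‖ → DifferentiableAt ℂ v ζ := by
    intro ζ hPζ
    by_cases hζ : ‖ζ‖ < 3 * r / 4
    · have h1 : DifferentiableAt ℂ (fun ζ => φ ζ - cauchyTransform φ r ζ) ζ := by
        refine (hφ ζ (by linarith) hPζ).differentiableAt.sub
          (analyticOnNhd_cauchyTransform hr.le (fun ξ hξ => ?_) ζ fun h => ?_).differentiableAt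
        · rw [mem_sphere_zero_iff_norm] at hξ
          exact hφ ξ hξ.le (hann ξ (by linarith)).le
        · rw [mem_sphere_zero_iff_norm] at h
          linarith
      refine h1.congr_of_eventuallyEq ?_
      filter_upwards [(isOpen_lt continuous_norm continuous_const).mem_nhds hζ] with ξ hξ
      exact hvin ξ hξ
    · push Not at hζ
      have h0 : r / 2 < ‖ζ‖ := by linarith
      have h1 : DifferentiableAt ℂ (fun ζ => - cauchyTransform φ (r / 2) ζ) ζ := by
        refine (analyticOnNhd_cauchyTransform (by positivity) (fun ξ hξ => ?_) ζ
          fun h => ?_).differentiableAt.neg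
        · rw [mem_sphere_zero_iff_norm] at hξ
          exact hφ ξ (by linarith) (hann ξ hξ.ge).le
        · rw [mem_sphere_zero_iff_norm] at h
          linarith
      refine h1.congr_of_eventuallyEq ?_
      filter_upwards [(isOpen_lt continuous_const continuous_norm).mem_nhds h0] with ξ hξ
      exact hvout ξ hξ
  have key : ∀ T : ℝ, r < T → ‖ζ₀‖ < T →
      ‖v ζ₀ ^ (m + 1) * P ζ₀‖ ≤ (5 * C) ^ (m + 1) * η + (r * C) ^ (m + 1) * 2 ^ m * T⁻¹ := by
    intro T hrT hT
    have hT0 : 0 < T := hr.trans hrT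
    set D : Set ℂ := {ζ | η < ‖P ζ‖} ∩ ball 0 T with hD
    have hDo : IsOpen D := (isOpen_lt continuous_const hP.continuous.norm).inter isOpen_ball
    have hcl : closure D ⊆ {ζ | η ≤ ‖P ζ‖} ∩ closedBall 0 T :=
      closure_minimal (fun ζ hζ => ⟨show η ≤ ‖P ζ‖ from le_of_lt hζ.1, ball_subset_closedBall hζ.2⟩)
        ((isClosed_le continuous_const hP.continuous.norm).inter isClosed_closedBall)
    have hdiff : DiffContOnCl ℂ (fun ζ => v ζ ^ (m + 1) * P ζ) D :=
      DifferentiableOn.diffContOnCl fun ζ hζ =>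
        (((hvd ζ (hcl hζ).1).pow _).mul (hP ζ)).differentiableWithinAt
    refine Complex.norm_le_of_forall_mem_frontier_norm_le
      (isBounded_ball.subset inter_subset_right) hdiff (fun ζ hζ => ?_)
      (subset_closure ⟨hann ζ₀ (by linarith), mem_ball_zero_iff.2 hT⟩)
    rw [hDo.frontier_eq] at hζ
    obtain ⟨hPζ, hζT⟩ := hcl hζ.1
    rw [mem_closedBall_zero_iff] at hζT
    rw [norm_mul, norm_pow]
    by_cases hlt : ‖ζ‖ < T
    · have hPeq : ‖P ζ‖ ≤ η := not_lt.1 fun h => hζ.2 ⟨h, mem_ball_zero_iff.2 hlt⟩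
      have h1 : ‖v ζ‖ ^ (m + 1) * ‖P ζ‖ ≤ (5 * C) ^ (m + 1) * η := by
        gcongr
        exact hvC ζ hPζ
      have : 0 ≤ (r * C) ^ (m + 1) * 2 ^ m * T⁻¹ := by positivity
      linarith
    · have hζT : ‖ζ‖ = T := le_antisymm hζT (not_lt.1 hlt)
      have h1 : ‖v ζ‖ ≤ r * C * T⁻¹ := by
        rw [hvout ζ (by linarith), norm_neg]
        refine (norm_cauchyTransform_half_le hr hann hφC (by linarith)).trans ?_
        rw [hζT]
        have h2 : (T - r / 2)⁻¹ ≤ (T / 2)⁻¹ := inv_anti₀ (by positivity) (by linarith)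
        calc r / 2 * ((T - r / 2)⁻¹ * C) ≤ r / 2 * ((T / 2)⁻¹ * C) := by gcongr
          _ = r * C * T⁻¹ := by field_simp
      have h2 : ‖P ζ‖ ≤ (2 * T) ^ m := hζT ▸ hgrow ζ (by linarith)
      have h3 : ‖v ζ‖ ^ (m + 1) * ‖P ζ‖ ≤ (r * C * T⁻¹) ^ (m + 1) * (2 * T) ^ m := by gcongr
      have h4 : (r * C * T⁻¹) ^ (m + 1) * (2 * T) ^ m = (r * C) ^ (m + 1) * 2 ^ m * T⁻¹ := by
        rw [mul_pow, mul_pow 2, pow_succ T⁻¹, inv_pow]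
        field_simp
      have : 0 ≤ (5 * C) ^ (m + 1) * η := by positivity
      linarith
  have hlim : Tendsto (fun T : ℝ => (5 * C) ^ (m + 1) * η + (r * C) ^ (m + 1) * 2 ^ m * T⁻¹) atTop
      (𝓝 ((5 * C) ^ (m + 1) * η)) := by
    simpa using (tendsto_inv_atTop_zero.const_mul ((r * C) ^ (m + 1) * 2 ^ m)).const_add
      ((5 * C) ^ (m + 1) * η)
  have := ge_of_tendsto hlim (((eventually_gt_atTop r).and (eventually_gt_atTop ‖ζ₀‖)).mono
    fun T hT => key T hT.1 hT.2)
  rwa [hvout ζ₀ (by linarith), norm_mul, norm_pow, norm_neg] at this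

/-- If the singular part vanishes then the function is given by Cauchy's formula, also on those
components of `{η < ‖P‖}` not meeting the outer annulus. -/
theorem eq_cauchyTransform_zero (hr : 0 < r) (hη : 0 < η) (hP : Differentiable ℂ P)
    (hann : ∀ ζ : ℂ, r / 2 ≤ ‖ζ‖ → η < ‖P ζ‖)
    (hφ : ∀ ζ : ℂ, ‖ζ‖ ≤ r → η ≤ ‖P ζ‖ → AnalyticAt ℂ φ ζ)
    (hφC : ∀ ζ : ℂ, ‖ζ‖ ≤ r → η ≤ ‖P ζ‖ → ‖φ ζ‖ ≤ C)
    (hzero : ∀ ζ : ℂ, ‖ζ‖ = 3 * r / 4 → cauchyTransform φ (r / 2) ζ = 0) (hP0 : η < ‖P 0‖) :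
    φ 0 = cauchyTransform φ r 0 := by
  set v : ℂ → ℂ := fun ζ => φ ζ - cauchyTransform φ r ζ with hv
  have hC : 0 ≤ C := (norm_nonneg _).trans (hφC 0 (by simpa using hr.le) hP0.le)
  have hvd : ∀ ζ : ℂ, ‖ζ‖ ≤ 3 * r / 4 → η ≤ ‖P ζ‖ → DifferentiableAt ℂ v ζ := by
    intro ζ hζ hPζ
    refine (hφ ζ (by linarith) hPζ).differentiableAt.sub
      (analyticOnNhd_cauchyTransform hr.le (fun ξ hξ => ?_) ζ fun h => ?_).differentiableAt
    · rw [mem_sphere_zero_iff_norm] at hξ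
      exact hφ ξ hξ.le (hann ξ (by linarith)).le
    · rw [mem_sphere_zero_iff_norm] at h
      linarith
  set D : Set ℂ := {ζ | η < ‖P ζ‖} ∩ ball 0 (3 * r / 4) with hD
  have hDo : IsOpen D := (isOpen_lt continuous_const hP.continuous.norm).inter isOpen_ball
  have hcl : closure D ⊆ {ζ | η ≤ ‖P ζ‖} ∩ closedBall 0 (3 * r / 4) :=
    closure_minimal (fun ζ hζ => ⟨show η ≤ ‖P ζ‖ from le_of_lt hζ.1, ball_subset_closedBall hζ.2⟩)
      ((isClosed_le continuous_const hP.continuous.norm).inter isClosed_closedBall)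
  have key : ∀ l : ℕ, ‖v 0 * P 0 ^ l‖ ≤ 5 * C * η ^ l := by
    intro l
    have hdiff : DiffContOnCl ℂ (fun ζ => v ζ * P ζ ^ l) D :=
      DifferentiableOn.diffContOnCl fun ζ hζ =>
        ((hvd ζ (mem_closedBall_zero_iff.1 (hcl hζ).2) (hcl hζ).1).mul
          ((hP ζ).pow l)).differentiableWithinAt
    refine Complex.norm_le_of_forall_mem_frontier_norm_le
      (isBounded_ball.subset inter_subset_right) hdiff (fun ζ hζ => ?_)
      (subset_closure ⟨hP0, mem_ball_self (by positivity)⟩)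
    rw [hDo.frontier_eq] at hζ
    obtain ⟨hPζ, hζT⟩ := hcl hζ.1
    rw [mem_closedBall_zero_iff] at hζT
    rw [norm_mul, norm_pow]
    by_cases hlt : ‖ζ‖ < 3 * r / 4
    · have hPeq : ‖P ζ‖ ≤ η := not_lt.1 fun h => hζ.2 ⟨h, mem_ball_zero_iff.2 hlt⟩
      gcongr
      exact norm_sub_cauchyTransform_le hr hann hφC hζT hPζ
    · have hζT : ‖ζ‖ = 3 * r / 4 := le_antisymm hζT (not_lt.1 hlt)
      have h0 : v ζ = 0 := by
        have := eq_cauchyTransform_sub (R := r) (by positivity : 0 < r / 2)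
          (fun ξ h1 h2 => hφ ξ h2 (hann ξ h1).le) (ζ := ζ) (by linarith) (by linarith)
        rw [hzero ζ hζT, sub_zero] at this
        exact sub_eq_zero.2 this
      rw [h0, norm_zero, zero_mul]
      positivity
  have hP0' : 0 < ‖P 0‖ := hη.trans hP0
  have hlim : Tendsto (fun l : ℕ => 5 * C * (η / ‖P 0‖) ^ l) atTop (𝓝 0) := by
    simpa using (tendsto_pow_atTop_nhds_zero_of_lt_one (by positivity)
      ((div_lt_one hP0').2 hP0)).const_mul (5 * C)
  have hle : ‖v 0‖ ≤ 0 := ge_of_tendsto hlim (Eventually.of_forall fun l => by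
    have := key l
    rw [norm_mul, norm_pow] at this
    rw [div_pow, ← mul_div_assoc, le_div_iff₀ (pow_pos hP0' l)]
    exact this)
  exact sub_eq_zero.1 (norm_le_zero_iff.1 hle)

end LemniscateEstimates

theorem eq_zero_of_flat {E : Type*} [NormedAddCommGroup E] [NormedSpace ℂ E] {h : E → ℂ} {ρ : ℝ}
    (hh : AnalyticOnNhd ℂ h (ball 0 ρ))
    (hflat : ∀ j : ℕ, ∃ K, ∀ᶠ x in 𝓝 (0 : E), x ≠ 0 → ‖h x‖ ≤ K * ‖x‖ ^ j) :
    ∀ x ∈ ball (0 : E) ρ, x ≠ 0 → h x = 0 := by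
  intro v hv hv0
  by_contra hne
  have hρ : 0 < ρ := (norm_nonneg v).trans_lt (mem_ball_zero_iff.1 hv)
  have hline := not_eventually_line_eq_zero hh hv hne
  have han : AnalyticAt ℂ (fun s : ℂ => h (s • v)) 0 := by
    refine (hh 0 (mem_ball_self hρ)).comp_of_eq (f := fun s : ℂ => s • v) ?_ (zero_smul _ _)
    exact analyticAt_id.smul analyticAt_const
  obtain ⟨N, k, hk, hk0, hkeq⟩ := (han.exists_eventuallyEq_pow_smul_nonzero_iff).2 hline
  obtain ⟨K, hK⟩ := hflat (N + 1)
  have htend : Tendsto (fun s : ℂ => s • v) (𝓝[≠] 0) (𝓝 0) :=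
    ((by fun_prop : Continuous fun s : ℂ => s • v).tendsto' 0 0 (zero_smul _ _)).mono_left
      nhdsWithin_le_nhds
  have hbound : ∀ᶠ s : ℂ in 𝓝[≠] 0, ‖k s‖ ≤ K * ‖v‖ ^ (N + 1) * ‖s‖ := by
    filter_upwards [htend.eventually hK, hkeq.filter_mono nhdsWithin_le_nhds,
      self_mem_nhdsWithin] with s hs hks hs0
    have h1 := hs (smul_ne_zero hs0 hv0)
    rw [hks, sub_zero, norm_smul, norm_smul, norm_pow] at h1
    have h2 : 0 < ‖s‖ ^ N := pow_pos (norm_pos_iff.2 hs0) N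
    refine le_of_mul_le_mul_left (h1.trans_eq ?_) h2
    ring
  have hlim : Tendsto (fun s : ℂ => K * ‖v‖ ^ (N + 1) * ‖s‖) (𝓝[≠] 0) (𝓝 0) := by
    have : Continuous fun s : ℂ => K * ‖v‖ ^ (N + 1) * ‖s‖ := by fun_prop
    exact (this.tendsto' 0 0 (by simp)).mono_left nhdsWithin_le_nhds
  have := le_of_tendsto_of_tendsto (hk.continuousAt.norm.tendsto.mono_left nhdsWithin_le_nhds)
    hlim hbound
  exact hk0 (norm_le_zero_iff.1 this)

theorem norm_le_mul_infDist {n : ℕ} {g : (Fin n → ℂ) → ℂ} {S : Set (Fin n → ℂ)} {L ε₁ : ℝ}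
    (hL : 0 < L) (hS0 : (0 : Fin n → ℂ) ∈ S) (hgS : ∀ y ∈ S, g y = 0)
    (hLip : ∀ x ∈ ball (0 : Fin n → ℂ) ε₁, ∀ y ∈ ball (0 : Fin n → ℂ) ε₁,
      ‖g x - g y‖ ≤ L * ‖x - y‖) {x : Fin n → ℂ} (hx : x ∈ ball (0 : Fin n → ℂ) (ε₁ / 2)) :
    ‖g x‖ ≤ L * infDist x S := by
  by_contra! hlt
  rw [mem_ball_zero_iff] at hx
  have hq : infDist x S < min (‖g x‖ / L) (ε₁ / 2) := by
    refine lt_min ((lt_div_iff₀' hL).2 hlt) ((infDist_le_dist_of_mem hS0).trans_lt ?_)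
    rwa [dist_zero_right]
  obtain ⟨y, hy, hd⟩ := (infDist_lt_iff ⟨0, hS0⟩).1 hq
  rw [dist_eq_norm, lt_min_iff] at hd
  have hyb : ‖y‖ < ε₁ := by
    have := norm_sub_norm_le y x
    rw [norm_sub_rev] at this
    linarith
  have h1 := hLip x (mem_ball_zero_iff.2 (by linarith [norm_nonneg x])) y (mem_ball_zero_iff.2 hyb)
  rw [hgS y hy, sub_zero] at h1
  have h2 := (lt_div_iff₀' hL).1 hd.1
  linarith

set_option maxHeartbeats 2000000 in
/-- A direction through the origin along which the lines near the origin meet the complement of `U`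
only in small lemniscates. -/
theorem exists_lemniscate_direction {n : ℕ} {ε₀ : ℝ} (hε₀ : 0 < ε₀) {g : (Fin n → ℂ) → ℂ}
    (hgan : AnalyticOnNhd ℂ g (ball (0 : Fin n → ℂ) ε₀)) (hg0 : g 0 = 0)
    (hgne : ∃ x ∈ ball (0 : Fin n → ℂ) ε₀, g x ≠ 0) {S : Set (Fin n → ℂ)}
    (hS : S = {x ∈ ball (0 : Fin n → ℂ) ε₀ | g x = 0}) {ε : ℕ → ℝ} (hε : ∀ d ≥ 1, 0 < ε d)
    {U : Set (Fin n → ℂ)}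
    (hU : ∀ d ≥ 1, ∀ x : Fin n → ℂ, ‖x‖ < ε d → ‖x‖ ^ d < infDist x S → x ∈ U) :
    ∃ (e : Fin n → ℂ) (r ρ : ℝ) (m : ℕ) (s : (Fin n → ℂ) → Fin m → ℂ), 0 < r ∧ 0 < ρ ∧
      (∀ x ∈ ball (0 : Fin n → ℂ) ρ, ∀ i, ‖s x i‖ ≤ r / 4) ∧
      (∀ x ∈ ball (0 : Fin n → ℂ) ρ, infDist x S ^ m ≤ ∏ i, ‖s x i‖) ∧
      ∀ j ≥ 1, ∃ A > 0, ∃ δ > 0, ∀ x ∈ ball (0 : Fin n → ℂ) δ, ∀ ζ : ℂ, ‖ζ‖ ≤ r →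
        A * ‖x‖ ^ j < ∏ i, ‖ζ - s x i‖ → x + ζ • e ∈ U := by
  have hg0an : AnalyticAt ℂ g 0 := hgan 0 (mem_ball_self hε₀)
  have hS0 : (0 : Fin n → ℂ) ∈ S := by rw [hS]; exact ⟨mem_ball_self hε₀, hg0⟩
  have hgS : ∀ y ∈ S, g y = 0 := fun y hy => by rw [hS] at hy; exact hy.2
  -- the direction
  obtain ⟨v, hvb, hgv⟩ := hgne
  have hv0 : ‖v‖ ≠ 0 := norm_ne_zero_iff.2 fun h => hgv (h ▸ hg0)
  have hv0c : (‖v‖ : ℂ) ≠ 0 := Complex.ofReal_ne_zero.2 hv0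
  set e : Fin n → ℂ := (‖v‖ : ℂ)⁻¹ • v with he
  have hnorm_e : ‖e‖ = 1 := by
    rw [he, norm_smul, norm_inv, Complex.norm_real, norm_norm, inv_mul_cancel₀ hv0]
  have hge : ¬ ∀ᶠ ζ : ℂ in 𝓝 0, g (ζ • e) = 0 := fun h => by
    refine not_eventually_line_eq_zero hgan hvb hgv ?_
    have ht : Tendsto (fun ζ : ℂ => ζ * ‖v‖) (𝓝 0) (𝓝 0) :=
      (by fun_prop : Continuous fun ζ : ℂ => ζ * ‖v‖).tendsto' 0 0 (zero_mul _)
    refine (ht.eventually h).mono fun ζ hζ => ?_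
    rwa [he, smul_smul, mul_assoc, mul_inv_cancel₀ hv0c, mul_one] at hζ
  -- the Lipschitz constant
  obtain ⟨L₀, V, hV, hLV⟩ := (hg0an.contDiffAt (n := 1)).exists_lipschitzOnWith
  obtain ⟨ε₁, hε₁, hε₁V⟩ := Metric.mem_nhds_iff.1 (inter_mem hV (ball_mem_nhds 0 hε₀))
  set L : ℝ := L₀ + 1 with hLdef
  have hL : 0 < L := by positivity
  have hLip : ∀ x ∈ ball (0 : Fin n → ℂ) ε₁, ∀ y ∈ ball (0 : Fin n → ℂ) ε₁,
      ‖g x - g y‖ ≤ L * ‖x - y‖ := fun x hx y hy => by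
    have h1 := hLV.dist_le_mul x (hε₁V hx).1 y (hε₁V hy).1
    rw [dist_eq_norm, dist_eq_norm] at h1
    refine h1.trans (mul_le_mul_of_nonneg_right ?_ (norm_nonneg _))
    simp [hLdef]
  -- the Weierstrass polynomial
  have hGan : AnalyticAt ℂ (fun p : (Fin n → ℂ) × ℂ => g (p.1 + p.2 • e)) 0 :=
    hg0an.comp_of_eq (f := fun p : (Fin n → ℂ) × ℂ => p.1 + p.2 • e)
      (analyticAt_fst.add (analyticAt_snd.smul analyticAt_const)) (by simp)
  have hWn : {p : (Fin n → ℂ) × ℂ | p.1 + p.2 • e ∈ ball (0 : Fin n → ℂ) (ε₁ / 2)} ∈ 𝓝 0 := by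
    refine (isOpen_ball.preimage (by fun_prop :
      Continuous fun p : (Fin n → ℂ) × ℂ => p.1 + p.2 • e)).mem_nhds ?_
    simpa using half_pos hε₁
  obtain ⟨r₁, hr₁, ρ₁, hρ₁, m, c, hc, hW, -, -, hG0, hfac⟩ :=
    exists_weierstrass_data hGan (by simpa using hge) hWn
  choose! s u hs hu hcu hgP using hfac
  have hball : ∀ x ∈ ball (0 : Fin n → ℂ) ρ₁, ∀ ζ ∈ closedBall (0 : ℂ) r₁,
      x + ζ • e ∈ ball (0 : Fin n → ℂ) (ε₁ / 2) := fun x hx ζ hζ => hW (mk_mem_prod hx hζ)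
  have hhalf : ball (0 : Fin n → ℂ) (ε₁ / 2) ⊆ ball 0 ε₁ := ball_subset_ball (by linarith)
  have hlow : ∀ x ∈ ball (0 : Fin n → ℂ) ρ₁, ∀ ζ ∈ closedBall (0 : ℂ) r₁,
      c * ∏ i, ‖ζ - s x i‖ ≤ ‖g (x + ζ • e)‖ := fun x hx ζ hζ => by
    have h1 := hgP x hx ζ
    simp only at h1
    rw [h1, norm_mul, norm_prod, mul_comm]
    exact mul_le_mul_of_nonneg_left (hcu x hx ζ hζ) (Finset.prod_nonneg fun _ _ => norm_nonneg _)
  have hm : m ≠ 0 := by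
    rintro rfl
    have := hlow 0 (mem_ball_self hρ₁) 0 (by simpa using hr₁.le)
    simp [hg0] at this
    linarith
  set K : ℝ := L / c + 1 with hK
  have hKpos : 0 < K := by positivity
  have hroot : ∀ x ∈ ball (0 : Fin n → ℂ) ρ₁, ∀ i, ‖s x i‖ ^ m ≤ K * ‖x‖ := by
    intro x hx i
    have hsb : s x i ∈ closedBall (0 : ℂ) r₁ := ball_subset_closedBall (hs x hx i).1
    have hz : ∀ k, s 0 k = 0 := fun k =>
      hG0 _ (ball_subset_closedBall (hs 0 (mem_ball_self hρ₁) k).1) (hs 0 (mem_ball_self hρ₁) k).2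
    have h1 := hlow 0 (mem_ball_self hρ₁) (s x i) hsb
    simp only [hz, sub_zero, Finset.prod_const, Finset.card_univ, Fintype.card_fin] at h1
    have h2 := hLip _ (hhalf (hball 0 (mem_ball_self hρ₁) _ hsb)) _ (hhalf (hball x hx _ hsb))
    have h3 : g (x + s x i • e) = 0 := (hs x hx i).2
    have h4 : (0 : Fin n → ℂ) + s x i • e - (x + s x i • e) = -x := by abel
    rw [h3, sub_zero, h4, norm_neg] at h2
    have h5 : ‖s x i‖ ^ m ≤ L / c * ‖x‖ := by
      rw [div_mul_eq_mul_div, le_div_iff₀ hc]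
      linarith
    have := norm_nonneg x
    rw [hK, add_mul]
    linarith
  -- the radius
  set B : ℝ := (3 / 2) ^ (m + 1) * 2 ^ m with hB
  have hBpos : 0 < B := by positivity
  obtain ⟨r, hr, hrlt⟩ : ∃ r > 0, r < min r₁ (min (ε (m + 1) / 2) (c / L / B)) :=
    exists_between (lt_min hr₁ (lt_min (half_pos (hε _ (by omega))) (by positivity)))
  simp only [lt_min_iff] at hrlt
  obtain ⟨hrr₁, hrε, hrB⟩ := hrlt
  refine ⟨e, r, min ρ₁ ((r / 4) ^ m / K), m, s, hr, by positivity, fun x hx i => ?_, fun x hx => ?_,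
    fun j hj => ?_⟩
  · rw [mem_ball_zero_iff, lt_min_iff, lt_div_iff₀' hKpos] at hx
    refine le_of_pow_le_pow_left₀ hm (by positivity) ?_
    exact (hroot x (mem_ball_zero_iff.2 hx.1) i).trans hx.2.le
  · have hx₁ : x ∈ ball (0 : Fin n → ℂ) ρ₁ := by
      rw [mem_ball_zero_iff, lt_min_iff] at hx
      exact mem_ball_zero_iff.2 hx.1
    have h1 : ∏ _i : Fin m, infDist x S ≤ ∏ i, ‖s x i‖ := by
      refine Finset.prod_le_prod (fun _ _ => infDist_nonneg) fun i _ => ?_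
      have hmem : x + s x i • e ∈ S := by
        rw [hS]
        exact ⟨(hε₁V (hhalf (hball x hx₁ _ (ball_subset_closedBall (hs x hx₁ i).1)))).2,
          (hs x hx₁ i).2⟩
      have := infDist_le_dist_of_mem (x := x) hmem
      rwa [dist_self_add_right, norm_smul, hnorm_e, mul_one] at this
    simpa using h1
  · have hmj : 1 ≤ m * j := Nat.mul_pos (by omega) hj
    refine ⟨L / c * 3 ^ (m * j) * K ^ j, by positivity,
      min (min ρ₁ 1) ((ε (m * j) / 3) ^ m / K), ?_, fun x hx ζ hζ hP => ?_⟩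
    · have := hε _ hmj
      positivity
    rw [mem_ball_zero_iff, lt_min_iff, lt_min_iff, lt_div_iff₀' hKpos] at hx
    obtain ⟨⟨hxρ, hx1⟩, hxε⟩ := hx
    have hx₁ : x ∈ ball (0 : Fin n → ℂ) ρ₁ := mem_ball_zero_iff.2 hxρ
    have hζ₁ : ζ ∈ closedBall (0 : ℂ) r₁ := mem_closedBall_zero_iff.2 (hζ.trans hrr₁.le)
    set R : ℝ := (K * ‖x‖) ^ ((m : ℝ)⁻¹) with hR
    have hR0 : 0 ≤ R := by positivity
    have hRm : R ^ m = K * ‖x‖ := Real.rpow_inv_natCast_pow (by positivity) hm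
    have hsR : ∀ i, ‖s x i‖ ≤ R := fun i =>
      le_of_pow_le_pow_left₀ hm hR0 ((hroot x hx₁ i).trans_eq hRm.symm)
    have hxR : ‖x‖ ≤ R := by
      refine le_of_pow_le_pow_left₀ hm hR0 ?_
      rw [hRm]
      have h1 : ‖x‖ ^ m ≤ ‖x‖ := pow_le_of_le_one (norm_nonneg _) hx1.le hm
      have h2 : 0 ≤ L / c * ‖x‖ := by positivity
      rw [hK, add_mul]
      linarith
    have hRε : R < ε (m * j) / 3 := by
      refine lt_of_pow_lt_pow_left₀ m (by have := hε _ hmj; positivity) ?_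
      rwa [hRm]
    have hNζ : ‖x + ζ • e‖ ≤ ‖x‖ + ‖ζ‖ := by
      refine (norm_add_le _ _).trans_eq ?_
      rw [norm_smul, hnorm_e, mul_one]
    have hq : c / L * ∏ i, ‖ζ - s x i‖ ≤ infDist (x + ζ • e) S := by
      have h1 := norm_le_mul_infDist hL hS0 hgS hLip (hball x hx₁ ζ hζ₁)
      have h2 := hlow x hx₁ ζ hζ₁
      rw [div_mul_eq_mul_div, div_le_iff₀' hL]
      exact h2.trans h1
    rcases le_or_gt (2 * R) ‖ζ‖ with hlarge | hsmall
    · have hζ0 : 0 < ‖ζ‖ := by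
        refine lt_of_le_of_ne (norm_nonneg _) fun h0 => ?_
        have hR00 : R = 0 := by linarith
        have hs0 : ∀ i, s x i = 0 := fun i => norm_le_zero_iff.1 (hR00 ▸ hsR i)
        have : 0 ≤ L / c * 3 ^ (m * j) * K ^ j * ‖x‖ ^ j := by positivity
        simp only [hs0, norm_eq_zero.1 h0.symm, sub_zero, norm_zero, Finset.prod_const,
          Finset.card_univ, Fintype.card_fin, zero_pow hm] at hP
        linarith
      refine hU (m + 1) (by omega) _ (by linarith) (lt_of_lt_of_le ?_ hq)
      have h1 : (‖ζ‖ / 2) ^ m ≤ ∏ i, ‖ζ - s x i‖ := by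
        have : ∏ _i : Fin m, ‖ζ‖ / 2 ≤ ∏ i, ‖ζ - s x i‖ := by
          refine Finset.prod_le_prod (fun _ _ => by positivity) fun i _ => ?_
          have := norm_sub_norm_le ζ (s x i)
          have := hsR i
          linarith
        rwa [Finset.prod_const, Finset.card_univ, Fintype.card_fin] at this
      have h2 : ‖x + ζ • e‖ ^ (m + 1) ≤ (3 / 2 * ‖ζ‖) ^ (m + 1) := by
        gcongr
        linarith
      have h3 : (3 / 2 * ‖ζ‖) ^ (m + 1) = B * ‖ζ‖ * (‖ζ‖ / 2) ^ m := by
        have h5 : (2 : ℝ) ^ m * (‖ζ‖ / 2) ^ m = ‖ζ‖ ^ m := by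
          rw [← mul_pow, mul_div_cancel₀ _ two_ne_zero]
        rw [hB, mul_pow, pow_succ ‖ζ‖, ← h5]
        ring
      have h4 : B * ‖ζ‖ < c / L := by
        rw [lt_div_iff₀' hBpos] at hrB
        exact (mul_le_mul_of_nonneg_left hζ hBpos.le).trans_lt hrB
      calc ‖x + ζ • e‖ ^ (m + 1) ≤ B * ‖ζ‖ * (‖ζ‖ / 2) ^ m := h2.trans_eq h3
        _ < c / L * (‖ζ‖ / 2) ^ m := mul_lt_mul_of_pos_right h4 (by positivity)
        _ ≤ c / L * ∏ i, ‖ζ - s x i‖ := by gcongr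
    · have hN3 : ‖x + ζ • e‖ ≤ 3 * R := by linarith
      refine hU (m * j) hmj _ (by linarith) (lt_of_lt_of_le ?_ hq)
      calc ‖x + ζ • e‖ ^ (m * j) ≤ (3 * R) ^ (m * j) := by gcongr
        _ = c / L * (L / c * 3 ^ (m * j) * K ^ j * ‖x‖ ^ j) := by
          rw [mul_pow, pow_mul R, hRm, mul_pow]
          field_simp
        _ < c / L * ∏ i, ‖ζ - s x i‖ := mul_lt_mul_of_pos_left hP (by positivity)

section Lemniscates

variable {E : Type*} [NormedAddCommGroup E] [NormedSpace ℂ E] [FiniteDimensional ℂ E]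

theorem analyticOnNhd_cauchyTransform_line {f : E → ℂ} {e : E} {V : Set E} (hV : IsOpen V)
    {R : ℝ} (hR : 0 ≤ R) {ζ : ℂ} (hζ : ‖ζ‖ ≠ R)
    (hf : ∀ x ∈ V, ∀ ξ : ℂ, ‖ξ‖ = R → AnalyticAt ℂ f (x + ξ • e)) :
    AnalyticOnNhd ℂ (fun x => cauchyTransform (fun ξ : ℂ => f (x + ξ • e)) R ζ) V := by
  unfold cauchyTransform
  refine fun x hx => analyticAt_const.fun_smul (analyticOnNhd_circleIntegral
    (H := fun x ξ => (ξ - ζ)⁻¹ * f (x + ξ • e)) hV hR (fun z hz ξ hξ => ?_) x hx)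
  rw [mem_sphere_zero_iff_norm] at hξ
  have hne : ξ - ζ ≠ 0 := sub_ne_zero.2 fun h => hζ (h ▸ hξ)
  have h1 : AnalyticAt ℂ (fun p : E × ℂ => (p.2 - ζ)⁻¹) (z, ξ) :=
    (analyticAt_snd.sub analyticAt_const).inv hne
  have h2 : AnalyticAt ℂ (fun p : E × ℂ => f (p.1 + p.2 • e)) (z, ξ) :=
    (hf z hz ξ hξ).comp_of_eq (f := fun p : E × ℂ => p.1 + p.2 • e)
      (analyticAt_fst.add (analyticAt_snd.smul analyticAt_const)) rfl
  exact h1.mul h2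

/-- A bounded analytic function on a set which the lines near the origin in direction `e` leave only
in small lemniscates agrees with an analytic function wherever the origin of the line lies
outside of the lemniscate. -/
theorem exists_analyticOnNhd_eq_of_lemniscates {f : E → ℂ} {U : Set E} {C : ℝ}
    (hfan : AnalyticOnNhd ℂ f U) (hfbd : ∀ x ∈ U, ‖f x‖ ≤ C) {e : E} {r ρ : ℝ} {m : ℕ}
    {s : E → Fin m → ℂ} (hr : 0 < r) (hρ : 0 < ρ) (hs : ∀ x ∈ ball (0 : E) ρ, ∀ i, ‖s x i‖ ≤ r / 4)
    (hole : ∀ j ≥ 1, ∃ A > 0, ∃ δ > 0, ∀ x ∈ ball (0 : E) δ, ∀ ζ : ℂ, ‖ζ‖ ≤ r →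
        A * ‖x‖ ^ j < ∏ i, ‖ζ - s x i‖ → x + ζ • e ∈ U) :
    ∃ ρ' > 0, ∃ F : E → ℂ, AnalyticOnNhd ℂ F (ball 0 ρ') ∧ ∀ j ≥ 1, ∃ A > 0, ∃ δ > 0,
      ∀ x ∈ ball (0 : E) δ, x ≠ 0 → A * ‖x‖ ^ j < ∏ i, ‖s x i‖ → F x = f x := by
  set P : E → ℂ → ℂ := fun x ζ => ∏ i, (ζ - s x i) with hPdef
  have hPn : ∀ x ζ, ‖P x ζ‖ = ∏ i, ‖ζ - s x i‖ := fun x ζ => by rw [hPdef]; simp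
  have hP : ∀ x, Differentiable ℂ (P x) := fun x => by rw [hPdef]; fun_prop
  have hgrow : ∀ x ∈ ball (0 : E) ρ, ∀ ζ : ℂ, r ≤ ‖ζ‖ → ‖P x ζ‖ ≤ (2 * ‖ζ‖) ^ m := by
    intro x hx ζ hζ
    have : ∏ i, ‖ζ - s x i‖ ≤ ∏ _i : Fin m, 2 * ‖ζ‖ := by
      refine Finset.prod_le_prod (fun _ _ => norm_nonneg _) fun i _ => ?_
      have := norm_sub_le ζ (s x i)
      linarith [hs x hx i]
    rwa [Finset.prod_const, Finset.card_univ, Fintype.card_fin, ← hPn] at this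
  have hlow : ∀ x ∈ ball (0 : E) ρ, ∀ ζ : ℂ, r / 2 ≤ ‖ζ‖ → (r / 4) ^ m ≤ ‖P x ζ‖ := by
    intro x hx ζ hζ
    have : ∏ _i : Fin m, r / 4 ≤ ∏ i, ‖ζ - s x i‖ := by
      refine Finset.prod_le_prod (fun _ _ => by positivity) fun i _ => ?_
      have := norm_sub_norm_le ζ (s x i)
      linarith [hs x hx i]
    rwa [Finset.prod_const, Finset.card_univ, Fintype.card_fin, ← hPn] at this
  have hdata : ∀ j ≥ 1, ∃ A > 0, ∃ δ > 0, δ ≤ ρ ∧ ∀ x ∈ ball (0 : E) δ, A * ‖x‖ ^ j < (r / 4) ^ m ∧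
      ∀ ζ : ℂ, ‖ζ‖ ≤ r → x ≠ 0 ∨ r / 2 ≤ ‖ζ‖ → A * ‖x‖ ^ j ≤ ‖P x ζ‖ → x + ζ • e ∈ U := by
    intro j hj
    obtain ⟨A, hA, δ, hδ, hAδ⟩ := hole j hj
    refine ⟨2 * A, by positivity, min (min ρ δ) (min 1 ((r / 4) ^ m / (2 * A))), by positivity,
      (min_le_left _ _).trans (min_le_left _ _), fun x hx => ?_⟩
    rw [mem_ball_zero_iff, lt_min_iff, lt_min_iff, lt_min_iff, lt_div_iff₀' (by positivity)] at hx
    obtain ⟨⟨hxρ, hxδ⟩, hx1, hxr⟩ := hx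
    have hlt : 2 * A * ‖x‖ ^ j < (r / 4) ^ m := by
      refine lt_of_le_of_lt (mul_le_mul_of_nonneg_left ?_ (by positivity)) hxr
      exact pow_le_of_le_one (norm_nonneg _) hx1.le (by omega)
    refine ⟨hlt, fun ζ hζ hor hPζ => hAδ x (mem_ball_zero_iff.2 hxδ) ζ hζ ?_⟩
    rw [← hPn]
    rcases hor with hx0 | hζ2
    · have : 0 < A * ‖x‖ ^ j := mul_pos hA (pow_pos (norm_pos_iff.2 hx0) j)
      linarith
    · have := hlow x (mem_ball_zero_iff.2 hxρ) ζ hζ2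
      have h2 : 0 ≤ A * ‖x‖ ^ j := by positivity
      linarith
  obtain ⟨A₁, hA₁, ρ', hρ', hρρ', h₁⟩ := hdata 1 le_rfl
  have hann : ∀ x ∈ ball (0 : E) ρ', ∀ ζ : ℂ, r / 2 ≤ ‖ζ‖ → ‖ζ‖ ≤ r → x + ζ • e ∈ U :=
    fun x hx ζ hζ hζr => (h₁ x hx).2 ζ hζr (Or.inr hζ)
      ((h₁ x hx).1.le.trans (hlow x (ball_subset_ball hρρ' hx) ζ hζ))
  have hline : ∀ x (ζ : ℂ), x + ζ • e ∈ U → AnalyticAt ℂ (fun ζ : ℂ => f (x + ζ • e)) ζ :=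
    fun x ζ h => (hfan _ h).comp_of_eq (f := fun ζ : ℂ => x + ζ • e)
      (analyticAt_const.add (analyticAt_id.smul analyticAt_const)) rfl
  have hzero : ∀ x ∈ ball (0 : E) ρ', x ≠ 0 → ∀ ζ : ℂ, ‖ζ‖ = 3 * r / 4 →
      cauchyTransform (fun ξ : ℂ => f (x + ξ • e)) (r / 2) ζ = 0 := by
    intro x hx hx0 ζ hζ
    have han : AnalyticOnNhd ℂ
        (fun x => cauchyTransform (fun ξ : ℂ => f (x + ξ • e)) (r / 2) ζ) (ball 0 ρ') :=
      analyticOnNhd_cauchyTransform_line isOpen_ball (by positivity) (by rw [hζ]; linarith)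
        fun y hy ξ hξ => hfan _ (hann y hy ξ hξ.ge (by linarith))
    refine eq_zero_of_pow_eq_zero (n := m + 1)
      (eq_zero_of_flat (h := fun x =>
        cauchyTransform (fun ξ : ℂ => f (x + ξ • e)) (r / 2) ζ ^ (m + 1))
        (fun y hy => (han y hy).pow _) (fun j => ?_) x hx hx0)
    obtain ⟨A, hA, δ, hδ, hδρ, hAδ⟩ := hdata (j + 1) (by omega)
    refine ⟨(5 * C) ^ (m + 1) * A / (r / 4) ^ m * δ, ?_⟩
    filter_upwards [ball_mem_nhds (0 : E) hδ] with y hy hy0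
    have hyρ := ball_subset_ball hδρ hy
    obtain ⟨hη, hyU⟩ := hAδ y hy
    have hy0' := norm_pos_iff.2 hy0
    have h2 := norm_cauchyTransform_pow_mul_le (φ := fun ξ : ℂ => f (y + ξ • e)) (C := C) hr
      (mul_pos hA (pow_pos hy0' (j + 1))) (hP y) (hgrow y hyρ)
      (fun ξ hξ => hη.trans_le (hlow y hyρ ξ hξ))
      (fun ξ hξ hPξ => hline y ξ (hyU ξ hξ (Or.inl hy0) hPξ))
      (fun ξ hξ hPξ => hfbd _ (hyU ξ hξ (Or.inl hy0) hPξ)) hζ.ge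
    have hC : 0 ≤ C := (norm_nonneg _).trans
      (hfbd _ (hyU ζ (by linarith) (Or.inl hy0)
        (hη.le.trans (hlow y hyρ ζ (by linarith)))))
    have h3 := (mul_le_mul_of_nonneg_left (hlow y hyρ ζ (by linarith))
      (pow_nonneg (norm_nonneg _) _)).trans h2
    rw [← le_div_iff₀ (by positivity)] at h3
    rw [norm_pow]
    refine h3.trans ?_
    have h4 : ‖y‖ ≤ δ := (mem_ball_zero_iff.1 hy).le
    calc (5 * C) ^ (m + 1) * (A * ‖y‖ ^ (j + 1)) / (r / 4) ^ m
        = (5 * C) ^ (m + 1) * A / (r / 4) ^ m * ‖y‖ * ‖y‖ ^ j := by ring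
      _ ≤ (5 * C) ^ (m + 1) * A / (r / 4) ^ m * δ * ‖y‖ ^ j := by gcongr
  refine ⟨ρ', hρ', fun x => cauchyTransform (fun ξ : ℂ => f (x + ξ • e)) r 0,
    analyticOnNhd_cauchyTransform_line isOpen_ball hr.le (by rw [norm_zero]; exact hr.ne)
      fun y hy ξ hξ => hfan _ (hann y hy ξ (by linarith) hξ.le), fun j hj => ?_⟩
  obtain ⟨A, hA, δ, hδ, hδρ, hAδ⟩ := hdata j hj
  refine ⟨A, hA, min δ ρ', by positivity, fun y hy hy0 hlt => ?_⟩
  rw [mem_ball_zero_iff, lt_min_iff] at hy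
  have hyδ := mem_ball_zero_iff.2 hy.1
  have hyρ := ball_subset_ball hδρ hyδ
  obtain ⟨hη, hyU⟩ := hAδ y hyδ
  have h2 := eq_cauchyTransform_zero (φ := fun ξ : ℂ => f (y + ξ • e)) (C := C) hr
    (mul_pos hA (pow_pos (norm_pos_iff.2 hy0) j)) (hP y)
    (fun ξ hξ => hη.trans_le (hlow y hyρ ξ hξ))
    (fun ξ hξ hPξ => hline y ξ (hyU ξ hξ (Or.inl hy0) hPξ))
    (fun ξ hξ hPξ => hfbd _ (hyU ξ hξ (Or.inl hy0) hPξ))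
    (fun ξ hξ => hzero y (mem_ball_zero_iff.2 hy.2) hy0 ξ hξ)
    (by rw [hPn]; simpa using hlt)
  refine h2.symm.trans ?_
  simp only [zero_smul, add_zero]

end Lemniscates

/-- **Extension lemma** (Zung). Let `S` be the zero set of a holomorphic
function `g ≢ 0` on the ball `B(0, ε₀) ⊆ ℂⁿ` with `g 0 = 0`, and let
`U = ⋃_{d ≥ 1} U_d` where `U_d = {x : ‖x‖ < ε_d, dist(x, S) > ‖x‖^d}` for an
arbitrary sequence `0 < ε_d ≤ ε₀`. Then every bounded holomorphic function on
`U` extends holomorphically to a neighborhood of `0` in `ℂⁿ`. -/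
theorem bounded_holomorphic_extension
    (n : ℕ) (ε₀ : ℝ) (hε₀ : 0 < ε₀)
    (g : (Fin n → ℂ) → ℂ)
    (hgan : AnalyticOnNhd ℂ g (Metric.ball (0 : Fin n → ℂ) ε₀))
    (hg0 : g 0 = 0)
    (hgne : ∃ x ∈ Metric.ball (0 : Fin n → ℂ) ε₀, g x ≠ 0)
    (S : Set (Fin n → ℂ))
    (hS : S = {x ∈ Metric.ball (0 : Fin n → ℂ) ε₀ | g x = 0})
    (ε : ℕ → ℝ) (hεpos : ∀ d ≥ 1, 0 < ε d) (hεle : ∀ d ≥ 1, ε d ≤ ε₀)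
    (U : Set (Fin n → ℂ))
    (hU : U = ⋃ d ∈ Set.Ici 1,
      {x : Fin n → ℂ | ‖x‖ < ε d ∧ ‖x‖ ^ d < Metric.infDist x S})
    (f : (Fin n → ℂ) → ℂ) (hfan : AnalyticOnNhd ℂ f U)
    (C : ℝ) (hfbd : ∀ x ∈ U, ‖f x‖ ≤ C) :
    ∃ δ > 0, ∃ F : (Fin n → ℂ) → ℂ,
      AnalyticOnNhd ℂ F (Metric.ball (0 : Fin n → ℂ) δ) ∧
      ∀ x ∈ U ∩ Metric.ball (0 : Fin n → ℂ) δ, F x = f x := by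
  have hmemU : ∀ x, x ∈ U ↔ ∃ d ≥ 1, ‖x‖ < ε d ∧ ‖x‖ ^ d < infDist x S := fun x => by
    rw [hU]; simp [and_left_comm]
  obtain ⟨e, r, ρ, m, s, hr, hρ, hs, hsq, hole⟩ := exists_lemniscate_direction hε₀ hgan hg0 hgne hS
    hεpos (U := U) fun d hd x h1 h2 => (hmemU x).2 ⟨d, hd, h1, h2⟩
  obtain ⟨ρ', hρ', F, hF, hFf⟩ := exists_analyticOnNhd_eq_of_lemniscates hfan hfbd hr hρ hs hole
  obtain ⟨N, δ₁, hδ₁, hcomp⟩ := exists_pow_le_infDist_of_component hε₀ hgan hg0 hS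
  obtain ⟨A, hA, δ₂, hδ₂, hA₂⟩ := hFf (N * m + 1) (by omega)
  have hS0 : (0 : Fin n → ℂ) ∈ S := by rw [hS]; exact ⟨mem_ball_self hε₀, hg0⟩
  refine ⟨min (min ρ' δ₁) (min (min ρ δ₂) (1 / A)), by positivity, F,
    hF.mono (ball_subset_ball ((min_le_left _ _).trans (min_le_left _ _))), ?_⟩
  rintro x ⟨hxU, hxδ⟩
  obtain ⟨d, hd, hxε, hxd⟩ := (hmemU x).1 hxU
  rw [mem_ball_zero_iff] at hxδ
  have hev : ∀ᶠ t in 𝓝[>] ‖x‖, t < min (ε d) (min (min ρ' δ₁) (min (min ρ δ₂) (1 / A))) ∧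
      t ^ d < infDist x S :=
    ((eventually_lt_nhds (lt_min hxε hxδ)).and
      (((continuous_pow d).tendsto ‖x‖).eventually_lt_const hxd)).filter_mono nhdsWithin_le_nhds
  obtain ⟨t, ⟨ht, htd⟩, hxt⟩ := (hev.and self_mem_nhdsWithin).exists
  simp only [lt_min_iff] at ht
  obtain ⟨htε, ⟨htρ', htδ₁⟩, ⟨htρ, htδ₂⟩, htA⟩ := ht
  have ht0 : 0 < t := (norm_nonneg x).trans_lt hxt
  obtain ⟨x₁, hx₁, hNx₁⟩ := hcomp t ht0 htδ₁ (t ^ d) (by positivity) x hxt htd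
  set D : Set (Fin n → ℂ) := {x | ‖x‖ < t ∧ t ^ d < infDist x S} with hD
  have hDsub : connectedComponentIn D x ⊆ D := connectedComponentIn_subset D x
  have hDU : D ⊆ U := fun y hy => (hmemU y).2 ⟨d, hd, hy.1.trans htε,
    (pow_le_pow_left₀ (norm_nonneg _) hy.1.le d).trans_lt hy.2⟩
  have hDF : D ⊆ ball 0 ρ' := fun y hy => mem_ball_zero_iff.2 (hy.1.trans htρ')
  have hnear : F =ᶠ[𝓝 x₁] f := by
    have hx₁t : ‖x₁‖ < t := (hDsub hx₁).1
    have hpos : 0 < infDist x₁ S := (pow_pos ht0 N).trans_le hNx₁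
    have hx₁0 : x₁ ≠ 0 := by
      rintro rfl
      rw [infDist_zero_of_mem hS0] at hpos
      exact hpos.false
    have hlt : A * ‖x₁‖ ^ (N * m + 1) < infDist x₁ S ^ m := by
      calc A * ‖x₁‖ ^ (N * m + 1) ≤ A * t ^ (N * m + 1) := by gcongr
        _ = t * A * t ^ (N * m) := by ring
        _ < 1 * t ^ (N * m) := by
          refine mul_lt_mul_of_pos_right ?_ (by positivity)
          rwa [← lt_div_iff₀ hA]
        _ = (t ^ N) ^ m := by rw [one_mul, pow_mul]
        _ ≤ infDist x₁ S ^ m := by gcongr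
    have hopen : ∀ᶠ y in 𝓝 x₁, A * ‖y‖ ^ (N * m + 1) < infDist y S ^ m :=
      (isOpen_lt (by fun_prop) ((continuous_infDist_pt S).pow m)).mem_nhds hlt
    filter_upwards [hopen, (isOpen_lt continuous_norm continuous_const).mem_nhds hx₁t,
      isOpen_ne.mem_nhds hx₁0] with y hy hyt hy0
    have hyt' : ‖y‖ < t := hyt
    exact hA₂ y (mem_ball_zero_iff.2 (hyt'.trans htδ₂)) hy0
      (hy.trans_le (hsq y (mem_ball_zero_iff.2 (hyt'.trans htρ))))
  exact AnalyticOnNhd.eqOn_of_preconnected_of_eventuallyEq (hF.mono (hDsub.trans hDF))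
    (hfan.mono (hDsub.trans hDU)) isPreconnected_connectedComponentIn hx₁ hnear
    (mem_connectedComponentIn ⟨hxt, htd⟩)
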